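/- For every real critical exponent α > 1 there exists a fixed point of the period-doubling renormalization operator: there exist t ∈ (0,1], a C² orientation-preserving diffeomorphism φ of [-1,1] onto itself, and p ∈ (0,1) such that the unimodal map f = φ ∘ q_t satisfies f(p) = p, f(0) ∈ [p,1], and f(f(-p·x)) = -p·f(x) for all x ∈ [-1,1] (i.e. the first return map f² to [-p,p], rescaled affinely by x ↦ -x/p, equals f itself). -/

import Mathlib

/-- The canonical folding map with critical exponent `α` and peak-value `t`:
`q_t(x) = -2t|x|^α + 2t - 1` (here `^` is the real power). -/
noncomputable def foldMap (α t x : ℝ) : ℝ := -2 * t * |x| ^ α + 2 * t - 1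

/-- `IsDiffeo φ d1 d2` : `φ` is an orientation-preserving C² diffeomorphism of `[-1,1]`
onto itself fixing the endpoints, with first derivative `d1 > 0` and continuous second
derivative `d2` (derivatives in the sense of `HasDerivWithinAt` on `[-1,1]`). -/
def IsDiffeo (φ d1 d2 : ℝ → ℝ) : Prop :=
  Set.BijOn φ (Set.Icc (-1 : ℝ) 1) (Set.Icc (-1 : ℝ) 1) ∧
  φ (-1) = -1 ∧ φ 1 = 1 ∧
  (∀ x ∈ Set.Icc (-1 : ℝ) 1, HasDerivWithinAt φ (d1 x) (Set.Icc (-1 : ℝ) 1) x) ∧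
  (∀ x ∈ Set.Icc (-1 : ℝ) 1, HasDerivWithinAt d1 (d2 x) (Set.Icc (-1 : ℝ) 1) x) ∧
  ContinuousOn d2 (Set.Icc (-1 : ℝ) 1) ∧
  (∀ x ∈ Set.Icc (-1 : ℝ) 1, 0 < d1 x)

section Scarf

variable {T I α : Type*} [LinearOrder α]

/-- A set `σ` is dominant with respect to the indices `C` if no point exceeds, for every
index of `C`, the minimum of `σ` for the ranking with this index. -/
def ScarfDominant (ρ : I → T → α) (σ : Finset T) (C : Finset I) : Prop :=
  ∀ y, ∃ i ∈ C, ∀ x ∈ σ, ρ i y ≤ ρ i x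

theorem ScarfDominant.surjOn {ρ : I → T → α} (hρ : ∀ i, Function.Injective (ρ i))
    {σ : Finset T} {C : Finset I} (h : ScarfDominant ρ σ C) {μ : I → T}
    (hμ : ∀ i, ∀ z ∈ σ, ρ i (μ i) ≤ ρ i z) (hμm : ∀ i ∈ C, μ i ∈ σ) :
    ∀ x ∈ σ, ∃ i ∈ C, μ i = x := by
  intro x hx
  obtain ⟨i, hi, h1⟩ := h x
  exact ⟨i, hi, hρ i (le_antisymm (hμ i x hx) (h1 _ (hμm i hi)))⟩

theorem exists_collision_of_card_lt {σ : Finset T} {C : Finset I} {μ : I → T}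
    (hm : ∀ i ∈ C, μ i ∈ σ) (hc : σ.card < C.card) :
    ∃ i ∈ C, ∃ j ∈ C, i ≠ j ∧ μ i = μ j :=
  Finset.exists_ne_map_eq_of_card_lt_of_maps_to hc hm

variable [DecidableEq T] [DecidableEq I]

/-- The door-room incidence relation in Scarf's parity argument. -/
def ScarfIncident (d r : Finset T × Finset I) : Prop :=
  (r.2 = d.2 ∧ ∃ x ∉ d.1, r.1 = insert x d.1) ∨ (r.1 = d.1 ∧ ∃ k ∈ d.2, r.2 = d.2.erase k)

/-- The room reached from the door `(τ, D)` by relaxing the index `k`. -/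
def ScarfNeighbor (ρ : I → T → α) (τ : Finset T) (D : Finset I) (k : I)
    (r : Finset T × Finset I) : Prop :=
  ScarfDominant ρ r.1 r.2 ∧
  (r = (τ, D.erase k) ∨ ∃ x ∉ τ, r = (insert x τ, D) ∧
    (∀ l ∈ D, l ≠ k → ∃ z ∈ τ, ρ l z < ρ l x) ∧ ∀ z ∈ τ, ρ k x < ρ k z)

theorem ScarfNeighbor.existsUnique [Finite T] {ρ : I → T → α} (hρ : ∀ i, Function.Injective (ρ i))
    {τ : Finset T} {D : Finset I} (h : ScarfDominant ρ τ D)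
    {μ : I → T} (hμ : ∀ i, ∀ z ∈ τ, ρ i (μ i) ≤ ρ i z) (hμm : ∀ i, μ i ∈ τ)
    {i j : I} (hi : i ∈ D) (hj : j ∈ D) (hij : i ≠ j) (hμij : μ i = μ j) :
    ∃! r, ScarfNeighbor ρ τ D i r := by
  classical
  have key : ∀ y, (∀ l ∈ D, l ≠ i → ∃ z ∈ τ, ρ l z < ρ l y) → ∀ z ∈ τ, ρ i y ≤ ρ i z := by
    intro y hy
    obtain ⟨l, hl, h1⟩ := h y
    by_cases hli : l = i
    · exact hli ▸ h1
    · obtain ⟨z, hz, h2⟩ := hy l hl hli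
      exact absurd (h1 z hz) (not_le.2 h2)
  by_cases hM : ∃ y, ∀ l ∈ D, l ≠ i → ∃ z ∈ τ, ρ l z < ρ l y
  · obtain ⟨x, hx, hmax⟩ := Set.exists_max_image
      {y | ∀ l ∈ D, l ≠ i → ∃ z ∈ τ, ρ l z < ρ l y} (ρ i) (Set.toFinite _) hM
    have hxτ : x ∉ τ := by
      intro hxt
      obtain ⟨l, hl, hlx⟩ := h.surjOn hρ hμ (fun i _ => hμm i) x hxt
      have : ∀ l ∈ D, l ≠ i → μ l ≠ x := by
        rintro l hl hli rfl
        obtain ⟨z, hz, h2⟩ := hx l hl hli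
        exact absurd (hμ l z hz) (not_le.2 h2)
      by_cases hli : l = i
      · exact this j hj hij.symm (by rw [← hμij, ← hli, hlx])
      · exact this l hl hli hlx
    have hlt : ∀ z ∈ τ, ρ i x < ρ i z := fun z hz =>
      lt_of_le_of_ne (key x hx z hz) (fun he => hxτ (hρ i he ▸ hz))
    refine ⟨(insert x τ, D), ⟨?_, Or.inr ⟨x, hxτ, rfl, hx, hlt⟩⟩, ?_⟩
    · intro y
      by_cases hy : ∀ l ∈ D, l ≠ i → ∃ z ∈ τ, ρ l z < ρ l y
      · refine ⟨i, hi, fun w hw => ?_⟩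
        rcases Finset.mem_insert.1 hw with rfl | hw
        · exact hmax y hy
        · exact key y hy w hw
      · push Not at hy
        obtain ⟨l, hl, hli, h3⟩ := hy
        refine ⟨l, hl, fun w hw => ?_⟩
        rcases Finset.mem_insert.1 hw with rfl | hw
        · obtain ⟨z, hz, h2⟩ := hx l hl hli
          exact (h3 z hz).trans h2.le
        · exact h3 w hw
    · rintro r ⟨hr, rfl | ⟨x', hx'τ, rfl, hx', hlt'⟩⟩
      · obtain ⟨l, hl, h1⟩ := hr x
        obtain ⟨z, hz, h2⟩ := hx l (Finset.mem_of_mem_erase hl) (Finset.ne_of_mem_erase hl)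
        exact absurd (h1 z hz) (not_le.2 h2)
      · have h4 : ρ i x ≤ ρ i x' := by
          obtain ⟨l, hl, h1⟩ := hr x
          by_cases hli : l = i
          · subst hli; exact h1 x' (Finset.mem_insert_self _ _)
          · obtain ⟨z, hz, h2⟩ := hx l hl hli
            exact absurd (h1 z (Finset.mem_insert_of_mem hz)) (not_le.2 h2)
        rw [hρ i (le_antisymm h4 (hmax x' hx'))]
  · push Not at hM
    refine ⟨(τ, D.erase i), ⟨?_, Or.inl rfl⟩, ?_⟩
    · intro y
      obtain ⟨l, hl, hli, h1⟩ := hM y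
      exact ⟨l, Finset.mem_erase.2 ⟨hli, hl⟩, h1⟩
    · rintro r ⟨hr, rfl | ⟨x', hx'τ, rfl, hx', hlt'⟩⟩
      · rfl
      · obtain ⟨l, hl, hli, h1⟩ := hM x'
        obtain ⟨z, hz, h2⟩ := hx' l hl hli
        exact absurd (h1 z hz) (not_le.2 h2)

theorem ScarfNeighbor.of_incident {ρ : I → T → α} (hρ : ∀ i, Function.Injective (ρ i))
    {τ : Finset T} {D : Finset I} (hcard : D.card = τ.card + 1)
    {μ : I → T} (hμ : ∀ i, ∀ z ∈ τ, ρ i (μ i) ≤ ρ i z) (hμm : ∀ i, μ i ∈ τ)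
    {i j : I} (hi : i ∈ D) (hj : j ∈ D) (hij : i ≠ j) (hμij : μ i = μ j)
    {r : Finset T × Finset I} (hr : ScarfDominant ρ r.1 r.2) (hinc : ScarfIncident (τ, D) r) :
    ScarfNeighbor ρ τ D i r ∨ ScarfNeighbor ρ τ D j r := by
  classical
  obtain ⟨σ, C⟩ := r
  rcases hinc with ⟨h1, x, hx, h2⟩ | ⟨h1, k, hk, h2⟩
  · simp only at h1 h2 hr hx
    subst h1 h2
    set ν : I → T := fun l => if ρ l x < ρ l (μ l) then x else μ l with hν
    have hν1 : ∀ i, ∀ z ∈ insert x τ, ρ i (ν i) ≤ ρ i z := by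
      intro l z hz
      simp only [hν]
      rcases Finset.mem_insert.1 hz with rfl | hz
      · split_ifs with h
        · exact le_rfl
        · exact not_lt.1 h
      · split_ifs with h
        · exact h.le.trans (hμ l z hz)
        · exact hμ l z hz
    have hν2 : ∀ l ∈ C, ν l ∈ insert x τ := by
      intro l _
      simp only [hν]
      split_ifs with h
      · exact Finset.mem_insert_self _ _
      · exact Finset.mem_insert_of_mem (hμm l)
    have hs := hr.surjOn hρ hν1 hν2
    have hinj := Finset.inj_on_of_surj_on_of_card_le (s := C) (t := insert x τ) (fun l _ => ν l)
      hν2 (fun b hb => by obtain ⟨l, hl, h⟩ := hs b hb; exact ⟨l, hl, h⟩)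
      (by rw [Finset.card_insert_of_notMem hx]; exact hcard.le)
    obtain ⟨k, hk, hkx⟩ := hs x (Finset.mem_insert_self _ _)
    have hklt : ρ k x < ρ k (μ k) := by
      by_contra h
      simp only [hν, if_neg h] at hkx
      exact hx (hkx ▸ hμm k)
    have hne : ∀ l ∈ C, l ≠ k → ρ l (μ l) < ρ l x := by
      intro l hl hlk
      have h3 : ¬ ρ l x < ρ l (μ l) := by
        intro h
        exact hlk (hinj hl hk (by simp only [hkx]; simp only [hν, if_pos h]))
      exact lt_of_le_of_ne (not_lt.1 h3) (fun he => hx (hρ l he ▸ hμm l))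
    have hN : ScarfNeighbor ρ τ C k (insert x τ, C) :=
      ⟨hr, Or.inr ⟨x, hx, rfl, fun l hl hlk => ⟨μ l, hμm l, hne l hl hlk⟩,
        fun z hz => hklt.trans_le (hμ k z hz)⟩⟩
    by_cases hki : k = i
    · exact Or.inl (hki ▸ hN)
    by_cases hkj : k = j
    · exact Or.inr (hkj ▸ hN)
    exfalso
    have e1 : ν i = μ i := if_neg (not_lt.2 (hne i hi (Ne.symm hki)).le)
    have e2 : ν j = μ j := if_neg (not_lt.2 (hne j hj (Ne.symm hkj)).le)
    exact hij (hinj hi hj (by rw [e1, e2, hμij]))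
  · simp only at h1 h2 hr hk
    subst h1 h2
    have hs := hr.surjOn hρ hμ (fun i _ => hμm i)
    have hinj := Finset.inj_on_of_surj_on_of_card_le (s := D.erase k) (t := σ) (fun l _ => μ l)
      (fun l _ => hμm l) (fun b hb => by obtain ⟨l, hl, h⟩ := hs b hb; exact ⟨l, hl, h⟩)
      (by rw [Finset.card_erase_of_mem hk, hcard]; simp)
    have hN : ScarfNeighbor ρ σ D k (σ, D.erase k) := ⟨hr, Or.inl rfl⟩
    by_cases hki : k = i
    · exact Or.inl (hki ▸ hN)
    by_cases hkj : k = j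
    · exact Or.inr (hkj ▸ hN)
    exact absurd (hinj (Finset.mem_erase.2 ⟨Ne.symm hki, hi⟩)
      (Finset.mem_erase.2 ⟨Ne.symm hkj, hj⟩) hμij) hij

theorem ScarfNeighbor.incident {ρ : I → T → α} {τ : Finset T} {D : Finset I} {k : I}
    (hk : k ∈ D) {r : Finset T × Finset I} (h : ScarfNeighbor ρ τ D k r) :
    ScarfIncident (τ, D) r := by
  rcases h.2 with rfl | ⟨x, hx, rfl, _⟩
  · exact Or.inr ⟨rfl, k, hk, rfl⟩
  · exact Or.inl ⟨rfl, x, hx, rfl⟩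

theorem ScarfNeighbor.ne {ρ : I → T → α} {τ : Finset T} {D : Finset I} {i j : I}
    (hi : i ∈ D) (hij : i ≠ j)
    {r : Finset T × Finset I} (h : ScarfNeighbor ρ τ D i r) (h' : ScarfNeighbor ρ τ D j r) :
    False := by
  rcases h.2 with rfl | ⟨x, hx, rfl, h1, h2⟩
  · rcases h'.2 with h3 | ⟨x, hx, h3, _⟩
    · have := (Prod.ext_iff.1 h3).2
      simp only at this
      have h4 : i ∈ D.erase j := Finset.mem_erase.2 ⟨hij, hi⟩
      rw [← this] at h4
      exact Finset.notMem_erase _ _ h4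
    · have := (Prod.ext_iff.1 h3).1
      simp only at this
      exact hx (this ▸ Finset.mem_insert_self _ _)
  · rcases h'.2 with h3 | ⟨x', hx', h3, h4, h5⟩
    · have := (Prod.ext_iff.1 h3).1
      simp only at this
      exact hx (this ▸ Finset.mem_insert_self _ _)
    · have := (Prod.ext_iff.1 h3).1
      simp only at this
      have hxx : x = x' := by
        have : x ∈ insert x' τ := this ▸ Finset.mem_insert_self _ _
        exact (Finset.mem_insert.1 this).resolve_right hx
      subst hxx
      obtain ⟨z, hz, h6⟩ := h4 i hi hij
      exact absurd (h2 z hz) (not_lt.2 h6.le)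

variable [Fintype T] [Fintype I]

open Classical in
theorem scarf_internal_door {ρ : I → T → α} (hρ : ∀ i, Function.Injective (ρ i))
    {τ : Finset T} {D : Finset I} (hcard : D.card = τ.card + 1) (h : ScarfDominant ρ τ D)
    (hτ : τ.Nonempty) :
    (Finset.univ.filter fun r : Finset T × Finset I =>
      ScarfDominant ρ r.1 r.2 ∧ ScarfIncident (τ, D) r).card = 2 := by
  have : ∀ i, ∃ x ∈ τ, ∀ z ∈ τ, ρ i x ≤ ρ i z := fun i => Finset.exists_min_image τ (ρ i) hτ
  choose μ hμm hμ using this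
  obtain ⟨i, hi, j, hj, hij, hμij⟩ := exists_collision_of_card_lt (C := D) (σ := τ)
    (fun i _ => hμm i) (by omega)
  obtain ⟨r, hr, hru⟩ := ScarfNeighbor.existsUnique hρ h hμ hμm hi hj hij hμij
  obtain ⟨s, hs, hsu⟩ := ScarfNeighbor.existsUnique hρ h hμ hμm hj hi hij.symm hμij.symm
  rw [Finset.card_eq_two]
  refine ⟨r, s, ?_, ?_⟩
  · rintro rfl; exact ScarfNeighbor.ne hi hij hr hs
  · ext t
    simp only [Finset.mem_filter, Finset.mem_univ, true_and, Finset.mem_insert,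
      Finset.mem_singleton]
    constructor
    · rintro ⟨h1, h2⟩
      exact (ScarfNeighbor.of_incident hρ hcard hμ hμm hi hj hij hμij h1 h2).imp (hru t) (hsu t)
    · rintro (rfl | rfl)
      · exact ⟨hr.1, hr.incident hi⟩
      · exact ⟨hs.1, hs.incident hj⟩

open Classical in
theorem scarf_outer_door [Nonempty T] {ρ : I → T → α} (hρ : ∀ i, Function.Injective (ρ i))
    (i : I) :
    (Finset.univ.filter fun r : Finset T × Finset I =>
      ScarfDominant ρ r.1 r.2 ∧ ScarfIncident (∅, {i}) r).card = 1 := by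
  obtain ⟨x, -, hx⟩ := Finset.exists_max_image Finset.univ (ρ i) Finset.univ_nonempty
  rw [Finset.card_eq_one]
  refine ⟨({x}, {i}), ?_⟩
  ext ⟨σ, C⟩
  simp only [Finset.mem_filter, Finset.mem_univ, true_and, Finset.mem_singleton]
  constructor
  · rintro ⟨h1, ⟨h2, y, hy, h3⟩ | ⟨h2, k, hk, h3⟩⟩
    · simp only at h1 h2 h3
      subst h2 h3
      obtain ⟨l, hl, h4⟩ := h1 x
      rw [Finset.mem_singleton] at hl
      subst hl
      have := hρ l (le_antisymm (h4 y (by simp)) (hx y (Finset.mem_univ _)))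
      subst this
      rfl
    · simp only [Finset.mem_singleton] at h1 h2 h3 hk
      subst h2 h3 hk
      obtain ⟨l, hl, _⟩ := h1 x
      simp at hl
  · intro h
    rw [Prod.mk.injEq] at h
    obtain ⟨rfl, rfl⟩ := h
    refine ⟨fun y => ⟨i, by simp, fun w hw => ?_⟩, Or.inl ⟨rfl, x, by simp, by simp⟩⟩
    rw [Finset.mem_singleton.1 hw]
    exact hx y (Finset.mem_univ _)

end Scarf

section ScarfParity

variable {T I α : Type*} [LinearOrder α]

theorem ScarfDominant.mono {ρ : I → T → α} {σ τ : Finset T} {C D : Finset I}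
    (h : ScarfDominant ρ σ C) (hτ : τ ⊆ σ) (hC : C ⊆ D) : ScarfDominant ρ τ D := fun y => by
  obtain ⟨i, hi, h1⟩ := h y
  exact ⟨i, hC hi, fun x hx => h1 x (hτ hx)⟩

variable [DecidableEq I]

/-- A dominant door whose points carry exactly the colours of its indices, except `i₀`. -/
def ScarfGood (ρ : I → T → α) (c : T → I) (i₀ : I) (d : Finset T × Finset I) : Prop :=
  ScarfDominant ρ d.1 d.2 ∧ d.2.card = d.1.card + 1 ∧ i₀ ∈ d.2 ∧ d.1.image c = d.2.erase i₀

theorem ScarfGood.injOn {ρ : I → T → α} {c : T → I} {i₀ : I} {d : Finset T × Finset I}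
    (h : ScarfGood ρ c i₀ d) : Set.InjOn c d.1 := by
  obtain ⟨-, h2, h3, h4⟩ := h
  apply Finset.card_image_iff.1
  rw [h4, Finset.card_erase_of_mem h3, h2, Nat.add_sub_cancel]

variable [DecidableEq T] [Fintype T] [Fintype I]

open Classical in
theorem scarf_room_of_insert {ρ : I → T → α} {c : T → I} {i₀ : I} {τ : Finset T} {C : Finset I}
    {x : T} (hx : x ∉ τ) (hd : ScarfGood ρ c i₀ (τ, C)) (hr : ScarfDominant ρ (insert x τ) C)
    (hn : (insert x τ).image c ≠ C) :
    (Finset.univ.filter fun d : Finset T × Finset I =>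
      ScarfGood ρ c i₀ d ∧ ScarfIncident d (insert x τ, C)).card = 2 := by
  obtain ⟨hdom, hcard, hi₀, himg⟩ := id hd
  simp only at hdom hcard hi₀ himg
  have himg' : (insert x τ).image c = insert (c x) (C.erase i₀) := by
    rw [Finset.image_insert, himg]
  have hcx : c x ≠ i₀ := by
    rintro h
    rw [himg', h, Finset.insert_erase hi₀] at hn
    exact hn rfl
  rw [Finset.card_eq_two]
  by_cases hcC : c x ∈ C
  · have : c x ∈ τ.image c := by rw [himg]; exact Finset.mem_erase.2 ⟨hcx, hcC⟩
    obtain ⟨x', hx', hxx'⟩ := Finset.mem_image.1 this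
    have hne : x' ≠ x := by rintro rfl; exact hx hx'
    have himg2 : ((insert x τ).erase x').image c = C.erase i₀ := by
      rw [← himg]
      ext k
      simp only [Finset.mem_image, Finset.mem_erase, Finset.mem_insert]
      constructor
      · rintro ⟨a, ⟨ha, rfl | h⟩, rfl⟩
        · exact ⟨x', hx', hxx'⟩
        · exact ⟨a, h, rfl⟩
      · rintro ⟨a, ha, rfl⟩
        by_cases hax : a = x'
        · exact ⟨x, ⟨hne.symm, Or.inl rfl⟩, by rw [hax, hxx']⟩
        · exact ⟨a, ⟨hax, Or.inr ha⟩, rfl⟩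
    have hx'm : x' ∈ insert x τ := Finset.mem_insert_of_mem hx'
    refine ⟨(τ, C), ((insert x τ).erase x', C), ?_, ?_⟩
    · intro h
      have h1 := (Prod.ext_iff.1 h).1
      simp only at h1
      rw [h1] at hx'
      exact Finset.notMem_erase _ _ hx'
    · ext ⟨τ', D'⟩
      simp only [Finset.mem_filter, Finset.mem_univ, true_and, Finset.mem_insert,
        Finset.mem_singleton]
      constructor
      · rintro ⟨hg, ⟨h1, y, hy, h2⟩ | ⟨h1, k, hk, h2⟩⟩
        · simp only at h1 hy h2
          subst h1
          have hinj := hg.injOn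
          have hτ' : τ' = (insert x τ).erase y := by rw [h2, Finset.erase_insert hy]
          have hyy : y = x ∨ y = x' := by
            by_contra! hcon
            refine hne (hinj ?_ ?_ hxx')
            · simp only [hτ', Finset.mem_coe, Finset.mem_erase]
              exact ⟨hcon.2.symm, hx'm⟩
            · simp only [hτ', Finset.mem_coe, Finset.mem_erase]
              exact ⟨hcon.1.symm, Finset.mem_insert_self _ _⟩
          rcases hyy with rfl | rfl
          · left; rw [hτ', Finset.erase_insert hx]
          · right; rw [hτ']
        · simp only at h1 hk h2
          exfalso
          obtain ⟨-, hc2, hi2, him2⟩ := hg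
          simp only at hc2 hi2 him2
          rw [← h1, himg', Finset.insert_eq_of_mem (Finset.mem_erase.2 ⟨hcx, hcC⟩)] at him2
          have h5 := congrArg Finset.card him2
          rw [Finset.card_erase_of_mem hi₀, Finset.card_erase_of_mem hi2, hc2, ← h1,
            Finset.card_insert_of_notMem hx, hcard] at h5
          omega
      · rintro (h | h)
        · rw [h]; exact ⟨hd, Or.inl ⟨rfl, x, hx, rfl⟩⟩
        · rw [h]
          refine ⟨⟨hr.mono (Finset.erase_subset _ _) subset_rfl, ?_, hi₀, himg2⟩,
            Or.inl ⟨rfl, x', Finset.notMem_erase _ _, (Finset.insert_erase hx'm).symm⟩⟩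
          simp only
          rw [Finset.card_erase_of_mem hx'm, Finset.card_insert_of_notMem hx, hcard]
          rfl
  · refine ⟨(τ, C), (insert x τ, insert (c x) C), ?_, ?_⟩
    · intro h
      have h1 : τ = insert x τ := (Prod.ext_iff.1 h).1
      rw [h1] at hx
      exact hx (Finset.mem_insert_self _ _)
    · ext ⟨τ', D'⟩
      simp only [Finset.mem_filter, Finset.mem_univ, true_and, Finset.mem_insert,
        Finset.mem_singleton]
      constructor
      · rintro ⟨hg, ⟨h1, y, hy, h2⟩ | ⟨h1, k, hk, h2⟩⟩
        · simp only at h1 hy h2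
          subst h1
          left
          have hτ' : τ' = (insert x τ).erase y := by rw [h2, Finset.erase_insert hy]
          have hyx : y = x := by
            by_contra hcon
            have hxm : x ∈ τ' := by
              rw [hτ']; exact Finset.mem_erase.2 ⟨Ne.symm hcon, Finset.mem_insert_self _ _⟩
            have h3 := Finset.mem_image_of_mem c hxm
            have h4 := hg.2.2.2
            simp only at h4
            rw [h4] at h3
            exact hcC (Finset.mem_of_mem_erase h3)
          rw [hτ', hyx, Finset.erase_insert hx]
        · simp only at h1 hk h2
          right
          obtain ⟨-, hc2, hi2, him2⟩ := hg
          simp only at hc2 hi2 him2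
          rw [← h1, himg'] at him2
          have h5 : c x ∈ D'.erase i₀ := him2 ▸ Finset.mem_insert_self _ _
          have h6 : c x = k := by
            by_contra hcon
            exact hcC (h2 ▸ Finset.mem_erase.2 ⟨hcon, Finset.mem_of_mem_erase h5⟩)
          rw [← h1, h2, h6, Finset.insert_erase hk]
      · rintro (h | h)
        · rw [h]; exact ⟨hd, Or.inl ⟨rfl, x, hx, rfl⟩⟩
        · rw [h]
          refine ⟨⟨hr.mono subset_rfl (Finset.subset_insert _ _), ?_,
            Finset.mem_insert_of_mem hi₀, ?_⟩,
            Or.inr ⟨rfl, c x, Finset.mem_insert_self _ _, (Finset.erase_insert hcC).symm⟩⟩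
          · simp only
            rw [Finset.card_insert_of_notMem hcC, Finset.card_insert_of_notMem hx, hcard]
          · simp only
            rw [himg', Finset.erase_insert_of_ne hcx]

open Classical in
theorem scarf_room_even {ρ : I → T → α} {c : T → I} {i₀ : I} {r : Finset T × Finset I}
    (hr : ScarfDominant ρ r.1 r.2) (hn : r.1.image c ≠ r.2) :
    Even (Finset.univ.filter fun d : Finset T × Finset I =>
      ScarfGood ρ c i₀ d ∧ ScarfIncident d r).card := by
  obtain ⟨σ, C⟩ := r
  simp only at hr hn
  by_cases hex : ∃ d, ScarfGood ρ c i₀ d ∧ ScarfIncident d (σ, C)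
  swap
  · push Not at hex
    rw [Finset.filter_false_of_mem (fun d _ h => hex d h.1 h.2)]
    simp
  obtain ⟨⟨τ, D⟩, hd, ⟨h1, x, hx, h2⟩ | ⟨h1, k, hk, h2⟩⟩ := hex
  · simp only at h1 hx h2
    subst h1 h2
    rw [scarf_room_of_insert hx hd hr hn]
    exact even_two
  · simp only at h1 hk h2
    subst h1 h2
    obtain ⟨hdom, hcard, hi₀, himg⟩ := id hd
    simp only at hdom hcard hi₀ himg
    have hki : k ≠ i₀ := by rintro rfl; exact hn himg
    have : k ∈ σ.image c := by rw [himg]; exact Finset.mem_erase.2 ⟨hki, hk⟩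
    obtain ⟨x, hx, rfl⟩ := Finset.mem_image.1 this
    have hins := Finset.insert_erase hx
    have hxn := Finset.notMem_erase x σ
    have hg : ScarfGood ρ c i₀ (σ.erase x, D.erase (c x)) := by
      refine ⟨hr.mono (Finset.erase_subset _ _) subset_rfl, ?_, ?_, ?_⟩
      · simp only
        rw [Finset.card_erase_of_mem hk, Finset.card_erase_of_mem hx, hcard]
        have := Finset.card_pos.2 ⟨x, hx⟩
        omega
      · exact Finset.mem_erase.2 ⟨hki.symm, hi₀⟩
      · simp only
        rw [Finset.erase_right_comm, ← himg]
        ext l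
        simp only [Finset.mem_image, Finset.mem_erase]
        constructor
        · rintro ⟨a, ⟨ha, h3⟩, rfl⟩
          exact ⟨fun h => ha (hd.injOn h3 hx h), a, h3, rfl⟩
        · rintro ⟨ha, a, h3, rfl⟩
          exact ⟨a, ⟨fun h => ha (h ▸ rfl), h3⟩, rfl⟩
    have := scarf_room_of_insert hxn hg (by rwa [hins]) (by rwa [hins])
    rw [hins] at this
    rw [this]
    exact even_two

/-- Scarf's theorem: every colouring of the points admits a dominant pair whose colours are
exactly its indices. -/
theorem exists_scarf_colorful [Nonempty T] {ρ : I → T → α} (hρ : ∀ i, Function.Injective (ρ i))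
    (c : T → I) : ∃ σ C, ScarfDominant ρ σ C ∧ σ.image c = C := by
  classical
  by_contra! hcon
  obtain ⟨x₀⟩ := ‹Nonempty T›
  have : Nonempty T := ⟨x₀⟩
  set i₀ := c x₀
  set G := Finset.univ.filter fun d : Finset T × Finset I => ScarfGood ρ c i₀ d with hG
  set R := Finset.univ.filter fun r : Finset T × Finset I => ScarfDominant ρ r.1 r.2 with hR
  have hsum := Finset.sum_card_bipartiteAbove_eq_sum_card_bipartiteBelow (s := G) (t := R)
    (ScarfIncident (T := T) (I := I))
  have hright : Even (∑ b ∈ R, (G.bipartiteBelow ScarfIncident b).card) := by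
    apply Finset.even_sum
    intro r hr
    have hr' := (Finset.mem_filter.1 hr).2
    have := scarf_room_even (c := c) (i₀ := i₀) hr' (hcon _ _ hr')
    rwa [Finset.bipartiteBelow, hG, Finset.filter_filter]
  have h0 : ((∅, {i₀}) : Finset T × Finset I) ∈ G := by
    rw [hG, Finset.mem_filter]
    exact ⟨Finset.mem_univ _, fun y => ⟨i₀, by simp, by simp⟩, by simp, by simp, by simp⟩
  have hleft : Odd (∑ a ∈ G, (R.bipartiteAbove ScarfIncident a).card) := by
    rw [← Finset.add_sum_erase _ _ h0, add_comm]
    apply Even.add_odd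
    · apply Finset.even_sum
      intro d hd
      obtain ⟨hne, hd⟩ := Finset.mem_erase.1 hd
      obtain ⟨τ, D⟩ := d
      obtain ⟨hdom, hcard, hi₀, himg⟩ := (Finset.mem_filter.1 hd).2
      simp only at hdom hcard hi₀ himg
      have hτ : τ.Nonempty := by
        rw [Finset.nonempty_iff_ne_empty]
        rintro rfl
        rw [Finset.card_empty, zero_add, Finset.card_eq_one] at hcard
        obtain ⟨a, rfl⟩ := hcard
        rw [Finset.mem_singleton.1 hi₀] at hne
        exact hne rfl
      rw [Finset.bipartiteAbove, hR, Finset.filter_filter, scarf_internal_door hρ hcard hdom hτ]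
      exact even_two
    · rw [Finset.bipartiteAbove, hR, Finset.filter_filter, scarf_outer_door hρ]
      exact odd_one
  rw [hsum] at hleft
  exact (Nat.not_even_iff_odd.2 hleft) hright

end ScarfParity

section Brouwer

/-- The lattice points of the simplex of side `N`. -/
abbrev LatticeSimplex (n N : ℕ) : Type := {x : Fin n → Fin (N + 1) // ∑ i, (x i : ℕ) = N}

theorem exists_latticeSimplex_ge {n N : ℕ} {C : Finset (Fin n)} (hC : C.Nonempty) (m : Fin n → ℕ)
    (h : ∑ i ∈ C, m i ≤ N) : ∃ y : LatticeSimplex n N, ∀ i ∈ C, m i ≤ (y.1 i : ℕ) := by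
  classical
  obtain ⟨k, hk⟩ := hC
  set z : Fin n → ℕ := fun i => (if i ∈ C then m i else 0) + if i = k then N - ∑ i ∈ C, m i else 0
    with hz
  have hsum : ∑ i, z i = N := by
    simp only [hz, Finset.sum_add_distrib, Finset.sum_ite_mem, Finset.univ_inter,
      Finset.sum_ite_eq', Finset.mem_univ, if_true]
    omega
  have hle : ∀ i, z i < N + 1 := fun i =>
    Nat.lt_succ_of_le (hsum ▸
      Finset.single_le_sum (fun i _ => Nat.zero_le (z i)) (Finset.mem_univ i))
  refine ⟨⟨fun i => ⟨z i, hle i⟩, hsum⟩, fun i hi => ?_⟩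
  simp only [hz, if_pos hi]
  omega

theorem exists_lattice_colorful {n N : ℕ} [NeZero n] (c : LatticeSimplex n N → Fin n) :
    ∃ (σ : Finset (LatticeSimplex n N)) (C : Finset (Fin n)), σ.Nonempty ∧ σ.image c = C ∧
      (∀ x ∈ σ, ∀ i ∉ C, (x.1 i : ℕ) ≤ n) ∧
      ∀ x ∈ σ, ∀ y ∈ σ, ∀ i, (x.1 i : ℕ) ≤ y.1 i + n := by
  classical
  have hTne : Nonempty (LatticeSimplex n N) := by
    obtain ⟨y, -⟩ := exists_latticeSimplex_ge (N := N) (C := {(0 : Fin n)}) (by simp) (fun _ => 0)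
      (by simp)
    exact ⟨y⟩
  let e := Fintype.equivFin (LatticeSimplex n N)
  let ρ : Fin n → LatticeSimplex n N → ℕ ×ₗ Fin (Fintype.card (LatticeSimplex n N)) :=
    fun i x => toLex ((x.1 i : ℕ), e x)
  have hρ : ∀ i, Function.Injective (ρ i) := by
    intro i x y h
    have := congrArg (fun p => (ofLex p).2) h
    simpa [ρ] using this
  have hρle : ∀ i x y, ρ i x ≤ ρ i y → (x.1 i : ℕ) ≤ y.1 i := by
    intro i x y h
    rcases (Prod.Lex.le_iff).1 h with h | h
    · exact le_of_lt h
    · exact le_of_eq h.1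
  obtain ⟨σ, C, hdom, himg⟩ := exists_scarf_colorful hρ c
  have hCne : C.Nonempty := by
    obtain ⟨i, hi, -⟩ := hdom hTne.some
    exact ⟨i, hi⟩
  have hσne : σ.Nonempty := by
    rw [← himg] at hCne
    exact Finset.image_nonempty.1 hCne
  have hmin : ∀ i, ∃ x ∈ σ, ∀ z ∈ σ, (x.1 i : ℕ) ≤ z.1 i :=
    fun i => Finset.exists_min_image σ (fun x => (x.1 i : ℕ)) hσne
  choose μ hμm hμ using hmin
  set m : Fin n → ℕ := fun i => (μ i).1 i with hm
  have hbig : N < ∑ i ∈ C, (m i + 1) := by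
    by_contra! hcon
    obtain ⟨y, hy⟩ := exists_latticeSimplex_ge hCne _ hcon
    obtain ⟨i, hi, h1⟩ := hdom y
    have h2 := hρle _ _ _ (h1 _ (hμm i))
    have h3 := hy i hi
    simp only [hm] at h3
    omega
  have hcardC : C.card ≤ n := by simpa using Finset.card_le_univ C
  rw [Finset.sum_add_distrib, Finset.sum_const, smul_eq_mul, mul_one] at hbig
  have hx : ∀ x ∈ σ, ∑ i ∈ C, ((x.1 i : ℕ) - m i) + ∑ i ∈ Cᶜ, (x.1 i : ℕ) ≤ n := by
    intro x hx
    have h1 : ∑ i ∈ C, (x.1 i : ℕ) + ∑ i ∈ Cᶜ, (x.1 i : ℕ) = N := by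
      rw [Finset.sum_add_sum_compl]; exact x.2
    have h2 : ∑ i ∈ C, ((x.1 i : ℕ) - m i) + ∑ i ∈ C, m i = ∑ i ∈ C, (x.1 i : ℕ) := by
      rw [← Finset.sum_add_distrib]
      exact Finset.sum_congr rfl fun i _ => Nat.sub_add_cancel (hμ i x hx)
    omega
  have hout : ∀ x ∈ σ, ∀ i ∉ C, (x.1 i : ℕ) ≤ n := by
    intro x hxs i hi
    have := Finset.single_le_sum (f := fun i => (x.1 i : ℕ)) (fun i _ => Nat.zero_le _)
      (Finset.mem_compl.2 hi)
    have h2 := hx x hxs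
    omega
  refine ⟨σ, C, hσne, himg, hout, fun x hxs y hys i => ?_⟩
  by_cases hi : i ∈ C
  · have := Finset.single_le_sum (f := fun i => (x.1 i : ℕ) - m i) (fun i _ => Nat.zero_le _) hi
    have h2 := hx x hxs
    have h3 : m i ≤ y.1 i := hμ i y hys
    omega
  · have := hout x hxs i hi
    omega

theorem exists_approx_fixed_stdSimplex {n : ℕ} [NeZero n] {G : (Fin n → ℝ) → Fin n → ℝ}
    (hmap : Set.MapsTo G (stdSimplex ℝ (Fin n)) (stdSimplex ℝ (Fin n))) (N : ℕ) :
    ∃ a ∈ stdSimplex ℝ (Fin n), ∀ i, ∃ x ∈ stdSimplex ℝ (Fin n),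
      (∀ j, |x j - a j| ≤ n / (N + 1 : ℝ)) ∧ x i ≤ max (G x i) (n / (N + 1 : ℝ)) := by
  classical
  have hN : (0 : ℝ) < N + 1 := by positivity
  let p : LatticeSimplex n (N + 1) → Fin n → ℝ := fun x i => (x.1 i : ℕ) / (N + 1 : ℝ)
  have hp : ∀ x, p x ∈ stdSimplex ℝ (Fin n) := by
    intro x
    refine ⟨fun i => by positivity, ?_⟩
    simp only [p]
    rw [← Finset.sum_div, div_eq_one_iff_eq hN.ne']
    have := x.2
    exact_mod_cast this
  have hc : ∀ x, ∃ i, p x i ≤ G (p x) i := by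
    intro x
    by_contra! hcon
    have h1 := (hmap (hp x)).2
    have h2 := (hp x).2
    have := Finset.sum_lt_sum_of_nonempty (Finset.univ_nonempty (α := Fin n)) fun i _ => hcon i
    rw [h1, h2] at this
    exact lt_irrefl _ this
  choose c hc using hc
  obtain ⟨σ, C, ⟨a, ha⟩, himg, hout, hnear⟩ := exists_lattice_colorful c
  have hdist : ∀ x ∈ σ, ∀ y ∈ σ, ∀ i, p x i - p y i ≤ n / (N + 1 : ℝ) := by
    intro x hx y hy i
    simp only [p]
    rw [← sub_div]
    gcongr
    have := hnear x hx y hy i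
    have h : ((x.1 i : ℕ) : ℝ) ≤ (y.1 i : ℕ) + n := by exact_mod_cast this
    linarith
  refine ⟨p a, hp a, fun i => ?_⟩
  by_cases hi : i ∈ C
  · rw [← himg] at hi
    obtain ⟨x, hx, rfl⟩ := Finset.mem_image.1 hi
    refine ⟨p x, hp x, fun j => abs_le.2 ⟨?_, hdist x hx a ha j⟩, le_max_of_le_left (hc x)⟩
    linarith [hdist a ha x hx j]
  · refine ⟨p a, hp a, fun j => ?_, le_max_of_le_right ?_⟩
    · simp only [sub_self, abs_zero]; positivity
    · simp only [p]
      gcongr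
      exact hout a ha i hi

/-- Brouwer's fixed point theorem on the standard simplex. -/
theorem exists_fixed_stdSimplex {n : ℕ} [NeZero n] {G : (Fin n → ℝ) → Fin n → ℝ}
    (hG : ContinuousOn G (stdSimplex ℝ (Fin n)))
    (hmap : Set.MapsTo G (stdSimplex ℝ (Fin n)) (stdSimplex ℝ (Fin n))) :
    ∃ x ∈ stdSimplex ℝ (Fin n), G x = x := by
  choose a ha x hx hxa hxG using exists_approx_fixed_stdSimplex hmap
  obtain ⟨b, hb, φ, hφ, hlim⟩ := (isCompact_stdSimplex ℝ (Fin n)).tendsto_subseq ha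
  have h0 : Filter.Tendsto (fun N : ℕ => (n : ℝ) / ((φ N : ℝ) + 1)) Filter.atTop (nhds 0) := by
    have := (tendsto_const_div_atTop_nhds_zero_nat (n : ℝ)).comp
      ((Filter.tendsto_add_atTop_nat 1).comp hφ.tendsto_atTop)
    simpa [Function.comp_def] using this
  have hle : ∀ i, b i ≤ G b i := by
    intro i
    have hxl : Filter.Tendsto (fun N => x (φ N) i) Filter.atTop (nhds b) := by
      rw [tendsto_pi_nhds] at hlim ⊢
      intro j
      have h1 : Filter.Tendsto (fun N => x (φ N) i j - a (φ N) j) Filter.atTop (nhds 0) :=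
        squeeze_zero_norm (fun N => hxa (φ N) i j) h0
      have := h1.add (hlim j)
      simpa using this
    have hGl : Filter.Tendsto (fun N => G (x (φ N) i)) Filter.atTop (nhds (G b)) :=
      ((hG b hb).tendsto.comp (tendsto_nhdsWithin_iff.2
        ⟨hxl, Filter.Eventually.of_forall fun N => hx (φ N) i⟩))
    have h2 := ((tendsto_pi_nhds.1 hGl i).max h0)
    rw [max_eq_left ((hmap hb).1 i)] at h2
    exact le_of_tendsto_of_tendsto' (tendsto_pi_nhds.1 hxl i) h2 fun N => hxG (φ N) i
  refine ⟨b, hb, ?_⟩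
  by_contra hne
  obtain ⟨i, hi⟩ := Function.ne_iff.1 hne
  have := Finset.sum_lt_sum (fun i _ => hle i)
    ⟨i, Finset.mem_univ i, lt_of_le_of_ne (hle i) hi.symm⟩
  rw [hb.2, (hmap hb).2] at this
  exact lt_irrefl _ this

end Brouwer

section Schauder

variable {E : Type*} [NormedAddCommGroup E] [NormedSpace ℝ E]

theorem exists_approx_fixed_of_compact_convex {K : Set E} (hK : IsCompact K) (hconv : Convex ℝ K)
    (hne : K.Nonempty) {T : E → E} (hT : ContinuousOn T K) (hmap : Set.MapsTo T K K) {ε : ℝ}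
    (hε : 0 < ε) : ∃ y ∈ K, dist y (T y) ≤ ε := by
  classical
  obtain ⟨t, htK, htfin, hcov⟩ := hK.finite_cover_balls hε
  obtain ⟨n, f, -, hft⟩ := htfin.fin_param
  have hfK : ∀ i, f i ∈ K := fun i => htK (hft ▸ Set.mem_range_self i)
  have hcov' : ∀ x ∈ K, ∃ i, dist x (f i) < ε := by
    intro x hx
    obtain ⟨y, hy, hxy⟩ := Set.mem_iUnion₂.1 (hcov hx)
    rw [← hft] at hy
    obtain ⟨i, rfl⟩ := hy
    exact ⟨i, hxy⟩
  have hn : NeZero n := by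
    constructor
    rintro rfl
    obtain ⟨i, -⟩ := hcov' _ hne.some_mem
    exact i.elim0
  let h : Fin n → E → ℝ := fun i x => max 0 (ε - dist x (f i))
  have hh0 : ∀ i x, 0 ≤ h i x := fun i x => le_max_left _ _
  have hhc : ∀ i, Continuous (h i) := fun i => by simp only [h]; fun_prop
  have hS : ∀ x ∈ K, 0 < ∑ i, h i x := by
    intro x hx
    obtain ⟨i, hi⟩ := hcov' x hx
    exact Finset.sum_pos' (fun i _ => hh0 i x)
      ⟨i, Finset.mem_univ _, lt_max_of_lt_right (sub_pos.2 hi)⟩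
  let P : (Fin n → ℝ) → E := fun w => ∑ i, w i • f i
  have hPc : Continuous P := by simp only [P]; fun_prop
  have hPK : Set.MapsTo P (stdSimplex ℝ (Fin n)) K := fun w hw =>
    hconv.sum_mem (fun i _ => hw.1 i) hw.2 fun i _ => hfK i
  let l : E → Fin n → ℝ := fun x i => h i x / ∑ j, h j x
  have hlc : ContinuousOn l K := by
    rw [continuousOn_pi]
    intro i
    exact (hhc i).continuousOn.div (continuous_finsetSum _ fun j _ => hhc j).continuousOn
      fun x hx => (hS x hx).ne'
  have hls : ∀ x ∈ K, l x ∈ stdSimplex ℝ (Fin n) := by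
    intro x hx
    refine ⟨fun i => div_nonneg (hh0 i x) (hS x hx).le, ?_⟩
    simp only [l]
    rw [← Finset.sum_div, div_self (hS x hx).ne']
  obtain ⟨w, hw, hwf⟩ := exists_fixed_stdSimplex (G := fun w => l (T (P w)))
    (hlc.comp (hT.comp hPc.continuousOn hPK) fun w hw => hmap (hPK hw))
    fun w hw => hls _ (hmap (hPK hw))
  refine ⟨P w, hPK hw, ?_⟩
  set z := T (P w) with hz
  have hzw : ∀ i, w i * dist (f i) z ≤ w i * ε := by
    intro i
    rw [← hwf]
    by_cases hi : h i z = 0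
    · simp [l, hi]
    · refine mul_le_mul_of_nonneg_left ?_ ((hls z (hmap (hPK hw))).1 i)
      by_contra! hcon
      exact hi (max_eq_left (by rw [dist_comm]; linarith))
  have h1 : P w - z = ∑ i, w i • (f i - z) := by
    simp only [P, smul_sub, Finset.sum_sub_distrib]
    rw [← Finset.sum_smul, hw.2, one_smul]
  rw [dist_eq_norm, h1]
  calc ‖∑ i, w i • (f i - z)‖ ≤ ∑ i, ‖w i • (f i - z)‖ := norm_sum_le _ _
    _ = ∑ i, w i * dist (f i) z := Finset.sum_congr rfl fun i _ => by
        rw [norm_smul, Real.norm_of_nonneg (hw.1 i), dist_eq_norm]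
    _ ≤ ∑ i, w i * ε := Finset.sum_le_sum fun i _ => hzw i
    _ = ε := by rw [← Finset.sum_mul, hw.2, one_mul]

/-- Schauder's fixed point theorem for compact convex sets of a normed space. -/
theorem exists_fixed_of_compact_convex {K : Set E} (hK : IsCompact K) (hconv : Convex ℝ K)
    (hne : K.Nonempty) {T : E → E} (hT : ContinuousOn T K) (hmap : Set.MapsTo T K K) :
    ∃ y ∈ K, T y = y := by
  obtain ⟨y, hy, hmin⟩ := hK.exists_isMinOn hne
    (continuous_dist.comp_continuousOn (continuousOn_id.prodMk hT))
  refine ⟨y, hy, ?_⟩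
  by_contra hcon
  have hpos : 0 < dist y (T y) := dist_pos.2 (Ne.symm hcon)
  obtain ⟨z, hz, h⟩ := exists_approx_fixed_of_compact_convex hK hconv hne hT hmap (half_pos hpos)
  have h1 : dist y (T y) ≤ dist z (T z) := hmin hz
  linarith

end Schauder

section Concave

theorem ConcaveOn.three_point {s : Set ℝ} {f : ℝ → ℝ} (hf : ConcaveOn ℝ s f) {x y z : ℝ}
    (hx : x ∈ s) (hz : z ∈ s) (hxy : x ≤ y) (hyz : y ≤ z) :
    (z - y) * f x + (y - x) * f z ≤ (z - x) * f y := by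
  rcases (hxy.trans hyz).eq_or_lt with h | h
  · have : x = y := by linarith
    subst this h
    simp
  · have hpos : 0 < z - x := sub_pos.2 h
    have := hf.2 hx hz
      (div_nonneg (sub_nonneg.2 hyz) hpos.le) (div_nonneg (sub_nonneg.2 hxy) hpos.le)
      (by field_simp; ring)
    have h2 : ((z - y) / (z - x)) • x + ((y - x) / (z - x)) • z = y := by
      simp only [smul_eq_mul]; field_simp; ring
    rw [h2] at this
    simp only [smul_eq_mul] at this
    have h3 := mul_le_mul_of_nonneg_left this hpos.le
    have h4 : (z - x) * ((z - y) / (z - x) * f x + (y - x) / (z - x) * f z)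
        = (z - y) * f x + (y - x) * f z := by field_simp
    linarith

theorem concaveOn_of_three_point {s : Set ℝ} {f : ℝ → ℝ} (hs : Convex ℝ s)
    (h : ∀ x ∈ s, ∀ z ∈ s, ∀ y, x < y → y < z →
      (z - y) * f x + (y - x) * f z ≤ (z - x) * f y) : ConcaveOn ℝ s f := by
  refine LinearOrder.concaveOn_of_lt hs fun x hx z hz hxz a b ha hb hab => ?_
  have hpos : 0 < z - x := sub_pos.2 hxz
  simp only [smul_eq_mul]
  have hb' : b = 1 - a := by linarith
  subst hb'
  have := h x hx z hz (a * x + (1 - a) * z) (by nlinarith) (by nlinarith)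
  refine le_of_mul_le_mul_left ?_ hpos
  calc (z - x) * (a * f x + (1 - a) * f z) = (z - (a * x + (1 - a) * z)) * f x
      + ((a * x + (1 - a) * z) - x) * f z := by ring
    _ ≤ _ := this

theorem hasDerivAt_affine_primitive {x a m k t : ℝ} (ha : a ≠ 0) (ht : a + m * (t - x) ≠ 0) :
    HasDerivAt (fun t => k * ((t - x) / (a * (a + m * (t - x)))))
      (k / (a + m * (t - x)) ^ 2) t := by
  have h1 : HasDerivAt (fun t => t - x) 1 t := (hasDerivAt_id t).sub_const x
  have h2 : HasDerivAt (fun t => a * (a + m * (t - x))) (a * (m * 1)) t :=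
    ((h1.const_mul m).const_add a).const_mul a
  refine ((h1.div h2 (mul_ne_zero ha ht)).const_mul k).congr_deriv ?_
  have h3 : 1 * (a * (a + m * (t - x))) - (t - x) * (a * (m * 1)) = a * a := by ring
  rw [h3]
  generalize a + m * (t - x) = D at ht ⊢
  field_simp

theorem sub_mul_le_of_affine_le {e g : ℝ → ℝ} {k x y a m : ℝ} (hk : 0 ≤ k) (hxy : x ≤ y)
    (hg : ∀ t ∈ Set.Icc x y, HasDerivAt g (k / e t ^ 2) t)
    (hpos : ∀ t ∈ Set.Icc x y, 0 < a + m * (t - x))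
    (hle : ∀ t ∈ Set.Icc x y, a + m * (t - x) ≤ e t) :
    (g y - g x) * (a * (a + m * (y - x))) ≤ k * (y - x) := by
  have ha : 0 < a := by simpa using hpos x ⟨le_rfl, hxy⟩
  have hd : ∀ t ∈ Set.Icc x y, HasDerivAt
      (fun t => g t - k * ((t - x) / (a * (a + m * (t - x)))))
      (k / e t ^ 2 - k / (a + m * (t - x)) ^ 2) t := fun t ht =>
    (hg t ht).sub (hasDerivAt_affine_primitive ha.ne' (hpos t ht).ne')
  have hanti := antitoneOn_of_hasDerivWithinAt_nonpos (convex_Icc x y)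
    (fun t ht => (hd t ht).continuousAt.continuousWithinAt)
    (fun t ht => (hd t (interior_subset ht)).hasDerivWithinAt)
    (fun t ht => by
      have h1 := hpos t (interior_subset ht)
      have h2 := hle t (interior_subset ht)
      rw [sub_nonpos]
      gcongr)
  have := hanti ⟨le_rfl, hxy⟩ ⟨hxy, le_rfl⟩ hxy
  have hy := hpos y ⟨hxy, le_rfl⟩
  simp only [sub_self, zero_div, mul_zero, sub_zero] at this
  have h3 : g y - g x ≤ k * ((y - x) / (a * (a + m * (y - x)))) := by linarith
  calc _ ≤ k * ((y - x) / (a * (a + m * (y - x)))) * (a * (a + m * (y - x))) := by gcongr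
    _ = _ := by rw [mul_assoc, div_mul_cancel₀ _ (mul_pos ha hy).ne']

theorem le_sub_mul_of_le_affine {e g : ℝ → ℝ} {k x y a m : ℝ} (hk : 0 ≤ k) (hxy : x ≤ y)
    (hg : ∀ t ∈ Set.Icc x y, HasDerivAt g (k / e t ^ 2) t)
    (hpos : ∀ t ∈ Set.Icc x y, 0 < e t)
    (hle : ∀ t ∈ Set.Icc x y, e t ≤ a + m * (t - x)) :
    k * (y - x) ≤ (g y - g x) * (a * (a + m * (y - x))) := by
  have hpos' : ∀ t ∈ Set.Icc x y, 0 < a + m * (t - x) := fun t ht => (hpos t ht).trans_le (hle t ht)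
  have ha : 0 < a := by simpa using hpos' x ⟨le_rfl, hxy⟩
  have hd : ∀ t ∈ Set.Icc x y, HasDerivAt
      (fun t => g t - k * ((t - x) / (a * (a + m * (t - x)))))
      (k / e t ^ 2 - k / (a + m * (t - x)) ^ 2) t := fun t ht =>
    (hg t ht).sub (hasDerivAt_affine_primitive ha.ne' (hpos' t ht).ne')
  have hmono := monotoneOn_of_hasDerivWithinAt_nonneg (convex_Icc x y)
    (fun t ht => (hd t ht).continuousAt.continuousWithinAt)
    (fun t ht => (hd t (interior_subset ht)).hasDerivWithinAt)
    (fun t ht => by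
      have h1 := hpos t (interior_subset ht)
      have h2 := hle t (interior_subset ht)
      rw [sub_nonneg]
      gcongr)
  have := hmono ⟨le_rfl, hxy⟩ ⟨hxy, le_rfl⟩ hxy
  have hy := hpos' y ⟨hxy, le_rfl⟩
  simp only [sub_self, zero_div, mul_zero, sub_zero] at this
  have h3 : k * ((y - x) / (a * (a + m * (y - x)))) ≤ g y - g x := by linarith
  calc k * (y - x) = k * ((y - x) / (a * (a + m * (y - x)))) * (a * (a + m * (y - x))) := by
        rw [mul_assoc, div_mul_cancel₀ _ (mul_pos ha hy).ne']
    _ ≤ _ := by gcongr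

/-- A primitive of `k / e ^ 2`, for `e` concave and positive, satisfies the three-point inequality
attached to the left end point. -/
theorem ConcaveOn.primitive_left {e g : ℝ → ℝ} {k x y z : ℝ} (hk : 0 ≤ k)
    (he : ConcaveOn ℝ (Set.Icc x z) e) (hpos : ∀ t ∈ Set.Icc x z, 0 < e t)
    (hg : ∀ t ∈ Set.Icc x z, HasDerivAt g (k / e t ^ 2) t) (hxy : x ≤ y) (hyz : y ≤ z) :
    e x * (g z - g x) * (z - y) ≤ e y * (g z - g y) * (z - x) := by
  rcases hxy.eq_or_lt with rfl | hxy'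
  · exact le_of_eq (by ring)
  have hx : x ∈ Set.Icc x z := ⟨le_rfl, hxy.trans hyz⟩
  have hz : z ∈ Set.Icc x z := ⟨hxy.trans hyz, le_rfl⟩
  have hy : y ∈ Set.Icc x z := ⟨hxy, hyz⟩
  have hyx : 0 < y - x := sub_pos.2 hxy'
  set m := (e y - e x) / (y - x) with hm
  have hm1 : m * (y - x) = e y - e x := by rw [hm]; field_simp
  have hex := hpos x hx
  have hey := hpos y hy
  have h1 := sub_mul_le_of_affine_le (e := e) (g := g) (a := e x) (m := m) hk hxy
    (fun t ht => hg t ⟨ht.1, ht.2.trans hyz⟩)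
    (fun t ht => by
      have h5 : (y - x) * (e x + m * (t - x)) = (y - t) * e x + (t - x) * e y := by
        linear_combination (t - x) * hm1
      have h6 : 0 < (y - t) * e x + (t - x) * e y := by
        rcases ht.1.eq_or_lt with h | h
        · subst h; simp only [sub_self, zero_mul, add_zero]; positivity
        · have := sub_pos.2 h
          have := sub_nonneg.2 ht.2
          positivity
      exact pos_of_mul_pos_right (h5 ▸ h6) hyx.le)
    (fun t ht => by
      have h5 : (y - x) * (e x + m * (t - x)) = (y - t) * e x + (t - x) * e y := by
        linear_combination (t - x) * hm1
      have := he.three_point hx hy ht.1 ht.2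
      exact le_of_mul_le_mul_left (h5 ▸ this) hyx)
  have h2 := le_sub_mul_of_le_affine (e := e) (g := g) (a := e y) (m := m) hk hyz
    (fun t ht => hg t ⟨hxy.trans ht.1, ht.2⟩) (fun t ht => hpos t ⟨hxy.trans ht.1, ht.2⟩)
    (fun t ht => by
      have h5 : (y - x) * (e y + m * (t - y)) = (t - x) * e y - (t - y) * e x := by
        linear_combination (t - y) * hm1
      have := he.three_point hx ⟨hxy.trans ht.1, ht.2⟩ hxy ht.1
      refine le_of_mul_le_mul_left ?_ hyx
      rw [h5]; linarith)
  have e1 : e x + m * (y - x) = e y := by linarith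
  rw [e1] at h1
  have e2 : (e y + m * (z - y)) * (y - x) = e y * (z - x) - e x * (z - y) := by
    linear_combination (z - y) * hm1
  have h3 : e x * (g y - g x) * (z - y) * e y ≤ k * (y - x) * (z - y) := by
    have := mul_le_mul_of_nonneg_right h1 (sub_nonneg.2 hyz)
    linarith
  have h4 : k * (y - x) * (z - y) ≤ (g z - g y) * (e y * (z - x) - e x * (z - y)) * e y := by
    have := mul_le_mul_of_nonneg_right h2 hyx.le
    rw [← e2]
    linarith
  have h5 : e x * (g y - g x) * (z - y) ≤ (g z - g y) * (e y * (z - x) - e x * (z - y)) :=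
    le_of_mul_le_mul_right (h3.trans h4) hey
  linarith

theorem ConcaveOn.primitive_right {e g : ℝ → ℝ} {k x y z : ℝ} (hk : 0 ≤ k)
    (he : ConcaveOn ℝ (Set.Icc x z) e) (hpos : ∀ t ∈ Set.Icc x z, 0 < e t)
    (hg : ∀ t ∈ Set.Icc x z, HasDerivAt g (k / e t ^ 2) t) (hxy : x ≤ y) (hyz : y ≤ z) :
    e z * (g z - g x) * (y - x) ≤ e y * (g y - g x) * (z - x) := by
  have hmem : ∀ t ∈ Set.Icc (-z) (-x), -t ∈ Set.Icc x z := fun t ht =>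
    ⟨by linarith [ht.2], by linarith [ht.1]⟩
  have := ConcaveOn.primitive_left (e := fun t => e (-t)) (g := fun t => -g (-t)) (k := k)
    (x := -z) (y := -y) (z := -x) hk
    (concaveOn_of_three_point (convex_Icc _ _) fun a ha c hc b hab hbc => by
      have := he.three_point (hmem c hc) (hmem a ha) (neg_le_neg hbc.le) (neg_le_neg hab.le)
      linarith)
    (fun t ht => hpos _ (hmem t ht))
    (fun t ht => by
      refine (((hg (-t) (hmem t ht)).comp t (hasDerivAt_neg t)).neg).congr_deriv ?_
      ring)
    (by linarith) (by linarith)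
  simp only [neg_neg] at this
  linarith

/-- If `g` is a primitive of `k / e ^ 2` with `e` concave and positive, and `C` is concave and
nonnegative, then `(C ∘ g) * e` is concave. -/
theorem ConcaveOn.comp_primitive_mul {e g C : ℝ → ℝ} {k u v : ℝ} (hk : 0 < k)
    (he : ConcaveOn ℝ (Set.Icc u v) e) (hpos : ∀ t ∈ Set.Icc u v, 0 < e t)
    (hg : ∀ t ∈ Set.Icc u v, HasDerivAt g (k / e t ^ 2) t) {s : Set ℝ} (hC : ConcaveOn ℝ s C)
    (hC0 : ∀ x ∈ s, 0 ≤ C x) (hmap : Set.MapsTo g (Set.Icc u v) s) :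
    ConcaveOn ℝ (Set.Icc u v) fun y => C (g y) * e y := by
  have hmono : StrictMonoOn g (Set.Icc u v) :=
    strictMonoOn_of_hasDerivWithinAt_pos (convex_Icc _ _)
      (fun t ht => (hg t ht).continuousAt.continuousWithinAt)
      (fun t ht => (hg t (interior_subset ht)).hasDerivWithinAt)
      (fun t ht => div_pos hk (pow_pos (hpos t (interior_subset ht)) 2))
  refine concaveOn_of_three_point (convex_Icc _ _) fun x hx z hz y hxy hyz => ?_
  have hsub : Set.Icc x z ⊆ Set.Icc u v := Set.Icc_subset_Icc hx.1 hz.2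
  have hy : y ∈ Set.Icc u v := hsub ⟨hxy.le, hyz.le⟩
  have he' := he.subset hsub (convex_Icc _ _)
  have h1 := he'.primitive_left hk.le (fun t ht => hpos t (hsub ht)) (fun t ht => hg t (hsub ht))
    hxy.le hyz.le
  have h2 := he'.primitive_right hk.le (fun t ht => hpos t (hsub ht)) (fun t ht => hg t (hsub ht))
    hxy.le hyz.le
  have hgxz : 0 < g z - g x := sub_pos.2 (hmono hx hz (hxy.trans hyz))
  have h3 := hC.three_point (hmap hx) (hmap hz) (hmono hx hy hxy).le (hmono hy hz hyz).le
  have hey := hpos y hy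
  have hCx := hC0 _ (hmap hx)
  have hCz := hC0 _ (hmap hz)
  have hzx : 0 < z - x := by linarith
  refine le_of_mul_le_mul_left ?_ hgxz
  have h4 := mul_le_mul_of_nonneg_right h3 (mul_nonneg hzx.le hey.le)
  have h5 := mul_le_mul_of_nonneg_left h1 hCx
  have h6 := mul_le_mul_of_nonneg_left h2 hCz
  linarith

end Concave

section Concave

theorem ConcaveOn.exists_one_sided_derivs {u v : ℝ} {f : ℝ → ℝ}
    (hf : ConcaveOn ℝ (Set.Icc u v) f) :
    ∃ L R : ℝ → ℝ, ∀ y ∈ Set.Ioo u v, HasDerivWithinAt f (L y) (Set.Iio y) y ∧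
      HasDerivWithinAt f (R y) (Set.Ioi y) y ∧ R y ≤ L y ∧
      (∀ z ∈ Set.Icc u v, y < z → f z - f y ≤ R y * (z - y)) ∧
      (∀ x ∈ Set.Icc u v, x < y → L y * (y - x) ≤ f y - f x) := by
  have hc : ConvexOn ℝ (Set.Icc u v) (-f) := hf.neg
  refine ⟨fun y => -derivWithin (-f) (Set.Iio y) y, fun y => -derivWithin (-f) (Set.Ioi y) y,
    fun y hy => ?_⟩
  have hyi : y ∈ interior (Set.Icc u v) := by rwa [interior_Icc]
  have h1 := hc.hasDerivWithinAt_rightDeriv_of_mem_interior hyi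
  have h2 := hc.hasDerivWithinAt_leftDeriv_of_mem_interior hyi
  refine ⟨?_, ?_, ?_, ?_, ?_⟩
  · simpa using h2.neg
  · simpa using h1.neg
  · exact neg_le_neg (hc.leftDeriv_le_rightDeriv_of_mem_interior hyi)
  · intro z hz hyz
    have := hc.rightDeriv_le_slope_of_mem_interior hyi hz hyz
    rw [slope_def_field, le_div_iff₀ (sub_pos.2 hyz)] at this
    simp only [Pi.neg_apply] at this
    linarith
  · intro x hx hxy
    have := hc.slope_le_leftDeriv_of_mem_interior hx hyi hxy
    rw [slope_def_field, div_le_iff₀ (sub_pos.2 hxy)] at this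
    simp only [Pi.neg_apply] at this
    linarith

theorem ConcaveOn.exists_supergradient {u v : ℝ} {f : ℝ → ℝ} (hf : ConcaveOn ℝ (Set.Icc u v) f)
    {y : ℝ} (hy : y ∈ Set.Ioo u v) : ∃ m, ∀ t ∈ Set.Icc u v, f t ≤ f y + m * (t - y) := by
  obtain ⟨L, R, h⟩ := hf.exists_one_sided_derivs
  obtain ⟨-, -, h1, h2, h3⟩ := h y hy
  refine ⟨R y, fun t ht => ?_⟩
  rcases lt_trichotomy t y with hty | rfl | hty
  · have := h3 t ht hty
    nlinarith
  · simp
  · linarith [h2 t ht hty]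

/-- The Schwarz-Pick type estimate for a primitive of `k / e ^ 2`, with `e` concave. -/
theorem ConcaveOn.primitive_deriv_le {e g : ℝ → ℝ} {k A y : ℝ} (hk : 0 ≤ k)
    (he : ConcaveOn ℝ (Set.Icc (-A) A) e) (hpos : ∀ t ∈ Set.Icc (-A) A, 0 < e t)
    (hg : ∀ t ∈ Set.Icc (-A) A, HasDerivAt g (k / e t ^ 2) t) (hg0 : 0 ≤ g (-A))
    (hy : y ∈ Set.Ioo (-A) A) :
    k / e y ^ 2 * (A ^ 2 - y ^ 2) * g A ≤ 2 * A * (g y * (g A - g y)) := by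
  obtain ⟨m, hm⟩ := he.exists_supergradient hy
  have hyI : y ∈ Set.Icc (-A) A := Set.Ioo_subset_Icc_self hy
  have hey := hpos y hyI
  have h1 := le_sub_mul_of_le_affine (e := e) (g := g) (a := e y) (m := m) hk hy.2.le
    (fun t ht => hg t ⟨hy.1.le.trans ht.1, ht.2⟩) (fun t ht => hpos t ⟨hy.1.le.trans ht.1, ht.2⟩)
    (fun t ht => hm t ⟨hy.1.le.trans ht.1, ht.2⟩)
  have hA : (-A) ∈ Set.Icc (-A) A := ⟨le_rfl, by linarith [hy.1, hy.2]⟩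
  have hA' : A ∈ Set.Icc (-A) A := ⟨by linarith [hy.1, hy.2], le_rfl⟩
  have h2 := le_sub_mul_of_le_affine (e := e) (g := g) (x := -A) (y := y)
    (a := e y + m * (-A - y)) (m := m) hk hy.1.le
    (fun t ht => hg t ⟨ht.1, ht.2.trans hy.2.le⟩) (fun t ht => hpos t ⟨ht.1, ht.2.trans hy.2.le⟩)
    (fun t ht => by linarith [hm t ⟨ht.1, ht.2.trans hy.2.le⟩])
  have e1 : e y + m * (-A - y) + m * (y - -A) = e y := by ring
  rw [e1] at h2
  have hmono : MonotoneOn g (Set.Icc (-A) A) :=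
    monotoneOn_of_hasDerivWithinAt_nonneg (convex_Icc _ _)
      (fun t ht => (hg t ht).continuousAt.continuousWithinAt)
      (fun t ht => (hg t (interior_subset ht)).hasDerivWithinAt)
      (fun t ht => div_nonneg hk (sq_nonneg _))
  have hQ : 0 ≤ g y := hg0.trans (hmono hA hyI hy.1.le)
  have hP : 0 ≤ g A - g y := sub_nonneg.2 (hmono hyI hA' hy.2.le)
  have hlA := (hpos (-A) hA).le.trans (hm _ hA)
  have hAy : 0 ≤ A - y := by linarith [hy.2]
  have hAy' : 0 ≤ A + y := by linarith [hy.1]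
  have h2' : k * (A + y) ≤ g y * ((e y + m * (-A - y)) * e y) := by
    have h5 : (g y - g (-A)) * ((e y + m * (-A - y)) * e y)
        ≤ g y * ((e y + m * (-A - y)) * e y) := by
      apply mul_le_mul_of_nonneg_right (by linarith)
      positivity
    linarith
  have h3 := mul_le_mul_of_nonneg_left h1 (mul_nonneg hQ hAy')
  have h4 := mul_le_mul_of_nonneg_left h2' (mul_nonneg hP hAy)
  have h6 : k * (A ^ 2 - y ^ 2) * g A ≤ 2 * A * (g y * (g A - g y)) * e y ^ 2 := by
    linarith
  have h7 : k / e y ^ 2 * (A ^ 2 - y ^ 2) * g A = k * (A ^ 2 - y ^ 2) * g A / e y ^ 2 := by ring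
  rw [h7, div_le_iff₀ (by positivity)]
  exact h6

theorem ConcaveOn.primitive_deriv_weight_le {e g : ℝ → ℝ} {k A y : ℝ} (hk : 0 ≤ k)
    (he : ConcaveOn ℝ (Set.Icc (-A) A) e) (hpos : ∀ t ∈ Set.Icc (-A) A, 0 < e t)
    (hg : ∀ t ∈ Set.Icc (-A) A, HasDerivAt g (k / e t ^ 2) t) (hg0 : 0 ≤ g (-A))
    (hgA : 0 < g A) (hgA' : g A ≤ A) (hy : y ∈ Set.Ioo (-A) A) :
    k / e y ^ 2 * (A ^ 2 - y ^ 2) ≤ g A / A * (A ^ 2 - g y ^ 2) := by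
  have h := ConcaveOn.primitive_deriv_le hk he hpos hg hg0 hy
  have hA : 0 < A := hgA.trans_le hgA'
  refine le_of_mul_le_mul_right (h.trans ?_) hgA
  have h1 : g A / A * (A ^ 2 - g y ^ 2) * g A = g A ^ 2 * (A ^ 2 - g y ^ 2) / A := by ring
  rw [h1, le_div_iff₀ hA]
  have h2 : g A ^ 2 ≤ A ^ 2 := by gcongr
  have h3 := mul_nonneg (sq_nonneg (g y)) (sub_nonneg.2 h2)
  nlinarith [sq_nonneg (g A * A - A * g y)]

end Concave

section Profile

open MeasureTheory intervalIntegral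

/-- Admissible nonlinearity profiles, extended by constants outside of `[-1, 1]`. -/
structure IsProfile (A : ℝ) (c : ℝ → ℝ) : Prop where
  cont : Continuous c
  concave : ConcaveOn ℝ (Set.Icc (-1) 1) c
  zero : c 0 = 1
  right : ∀ y ∈ Set.Icc (-1 : ℝ) 1, c y * (A - 1) ≤ c 1 * (A - y)
  left : ∀ y ∈ Set.Icc (-1 : ℝ) 1, c y * (A - 1) ≤ c (-1) * (A + y)
  out_right : ∀ x, 1 ≤ x → c x = c 1
  out_left : ∀ x, x ≤ -1 → c x = c (-1)

namespace IsProfile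

variable {A : ℝ} {c : ℝ → ℝ}

theorem exists_mem (h : IsProfile A c) (x : ℝ) : ∃ y ∈ Set.Icc (-1 : ℝ) 1, c x = c y := by
  rcases le_total x (-1) with h1 | h1
  · exact ⟨-1, by norm_num, h.out_left x h1⟩
  rcases le_total 1 x with h2 | h2
  · exact ⟨1, by norm_num, h.out_right x h2⟩
  · exact ⟨x, ⟨h1, h2⟩, rfl⟩

theorem lower (h : IsProfile A c) (hA : 1 < A) (x : ℝ) : (A - 1) / A ≤ c x := by
  obtain ⟨y, hy, hxy⟩ := h.exists_mem x
  rw [hxy, div_le_iff₀ (by linarith)]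
  have h1 := h.right 0 (by norm_num)
  have h2 := h.left 0 (by norm_num)
  rw [h.zero] at h1 h2
  have h3 := h.concave.three_point (x := -1) (z := 1) (by norm_num) (by norm_num) hy.1 hy.2
  have h4 := mul_le_mul_of_nonneg_left h1 (by linarith [hy.1] : 0 ≤ y + 1)
  have h5 := mul_le_mul_of_nonneg_left h2 (by linarith [hy.2] : 0 ≤ 1 - y)
  have h6 := mul_le_mul_of_nonneg_right h3 (by linarith : 0 ≤ A)
  nlinarith

theorem pos (h : IsProfile A c) (hA : 1 < A) (x : ℝ) : 0 < c x :=
  (div_pos (by linarith) (by linarith)).trans_le (h.lower hA x)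

theorem upper (h : IsProfile A c) (hA : 1 < A) (x : ℝ) : c x ≤ 2 := by
  obtain ⟨y, hy, hxy⟩ := h.exists_mem x
  rw [hxy]
  have h1 := h.pos hA 1
  have h2 := h.pos hA (-1)
  rcases le_total 0 y with h0 | h0
  · have := h.concave.three_point (x := -1) (z := y) (by norm_num) hy
      (by norm_num : (-1 : ℝ) ≤ 0) h0
    rw [h.zero] at this
    nlinarith [mul_nonneg h0 h2.le, hy.2]
  · have := h.concave.three_point (x := y) (z := 1) hy (by norm_num) h0 (by norm_num : (0 : ℝ) ≤ 1)
    rw [h.zero] at this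
    nlinarith [mul_nonneg (neg_nonneg.2 h0) h1.le, hy.1]

theorem slope_bound (h : IsProfile A c) (hA : 1 < A) {x y : ℝ} (hx : x ∈ Set.Icc (-1 : ℝ) 1)
    (hy : y ∈ Set.Icc (-1 : ℝ) 1) (hxy : x < y) : |c y - c x| * (A - 1) ≤ 2 * (y - x) := by
  have hA' : 0 < A - 1 := by linarith
  have h1 : (c x - c y) * (A - 1) ≤ 2 * (y - x) := by
    have h2 := h.right x hx
    have h3 := h.right y hy
    have h4 := h.upper hA 1
    have h5 := h.concave.three_point hx (z := 1) (by norm_num) hxy.le hy.2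
    have h7 : 0 < 1 - x := by linarith [hy.2]
    refine le_of_mul_le_mul_left ?_ h7
    have h6 := mul_le_mul_of_nonneg_left h2 (sub_nonneg.2 hxy.le)
    have h8 := mul_le_mul_of_nonneg_right h5 hA'.le
    have h9 := mul_le_mul_of_nonneg_right h4 (mul_nonneg h7.le (sub_nonneg.2 hxy.le))
    linarith
  have h1' : (c y - c x) * (A - 1) ≤ 2 * (y - x) := by
    have h2 := h.left y hy
    have h4 := h.upper hA (-1)
    have h5 := h.concave.three_point (x := -1) (by norm_num) hy hx.1 hxy.le
    have h7 : 0 < 1 + y := by linarith [hx.1]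
    refine le_of_mul_le_mul_left ?_ h7
    have h6 := mul_le_mul_of_nonneg_left h2 (sub_nonneg.2 hxy.le)
    have h8 := mul_le_mul_of_nonneg_right h5 hA'.le
    have h9 := mul_le_mul_of_nonneg_right h4 (mul_nonneg h7.le (sub_nonneg.2 hxy.le))
    linarith
  rcases abs_cases (c y - c x) with ⟨h2, -⟩ | ⟨h2, -⟩ <;> rw [h2] <;> linarith

end IsProfile

/-- The normalisation constant of `profileMap`. -/
noncomputable def profileInt (c : ℝ → ℝ) : ℝ := ∫ x in (0 : ℝ)..1, 1 / c x ^ 2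

/-- The normalised primitive of `-1 / c ^ 2` vanishing at `1`. -/
noncomputable def profileMap (c : ℝ → ℝ) (y : ℝ) : ℝ := (∫ x in y..1, 1 / c x ^ 2) / profileInt c

namespace IsProfile

variable {A : ℝ} {c : ℝ → ℝ}

theorem cont_inv (h : IsProfile A c) (hA : 1 < A) : Continuous fun x => 1 / c x ^ 2 :=
  continuous_const.div (h.cont.pow 2) fun x => (pow_pos (h.pos hA x) 2).ne'

theorem integral_lower (h : IsProfile A c) (hA : 1 < A) {x y : ℝ} (hxy : x ≤ y) :
    (y - x) / 4 ≤ ∫ t in x..y, 1 / c t ^ 2 := by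
  have := integral_mono_on (μ := volume) hxy (f := fun _ => (1 : ℝ) / 4) (g := fun t => 1 / c t ^ 2)
    intervalIntegrable_const ((h.cont_inv hA).intervalIntegrable _ _) fun t _ => by
      have := h.upper hA t
      have := h.pos hA t
      apply one_div_le_one_div_of_le (by positivity)
      nlinarith
  rw [intervalIntegral.integral_const] at this
  simpa [div_eq_mul_inv] using this

theorem integral_upper (h : IsProfile A c) (hA : 1 < A) {x y : ℝ} (hxy : x ≤ y) :
    ∫ t in x..y, 1 / c t ^ 2 ≤ (y - x) * (A / (A - 1)) ^ 2 := by
  have := integral_mono_on (μ := volume) hxy (g := fun _ => (A / (A - 1)) ^ 2)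
    (f := fun t => 1 / c t ^ 2)
    ((h.cont_inv hA).intervalIntegrable _ _) intervalIntegrable_const fun t _ => by
      have h1 := h.lower hA t
      have h2 : 0 < (A - 1) / A := div_pos (by linarith) (by linarith)
      calc 1 / c t ^ 2 ≤ 1 / ((A - 1) / A) ^ 2 := by gcongr
        _ = _ := by
          have : A - 1 ≠ 0 := by linarith
          field_simp
  rw [intervalIntegral.integral_const] at this
  simpa using this

theorem int_pos (h : IsProfile A c) (hA : 1 < A) : 0 < profileInt c :=
  lt_of_lt_of_le (by norm_num) (h.integral_lower hA (zero_le_one (α := ℝ)))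

theorem int_le (h : IsProfile A c) (hA : 1 < A) : profileInt c ≤ (A / (A - 1)) ^ 2 := by
  simpa [profileInt] using h.integral_upper hA (zero_le_one (α := ℝ))

theorem hasDerivAt_map (h : IsProfile A c) (hA : 1 < A) (y : ℝ) :
    HasDerivAt (profileMap c) (-(1 / c y ^ 2 / profileInt c)) y := by
  have := integral_hasDerivAt_left (a := y) (b := 1) ((h.cont_inv hA).intervalIntegrable _ _)
    ((h.cont_inv hA).stronglyMeasurableAtFilter _ _) (h.cont_inv hA).continuousAt
  refine (this.div_const (profileInt c)).congr_deriv ?_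
  ring

theorem map_zero (h : IsProfile A c) (hA : 1 < A) : profileMap c 0 = 1 :=
  div_self (h.int_pos hA).ne'

theorem map_one (_ : IsProfile A c) : profileMap c 1 = 0 := by simp [profileMap]

theorem map_sub (h : IsProfile A c) (hA : 1 < A) (x y : ℝ) :
    profileMap c x - profileMap c y = (∫ t in x..y, 1 / c t ^ 2) / profileInt c := by
  rw [profileMap, profileMap, ← sub_div, ← integral_add_adjacent_intervals
    ((h.cont_inv hA).intervalIntegrable x y) ((h.cont_inv hA).intervalIntegrable y 1)]
  ring

theorem map_sub_lower (h : IsProfile A c) (hA : 1 < A) {x y : ℝ} (hxy : x ≤ y) :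
    ((A - 1) / A) ^ 2 / 4 * (y - x) ≤ profileMap c x - profileMap c y := by
  have hI := h.int_pos hA
  rw [h.map_sub hA, le_div_iff₀ hI]
  refine le_trans ?_ (h.integral_lower hA hxy)
  have h2 := h.int_le hA
  have hm : 0 ≤ ((A - 1) / A) ^ 2 / 4 * (y - x) :=
    mul_nonneg (by positivity) (sub_nonneg.2 hxy)
  refine (mul_le_mul_of_nonneg_left h2 hm).trans_eq ?_
  have h3 : A - 1 ≠ 0 := by linarith
  have h4 : A ≠ 0 := by linarith
  field_simp

theorem map_sub_upper (h : IsProfile A c) (hA : 1 < A) {x y : ℝ} (hxy : x ≤ y) :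
    profileMap c x - profileMap c y ≤ 4 * (A / (A - 1)) ^ 2 * (y - x) := by
  have hI := h.int_pos hA
  have h0 : (1 : ℝ) / 4 ≤ profileInt c := by
    simpa [profileInt] using h.integral_lower hA (zero_le_one (α := ℝ))
  rw [h.map_sub hA, div_le_iff₀ hI]
  refine (h.integral_upper hA hxy).trans ?_
  have := mul_le_mul_of_nonneg_left h0
    (mul_nonneg (by positivity : 0 ≤ 4 * (A / (A - 1)) ^ 2) (sub_nonneg.2 hxy))
  linarith

theorem map_strictAnti (h : IsProfile A c) (hA : 1 < A) : StrictAnti (profileMap c) := by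
  intro x y hxy
  have h1 := h.map_sub_lower hA hxy.le
  have h2 : 0 < (A - 1) / A := div_pos (by linarith) (by linarith)
  have h3 : 0 < ((A - 1) / A) ^ 2 / 4 * (y - x) := mul_pos (by positivity) (sub_pos.2 hxy)
  linarith

theorem map_pos (h : IsProfile A c) (hA : 1 < A) {y : ℝ} (hy : y < 1) : 0 < profileMap c y :=
  h.map_one ▸ h.map_strictAnti hA hy

theorem one_le_map (h : IsProfile A c) (hA : 1 < A) {y : ℝ} (hy : y ≤ 0) : 1 ≤ profileMap c y :=
  h.map_zero hA ▸ (h.map_strictAnti hA).antitone hy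

end IsProfile

end Profile

section Renorm

/-- The inner branch of the renormalization, with scale `s` and exponent `q`. -/
noncomputable def innerMap (c : ℝ → ℝ) (s q y : ℝ) : ℝ :=
  (profileMap c (-(s * y)) / profileMap c (-s)) ^ (1 / q)

/-- The concave function whose inverse square is proportional to the derivative
of `innerMap`. -/
noncomputable def innerWeight (c : ℝ → ℝ) (s q y : ℝ) : ℝ :=
  profileMap c (-(s * y)) ^ ((1 - 1 / q) / 2) * c (-(s * y))

/-- The renormalized profile. -/
noncomputable def renormProfile (c : ℝ → ℝ) (s q y : ℝ) : ℝ :=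
  c (innerMap c s q y) * innerWeight c s q y / c (innerMap c s q 0)

/-- The constant relating `innerMap` and `innerWeight`. -/
noncomputable def innerConst (c : ℝ → ℝ) (s q : ℝ) : ℝ :=
  s / (q * profileInt c) * profileMap c (-s) ^ (-(1 / q))

namespace IsProfile

variable {A : ℝ} {c : ℝ → ℝ} {s q : ℝ}

theorem innerConst_pos (h : IsProfile A c) (hA : 1 < A) (hs : 0 < s) (hq : 1 < q) :
    0 < innerConst c s q :=
  mul_pos (div_pos hs (mul_pos (by linarith) (h.int_pos hA)))
    (Real.rpow_pos_of_pos (h.map_pos hA (by linarith)) _)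

theorem innerWeight_pos (h : IsProfile A c) (hA : 1 < A) {y : ℝ} (hy : -1 < s * y) :
    0 < innerWeight c s q y :=
  mul_pos (Real.rpow_pos_of_pos (h.map_pos hA (by linarith)) _) (h.pos hA _)

theorem innerMap_pos (h : IsProfile A c) (hA : 1 < A) (hs : 0 < s) {y : ℝ} (hy : -1 < s * y) :
    0 < innerMap c s q y :=
  Real.rpow_pos_of_pos (div_pos (h.map_pos hA (by linarith)) (h.map_pos hA (by linarith))) _

theorem innerMap_one (h : IsProfile A c) (hA : 1 < A) (hs : 0 < s) : innerMap c s q 1 = 1 := by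
  rw [innerMap, mul_one, div_self (h.map_pos hA (by linarith)).ne', Real.one_rpow]

theorem hasDerivAt_map_scale (h : IsProfile A c) (hA : 1 < A) (y : ℝ) :
    HasDerivAt (fun y => profileMap c (-(s * y))) (s / profileInt c / c (-(s * y)) ^ 2) y := by
  have h1 : HasDerivAt (fun y => -(s * y)) (-(s * 1)) y := ((hasDerivAt_id y).const_mul s).neg
  refine ((h.hasDerivAt_map hA _).comp y h1).congr_deriv ?_
  ring

theorem hasDerivAt_innerMap (h : IsProfile A c) (hA : 1 < A) (hs : 0 < s) (hq : 1 < q) {y : ℝ}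
    (hy : -1 < s * y) :
    HasDerivAt (innerMap c s q) (innerConst c s q / innerWeight c s q y ^ 2) y := by
  have hV := h.map_pos hA (y := -(s * y)) (by linarith)
  have hV1 := h.map_pos hA (y := -s) (by linarith)
  have hI := h.int_pos hA
  have hc := h.pos hA (-(s * y))
  have h1 := ((h.hasDerivAt_map_scale (s := s) hA y).div_const (profileMap c (-s))).rpow_const
    (p := 1 / q) (Or.inl (div_pos hV hV1).ne')
  refine h1.congr_deriv ?_
  rw [innerWeight, innerConst, Real.div_rpow hV.le hV1.le]
  generalize profileMap c (-(s * y)) = V at *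
  generalize profileMap c (-s) = W at *
  have e1 : (V ^ ((1 - 1 / q) / 2)) ^ 2 = V ^ (1 - 1 / q) := by
    rw [← Real.rpow_natCast, ← Real.rpow_mul hV.le]
    norm_num
  rw [mul_pow, e1]
  have e2 : V ^ (1 / q - 1) = (V ^ (1 - 1 / q))⁻¹ := by
    rw [← Real.rpow_neg hV.le]; congr 1; ring
  have e3 : W ^ (1 / q - 1) = W ^ (1 / q) / W := by
    rw [Real.rpow_sub hV1, Real.rpow_one]
  have e3' : W ^ (-(1 / q)) = (W ^ (1 / q))⁻¹ := Real.rpow_neg hV1.le _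
  rw [e2, e3, e3']
  have h5 : 0 < V ^ (1 - 1 / q) := Real.rpow_pos_of_pos hV _
  have h6 : 0 < W ^ (1 / q) := Real.rpow_pos_of_pos hV1 _
  have hq0 : 0 < q := by linarith
  generalize V ^ (1 - 1 / q) = X at *
  generalize W ^ (1 / q) = Y at *
  field_simp

theorem innerMap_strictMonoOn (h : IsProfile A c) (hA : 1 < A) (hs : 0 < s) (hq : 1 < q) :
    StrictMonoOn (innerMap c s q) {y | -1 < s * y} := by
  intro x hx y hy hxy
  have hx' := h.map_pos hA (y := -(s * x)) (by linarith [show -1 < s * x from hx])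
  have hV1 := h.map_pos hA (y := -s) (by linarith)
  apply Real.rpow_lt_rpow (div_pos hx' hV1).le
  · have := h.map_strictAnti hA (a := -(s * y)) (b := -(s * x)) (by nlinarith)
    gcongr
  · exact div_pos one_pos (by linarith)

theorem innerWeight_concave (h : IsProfile A c) (hA : 1 < A) (hs : 0 < s) (hq : 1 < q) :
    ConcaveOn ℝ (Set.Icc (-(1 / s)) (1 / s)) (innerWeight c s q) := by
  have hmem : ∀ t ∈ Set.Icc (-(1 / s)) (1 / s), -(s * t) ∈ Set.Icc (-1 : ℝ) 1 := by
    intro t ht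
    have h1 := mul_le_mul_of_nonneg_left ht.1 hs.le
    have h2 := mul_le_mul_of_nonneg_left ht.2 hs.le
    have h3 : s * (1 / s) = 1 := by field_simp
    constructor <;> linarith
  have hce : ConcaveOn ℝ (Set.Icc (-(1 / s)) (1 / s)) (fun t => c (-(s * t))) := by
    refine concaveOn_of_three_point (convex_Icc _ _) fun x hx z hz y hxy hyz => ?_
    have := h.concave.three_point (x := -(s * z)) (y := -(s * y)) (z := -(s * x)) (hmem z hz)
      (hmem x hx) (by nlinarith) (by nlinarith)
    refine le_of_mul_le_mul_left ?_ hs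
    linarith
  have hq' : 1 / q < 1 := by rw [div_lt_one (by linarith)]; exact hq
  have hq'' : 0 < 1 / q := by positivity
  exact ConcaveOn.comp_primitive_mul (g := fun t => profileMap c (-(s * t)))
    (k := s / profileInt c) (div_pos hs (h.int_pos hA)) hce
    (fun t _ => h.pos hA _) (fun t _ => h.hasDerivAt_map_scale hA t)
    (Real.concaveOn_rpow (p := (1 - 1 / q) / 2) (by linarith) (by linarith))
    (fun x hx => Real.rpow_nonneg hx _)
    (fun t ht => by
      have := (h.map_strictAnti hA).antitone (hmem t ht).2
      rw [h.map_one] at this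
      exact this)

theorem mem_Icc_of_scale (hs : 0 < s) (hsA : s * A < 1) {y : ℝ} (hy : y ∈ Set.Icc (-A) A) :
    y ∈ Set.Icc (-(1 / s)) (1 / s) := by
  have h3 : A < 1 / s := by rw [lt_div_iff₀ hs]; linarith
  constructor <;> linarith [hy.1, hy.2]

theorem lt_of_scale (hs : 0 < s) (hsA : s * A < 1) {y : ℝ} (hy : -A ≤ y) : -1 < s * y := by
  nlinarith

theorem innerWeight_concave' (h : IsProfile A c) (hA : 1 < A) (hs : 0 < s) (hsA : s * A < 1)
    (hq : 1 < q) : ConcaveOn ℝ (Set.Icc (-A) A) (innerWeight c s q) :=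
  (h.innerWeight_concave hA hs hq).subset (fun _ hy => mem_Icc_of_scale hs hsA hy) (convex_Icc _ _)

theorem innerMap_le_one (h : IsProfile A c) (hA : 1 < A) (hs : 0 < s) (hsA : s * A < 1)
    (hq : 1 < q) {y : ℝ} (hy : y ∈ Set.Icc (-1 : ℝ) 1) : innerMap c s q y ≤ 1 := by
  rw [← h.innerMap_one hA hs (q := q)]
  exact (h.innerMap_strictMonoOn hA hs hq).monotoneOn
    (lt_of_scale hs hsA (by linarith [hy.1])) (lt_of_scale hs hsA (by linarith)) hy.2

theorem innerMap_mem (h : IsProfile A c) (hA : 1 < A) (hs : 0 < s) (hsA : s * A < 1)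
    (hq : 1 < q) {y : ℝ} (hy : y ∈ Set.Icc (-1 : ℝ) 1) : innerMap c s q y ∈ Set.Icc (-1 : ℝ) 1 :=
  ⟨by linarith [h.innerMap_pos hA hs (q := q) (lt_of_scale hs hsA (by linarith [hy.1] : -A ≤ y))],
    h.innerMap_le_one hA hs hsA hq hy⟩

theorem renorm_zero (h : IsProfile A c) (hA : 1 < A) : renormProfile c s q 0 = 1 := by
  rw [renormProfile, innerWeight, mul_zero, neg_zero, h.map_zero hA, h.zero, Real.one_rpow,
    mul_one, mul_one, div_self (h.pos hA _).ne']

theorem renorm_concave (h : IsProfile A c) (hA : 1 < A) (hs : 0 < s) (hsA : s * A < 1)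
    (hq : 1 < q) : ConcaveOn ℝ (Set.Icc (-1) 1) (renormProfile c s q) := by
  have hsub : Set.Icc (-1 : ℝ) 1 ⊆ Set.Icc (-A) A :=
    Set.Icc_subset_Icc (by linarith) hA.le
  have h1 := ConcaveOn.comp_primitive_mul (h.innerConst_pos hA hs hq)
    ((h.innerWeight_concave' hA hs hsA hq).subset hsub (convex_Icc _ _))
    (fun t ht => h.innerWeight_pos hA (lt_of_scale hs hsA (hsub ht).1))
    (fun t ht => h.hasDerivAt_innerMap hA hs hq (lt_of_scale hs hsA (hsub ht).1))
    h.concave (fun x _ => (h.pos hA x).le) (fun t ht => h.innerMap_mem hA hs hsA hq ht)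
  have h2 := h1.smul (inv_pos.2 (h.pos hA (innerMap c s q 0))).le
  refine h2.congr fun y _ => ?_
  simp only [renormProfile, smul_eq_mul]
  rw [div_eq_inv_mul]

theorem renorm_right (h : IsProfile A c) (hA : 1 < A) (hs : 0 < s) (hsA : s * A < 1)
    (hq : 1 < q) (hAA : innerMap c s q A ≤ A) {y : ℝ} (hy : y ∈ Set.Icc (-1 : ℝ) 1) :
    renormProfile c s q y * (A - 1) ≤ renormProfile c s q 1 * (A - y) := by
  have hyA : y ∈ Set.Icc (-A) A := ⟨by linarith [hy.1], by linarith [hy.2]⟩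
  have hsub : Set.Icc y A ⊆ Set.Icc (-A) A := Set.Icc_subset_Icc_left hyA.1
  have hcon := h.innerWeight_concave' hA hs hsA hq
  have h1 := ((hcon.subset hsub (convex_Icc _ _)).primitive_left (h.innerConst_pos hA hs hq).le
    (fun t ht => h.innerWeight_pos hA (lt_of_scale hs hsA (hsub ht).1))
    (fun t ht => h.hasDerivAt_innerMap hA hs hq (lt_of_scale hs hsA (hsub ht).1)) hy.2 hA.le)
  have h2 := hcon.three_point hyA (z := A) ⟨by linarith, le_rfl⟩ hy.2 hA.le
  have heA := h.innerWeight_pos hA (q := q) (lt_of_scale hs hsA (by linarith : -A ≤ A))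
  have hey := h.innerWeight_pos hA (q := q) (lt_of_scale hs hsA hyA.1)
  have he1 := h.innerWeight_pos hA (q := q) (lt_of_scale hs hsA (by linarith : -A ≤ 1))
  have hφy := h.innerMap_mem hA hs hsA hq hy
  have h3 := h.right _ hφy
  rw [renormProfile, renormProfile, h.innerMap_one hA hs] at *
  have hc0 := h.pos hA (innerMap c s q 0)
  have hc1 := h.pos hA 1
  generalize c (innerMap c s q 0) = c0 at *
  generalize c (innerMap c s q y) = cy at *
  generalize innerMap c s q A = B at *
  generalize innerMap c s q y = p at *
  generalize innerWeight c s q y = ey at *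
  generalize innerWeight c s q 1 = e1 at *
  generalize innerWeight c s q A = eA at *
  rw [div_mul_eq_mul_div, div_mul_eq_mul_div]
  refine div_le_div_of_nonneg_right ?_ hc0.le
  have h4 : ey * (A - 1) ≤ e1 * (A - y) := by
    nlinarith [hy.2, mul_nonneg (sub_nonneg.2 hy.2) heA.le]
  have h5 : ey * (A - p) * (A - 1) ≤ e1 * (A - 1) * (A - y) := by
    linarith [mul_le_mul_of_nonneg_left h4 (sub_nonneg.2 hAA)]
  have h6 := mul_le_mul_of_nonneg_right h3 hey.le
  have h7 := mul_le_mul_of_nonneg_left h5 hc1.le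
  refine le_of_mul_le_mul_right ?_ (by linarith : 0 < A - 1)
  linarith [mul_le_mul_of_nonneg_right h6 (by linarith : 0 ≤ A - 1)]

theorem renorm_left (h : IsProfile A c) (hA : 1 < A) (hs : 0 < s) (hsA : s * A < 1)
    (hq : 1 < q) {y : ℝ} (hy : y ∈ Set.Icc (-1 : ℝ) 1) :
    renormProfile c s q y * (A - 1) ≤ renormProfile c s q (-1) * (A + y) := by
  have hyA : y ∈ Set.Icc (-A) A := ⟨by linarith [hy.1], by linarith [hy.2]⟩
  have hsub : Set.Icc (-A) y ⊆ Set.Icc (-A) A := Set.Icc_subset_Icc_right hyA.2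
  have hcon := h.innerWeight_concave' hA hs hsA hq
  have h1 := ((hcon.subset hsub (convex_Icc _ _)).primitive_right (h.innerConst_pos hA hs hq).le
    (fun t ht => h.innerWeight_pos hA (lt_of_scale hs hsA (hsub ht).1))
    (fun t ht => h.hasDerivAt_innerMap hA hs hq (lt_of_scale hs hsA (hsub ht).1))
    (by linarith : -A ≤ -1) hy.1)
  have h2 := hcon.three_point (x := -A) ⟨by linarith, by linarith⟩ hyA (by linarith) hy.1
  have heA := h.innerWeight_pos hA (q := q) (lt_of_scale hs hsA (le_refl (-A)))
  have hey := h.innerWeight_pos hA (q := q) (lt_of_scale hs hsA hyA.1)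
  have he1 := h.innerWeight_pos hA (q := q) (lt_of_scale hs hsA (by linarith : -A ≤ -1))
  have hpA := h.innerMap_pos hA hs (q := q) (lt_of_scale hs hsA (le_refl (-A)))
  have hp1 := h.innerMap_pos hA hs (q := q) (lt_of_scale hs hsA (by linarith : -A ≤ -1))
  have hφy := h.innerMap_mem hA hs hsA hq hy
  have hφ1 := h.innerMap_mem hA hs hsA hq (y := -1) (by norm_num)
  have hm := (h.innerMap_strictMonoOn hA hs hq).monotoneOn
    (lt_of_scale hs hsA (by linarith : -A ≤ -1)) (lt_of_scale hs hsA hyA.1) hy.1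
  have h3 := h.concave.three_point (x := -1) (by norm_num) hφy hφ1.1 hm
  have hcm := h.pos hA (-1)
  rw [renormProfile, renormProfile] at *
  have hc0 := h.pos hA (innerMap c s q 0)
  have hc1 := h.pos hA (innerMap c s q (-1))
  generalize c (innerMap c s q 0) = c0 at *
  generalize c (innerMap c s q y) = cy at *
  generalize c (innerMap c s q (-1)) = c1 at *
  generalize innerMap c s q (-A) = B at *
  generalize innerMap c s q y = p at *
  generalize innerMap c s q (-1) = p1 at *
  generalize innerWeight c s q y = ey at *
  generalize innerWeight c s q (-1) = e1 at *
  generalize innerWeight c s q (-A) = eA at *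
  rw [div_mul_eq_mul_div, div_mul_eq_mul_div]
  refine div_le_div_of_nonneg_right ?_ hc0.le
  have h4 : ey * (A - 1) ≤ e1 * (A + y) := by nlinarith [hy.1]
  have h5 : ey * (1 + p) * (A - 1) ≤ e1 * (1 + p1) * (A + y) := by
    linarith [mul_le_mul_of_nonneg_left h4 (by linarith : 0 ≤ 1 + B)]
  have h6 : cy * (1 + p1) ≤ c1 * (1 + p) := by nlinarith
  refine le_of_mul_le_mul_right ?_ (by linarith : 0 < 1 + p1)
  have h7 := mul_le_mul_of_nonneg_left h5 hc1.le
  linarith [mul_le_mul_of_nonneg_right h6 (mul_nonneg hey.le (by linarith : 0 ≤ A - 1))]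

end IsProfile

end Renorm

section ProfileSpace

/-- Extension by constants of a function on `[-1, 1]`. -/
noncomputable abbrev extendUnit (g : Set.Icc (-1 : ℝ) 1 → ℝ) : ℝ → ℝ :=
  Set.IccExtend (neg_le_self zero_le_one) g

/-- The continuous functions on `[-1, 1]` which are admissible profiles. -/
def profileSet (A : ℝ) : Set C(Set.Icc (-1 : ℝ) 1, ℝ) := {f | IsProfile A (extendUnit f)}

theorem isProfile_extendUnit {A : ℝ} {g : Set.Icc (-1 : ℝ) 1 → ℝ} (hg : Continuous g)
    (h1 : ConcaveOn ℝ (Set.Icc (-1) 1) (extendUnit g)) (h2 : extendUnit g 0 = 1)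
    (h3 : ∀ y ∈ Set.Icc (-1 : ℝ) 1, extendUnit g y * (A - 1) ≤ extendUnit g 1 * (A - y))
    (h4 : ∀ y ∈ Set.Icc (-1 : ℝ) 1, extendUnit g y * (A - 1) ≤ extendUnit g (-1) * (A + y)) :
    IsProfile A (extendUnit g) where
  cont := hg.Icc_extend'
  concave := h1
  zero := h2
  right := h3
  left := h4
  out_right x hx := by
    rw [extendUnit, Set.IccExtend_of_right_le _ _ hx, Set.IccExtend_right]
  out_left x hx := by
    rw [extendUnit, Set.IccExtend_of_le_left _ _ hx, Set.IccExtend_left]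

theorem profileSet_convex (A : ℝ) : Convex ℝ (profileSet A) := by
  intro f hf g hg a b ha hb hab
  have hext : ∀ x, extendUnit (a • f + b • g : C(Set.Icc (-1 : ℝ) 1, ℝ)) x
      = a * extendUnit f x + b * extendUnit g x := fun x => rfl
  refine isProfile_extendUnit (map_continuous _) ?_ ?_ ?_ ?_
  · refine ((hf.concave.smul ha).add (hg.concave.smul hb)).congr fun x _ => ?_
    rw [hext]; rfl
  · rw [hext, hf.zero, hg.zero]; linarith
  · intro y hy
    rw [hext, hext]
    linarith [mul_le_mul_of_nonneg_left (hf.right y hy) ha,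
      mul_le_mul_of_nonneg_left (hg.right y hy) hb]
  · intro y hy
    rw [hext, hext]
    linarith [mul_le_mul_of_nonneg_left (hf.left y hy) ha,
      mul_le_mul_of_nonneg_left (hg.left y hy) hb]

theorem profileSet_nonempty {A : ℝ} : (profileSet A).Nonempty := by
  refine ⟨ContinuousMap.const _ 1, isProfile_extendUnit (map_continuous _) ?_ ?_ ?_ ?_⟩
  · exact concaveOn_const 1 (convex_Icc _ _)
  · rfl
  · intro y hy
    change (1 : ℝ) * (A - 1) ≤ 1 * (A - y)
    linarith [hy.2]
  · intro y hy
    change (1 : ℝ) * (A - 1) ≤ 1 * (A + y)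
    linarith [hy.1]

theorem continuous_extendUnit_apply (x : ℝ) :
    Continuous fun g : Set.Icc (-1 : ℝ) 1 → ℝ => extendUnit g x :=
  continuous_apply _

theorem isClosed_pointwise_profile (A : ℝ) : IsClosed {g : Set.Icc (-1 : ℝ) 1 → ℝ |
    (∀ x ∈ Set.Icc (-1 : ℝ) 1, ∀ z ∈ Set.Icc (-1 : ℝ) 1, ∀ y, x < y → y < z →
      (z - y) * extendUnit g x + (y - x) * extendUnit g z ≤ (z - x) * extendUnit g y) ∧
    extendUnit g 0 = 1 ∧
    (∀ y ∈ Set.Icc (-1 : ℝ) 1, extendUnit g y * (A - 1) ≤ extendUnit g 1 * (A - y)) ∧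
    (∀ y ∈ Set.Icc (-1 : ℝ) 1, extendUnit g y * (A - 1) ≤ extendUnit g (-1) * (A + y)) ∧
    ∀ x y, dist (g x) (g y) ≤ 2 / (A - 1) * dist x y} := by
  have hc := continuous_extendUnit_apply
  simp only [Set.ofPred_and, Set.ofPred_forall]
  refine IsClosed.inter ?_ (IsClosed.inter ?_ (IsClosed.inter ?_ (IsClosed.inter ?_ ?_)))
  · refine isClosed_iInter fun x => isClosed_iInter fun _ => isClosed_iInter fun z =>
      isClosed_iInter fun _ => isClosed_iInter fun y => isClosed_iInter fun _ =>
      isClosed_iInter fun _ => isClosed_le ?_ ?_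
    · exact ((hc x).const_mul _).add ((hc z).const_mul _)
    · exact (hc y).const_mul _
  · exact isClosed_eq (hc 0) continuous_const
  · refine isClosed_iInter fun y => isClosed_iInter fun _ => isClosed_le ?_ ?_
    · exact (hc y).mul_const _
    · exact (hc 1).mul_const _
  · refine isClosed_iInter fun y => isClosed_iInter fun _ => isClosed_le ?_ ?_
    · exact (hc y).mul_const _
    · exact (hc (-1)).mul_const _
  · refine isClosed_iInter fun x => isClosed_iInter fun y => isClosed_le ?_ continuous_const
    exact (continuous_apply x).dist (continuous_apply y)

theorem profileSet_dist_le {A : ℝ} (hA : 1 < A) {f : C(Set.Icc (-1 : ℝ) 1, ℝ)}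
    (hf : f ∈ profileSet A) (x y : Set.Icc (-1 : ℝ) 1) :
    dist (f x) (f y) ≤ 2 / (A - 1) * dist x y := by
  wlog hxy : x ≤ y generalizing x y
  · rw [dist_comm, dist_comm x]; exact this y x (le_of_not_ge hxy)
  rcases hxy.eq_or_lt with rfl | hxy
  · simp
  have h1 := IsProfile.slope_bound hf hA x.2 y.2 hxy
  have h2 : extendUnit f x = f x := Set.IccExtend_val _ _ _
  have h3 : extendUnit f y = f y := Set.IccExtend_val _ _ _
  rw [h2, h3] at h1
  have hA' : 0 < A - 1 := by linarith
  rw [dist_comm, Real.dist_eq, dist_comm, Subtype.dist_eq, Real.dist_eq,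
    abs_of_pos (sub_pos.2 (show (x : ℝ) < y from hxy)), div_mul_eq_mul_div, le_div_iff₀ hA']
  exact h1

theorem profileSet_isCompact {A : ℝ} (hA : 1 < A) : IsCompact (profileSet A) := by
  have hA' : 0 < A - 1 := by linarith
  have hL : 0 ≤ 2 / (A - 1) := by positivity
  apply ArzelaAscoli.isCompact_of_equicontinuous
  · have hbox : IsCompact (Set.univ.pi fun _ : Set.Icc (-1 : ℝ) 1 => Set.Icc (0 : ℝ) 2) :=
      isCompact_univ_pi fun _ => isCompact_Icc
    convert hbox.inter_right (isClosed_pointwise_profile A) using 1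
    ext g
    constructor
    · rintro ⟨f, hf, rfl⟩
      refine ⟨fun x _ => ?_, fun x hx z hz y hxy hyz => ?_, ?_, ?_, ?_, ?_⟩
      · have h2 : extendUnit f x = f x := Set.IccExtend_val _ _ _
        have h3 := IsProfile.pos hf hA x
        have h4 := IsProfile.upper hf hA x
        rw [h2] at h3 h4
        exact ⟨h3.le, h4⟩
      · exact hf.concave.three_point hx hz hxy.le hyz.le
      · exact hf.zero
      · exact hf.right
      · exact hf.left
      · exact profileSet_dist_le hA hf
    · rintro ⟨-, h1, h2, h3, h4, h5⟩
      have hg : Continuous g :=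
        (LipschitzWith.of_dist_le_mul (K := ⟨2 / (A - 1), hL⟩) h5).continuous
      exact ⟨⟨g, hg⟩, isProfile_extendUnit hg (concaveOn_of_three_point (convex_Icc _ _) h1)
        h2 h3 h4, rfl⟩
  · refine UniformEquicontinuous.equicontinuous
      (LipschitzWith.uniformEquicontinuous _ ⟨2 / (A - 1), hL⟩ fun f => ?_)
    exact LipschitzWith.of_dist_le_mul (profileSet_dist_le hA f.2)

end ProfileSpace

section Continuity

open MeasureTheory

variable {X : Type*} [TopologicalSpace X] {A : ℝ} {c : X → ℝ → ℝ}

theorem continuous_family_inv (hA : 1 < A) (h : ∀ x, IsProfile A (c x))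
    (hc : Continuous (Function.uncurry c)) :
    Continuous (Function.uncurry fun x t => 1 / c x t ^ 2) :=
  continuous_const.div (hc.pow 2) fun p => (pow_pos ((h p.1).pos hA p.2) 2).ne'

theorem continuous_family_map (hA : 1 < A) (h : ∀ x, IsProfile A (c x))
    (hc : Continuous (Function.uncurry c)) {u : X → ℝ} (hu : Continuous u) :
    Continuous fun x => profileMap (c x) (u x) := by
  have h1 := continuous_family_inv hA h hc
  have h2 : Continuous fun x => profileInt (c x) :=
    intervalIntegral.continuous_parametric_intervalIntegral_of_continuous' h1 0 1
  have h3 := intervalIntegral.continuous_parametric_intervalIntegral_of_continuous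
    (a₀ := (1 : ℝ)) (μ := volume) h1 hu
  refine Continuous.div ?_ h2 fun x => ((h x).int_pos hA).ne'
  refine h3.neg.congr fun x => ?_
  exact (intervalIntegral.integral_symm _ _).symm

theorem continuous_family_innerMap (hA : 1 < A) (h : ∀ x, IsProfile A (c x))
    (hc : Continuous (Function.uncurry c)) {s q y : X → ℝ} (hs : Continuous s) (hq : Continuous q)
    (hy : Continuous y) (hs0 : ∀ x, 0 < s x) (hq1 : ∀ x, 1 < q x) (hsy : ∀ x, -1 < s x * y x) :
    Continuous fun x => innerMap (c x) (s x) (q x) (y x) := by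
  have hV : ∀ x, 0 < profileMap (c x) (-(s x * y x)) := fun x =>
    (h x).map_pos hA (by linarith [hsy x])
  have hV1 : ∀ x, 0 < profileMap (c x) (-s x) := fun x => (h x).map_pos hA (by linarith [hs0 x])
  refine Continuous.rpow ?_ ?_ fun x => Or.inl (div_pos (hV x) (hV1 x)).ne'
  · exact (continuous_family_map hA h hc (hs.mul hy).neg).div
      (continuous_family_map hA h hc hs.neg) fun x => (hV1 x).ne'
  · exact continuous_const.div hq fun x => by linarith [hq1 x]

theorem continuous_family_renorm (hA : 1 < A) (h : ∀ x, IsProfile A (c x))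
    (hc : Continuous (Function.uncurry c)) {s q y : X → ℝ} (hs : Continuous s) (hq : Continuous q)
    (hy : Continuous y) (hs0 : ∀ x, 0 < s x) (hq1 : ∀ x, 1 < q x) (hsy : ∀ x, -1 < s x * y x) :
    Continuous fun x => renormProfile (c x) (s x) (q x) (y x) := by
  have hV : ∀ x, 0 < profileMap (c x) (-(s x * y x)) := fun x =>
    (h x).map_pos hA (by linarith [hsy x])
  refine Continuous.div (Continuous.mul ?_ (Continuous.mul ?_ ?_)) ?_ fun x => ((h x).pos hA _).ne'
  · exact hc.comp (continuous_id.prodMk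
      (continuous_family_innerMap hA h hc hs hq hy hs0 hq1 hsy))
  · refine Continuous.rpow (continuous_family_map hA h hc (hs.mul hy).neg) ?_
      fun x => Or.inl (hV x).ne'
    exact (continuous_const.sub (continuous_const.div hq fun x => by linarith [hq1 x])).div_const 2
  · exact hc.comp (continuous_id.prodMk (hs.mul hy).neg)
  · exact hc.comp (continuous_id.prodMk
      (continuous_family_innerMap hA h hc hs hq continuous_const hs0 hq1 (by simp)))

/-- The exponent used in the modified renormalization operator. -/
noncomputable def renormExp (r A : ℝ) (c : ℝ → ℝ) (s : ℝ) : ℝ :=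
  max r (Real.log (profileMap c (-(s * A)) / profileMap c (-s)) / Real.log A)

theorem continuous_family_renormExp {r : ℝ} (hA : 1 < A) (h : ∀ x, IsProfile A (c x))
    (hc : Continuous (Function.uncurry c)) {s : X → ℝ} (hs : Continuous s) (hs0 : ∀ x, 0 < s x) :
    Continuous fun x => renormExp r A (c x) (s x) := by
  have hV : ∀ x, 0 < profileMap (c x) (-(s x * A)) := fun x =>
    (h x).map_pos hA (by nlinarith [hs0 x])
  have hV1 : ∀ x, 0 < profileMap (c x) (-s x) := fun x => (h x).map_pos hA (by linarith [hs0 x])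
  refine continuous_const.max (Continuous.div_const (Continuous.log ?_ ?_) _)
  · exact (continuous_family_map hA h hc (hs.mul continuous_const).neg).div
      (continuous_family_map hA h hc hs.neg) fun x => (hV1 x).ne'
  · exact fun x => (div_pos (hV x) (hV1 x)).ne'

end Continuity

section Existence

variable {A r l s : ℝ} {c : ℝ → ℝ}

theorem le_renormExp : r ≤ renormExp r A c s := le_max_left _ _

theorem IsProfile.innerMap_le_of_renormExp (h : IsProfile A c) (hA : 1 < A) (hr : 1 < r)
    (hs : 0 < s) : innerMap c s (renormExp r A c s) A ≤ A := by
  have hq : 1 < renormExp r A c s := hr.trans_le le_renormExp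
  have hV := h.map_pos hA (y := -(s * A)) (by nlinarith)
  have hV1 := h.map_pos hA (y := -s) (by linarith)
  have h1 : Real.log (profileMap c (-(s * A)) / profileMap c (-s)) / Real.log A
    ≤ renormExp r A c s := le_max_right _ _
  rw [div_le_iff₀ (Real.log_pos hA)] at h1
  rw [innerMap, one_div, Real.rpow_inv_le_iff_of_pos (div_pos hV hV1).le (by linarith)
    (by linarith), ← Real.log_le_log_iff (div_pos hV hV1) (by positivity),
    Real.log_rpow (by linarith)]
  exact h1

theorem IsProfile.renormExp_le (h : IsProfile A c) (hA : 1 < A) (hs : 0 < s) (hsA : s * A < 1) :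
    renormExp r A c s ≤ max r (Real.log (1 + 4 * (A / (A - 1)) ^ 2) / Real.log A) := by
  have hV := h.map_pos hA (y := -(s * A)) (by nlinarith)
  have hV1 := h.one_le_map hA (y := -s) (by linarith)
  refine max_le_max le_rfl (div_le_div_of_nonneg_right ?_ (Real.log_pos hA).le)
  refine Real.log_le_log (div_pos hV (by linarith)) ?_
  rw [div_le_iff₀ (by linarith)]
  have h1 := h.map_sub_upper hA (x := -(s * A)) (y := 0) (by nlinarith)
  rw [h.map_zero hA] at h1
  have h2 : 0 ≤ (A / (A - 1)) ^ 2 := sq_nonneg _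
  nlinarith

theorem exists_scale_lower_bound (hr : 1 < r) (hA : 1 < A) (hl : 0 < l) (hlA : l * A < 1) :
    ∃ b, 0 < b ∧ b ≤ l ∧ ∀ c s, IsProfile A c → s ∈ Set.Icc b l →
      b ≤ profileMap c (innerMap c s (renormExp r A c s) 0) ^ (1 / renormExp r A c s) := by
  obtain ⟨R, hR⟩ : ∃ R, R = max r (Real.log (1 + 4 * (A / (A - 1)) ^ 2) / Real.log A) := ⟨_, rfl⟩
  have hrR : r ≤ R := hR ▸ le_max_left _ _
  obtain ⟨k, hk⟩ : ∃ k, k = ((A - 1) / A) ^ 2 / 4 := ⟨_, rfl⟩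
  have hA0 : 0 < A := by linarith
  have hm : 0 < (A - 1) / A := div_pos (by linarith) hA0
  have hm1 : (A - 1) / A < 1 := by rw [div_lt_one hA0]; linarith
  have hk0 : 0 < k := by rw [hk]; positivity
  have hk1 : k < 1 := by rw [hk]; nlinarith
  have hk3 : 0 < k * (k / (2 * R)) := by
    have : 0 < R := by linarith
    positivity
  have hr1 : 0 < r - 1 := by linarith
  have hl1 : l < 1 := by nlinarith
  refine ⟨min l ((k * (k / (2 * R))) ^ (1 / (r - 1))),
    lt_min hl (Real.rpow_pos_of_pos hk3 _), min_le_left _ _, ?_⟩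
  generalize hb : min l ((k * (k / (2 * R))) ^ (1 / (r - 1))) = b
  intro c s h hsb
  have hb0 : 0 < b := hb ▸ lt_min hl (Real.rpow_pos_of_pos hk3 _)
  have hbr : b ^ (r - 1) ≤ k * (k / (2 * R)) := by
    have : b ≤ (k * (k / (2 * R))) ^ (1 / (r - 1)) := hb ▸ min_le_right _ _
    rwa [one_div, Real.le_rpow_inv_iff_of_pos hb0.le hk3.le hr1] at this
  have hs0 : 0 < s := hb0.trans_le hsb.1
  have hs1 : s < 1 := hsb.2.trans_lt hl1
  have hsA : s * A < 1 := (mul_le_mul_of_nonneg_right hsb.2 hA0.le).trans_lt hlA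
  have hqR : renormExp r A c s ≤ R := hR ▸ h.renormExp_le hA hs0 hsA
  have hrq : r ≤ renormExp r A c s := le_renormExp
  generalize renormExp r A c s = q at hqR hrq
  have hq : 1 < q := by linarith
  have hR0 : 0 < R := by linarith
  have hz1 : innerMap c s q 0 ≤ 1 - k / (2 * R) * s := by
    have h1 := h.map_sub_lower hA (x := -s) (y := 0) (by linarith)
    rw [h.map_zero hA, ← hk] at h1
    rw [innerMap, mul_zero, neg_zero, h.map_zero hA]
    have h2 : 1 / profileMap c (-s) ≤ 1 - k * s / 2 := by
      rw [div_le_iff₀ (by nlinarith)]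
      have h3 : 0 < k * s := by positivity
      have h4 : k * s < 1 := by nlinarith
      nlinarith
    have h5 : 0 < 1 / profileMap c (-s) := one_div_pos.2 (by nlinarith)
    have hks : 0 < k * s := by positivity
    calc (1 / profileMap c (-s)) ^ (1 / q) ≤ (1 - k * s / 2) ^ (1 / q) :=
          Real.rpow_le_rpow h5.le h2 (by positivity)
      _ ≤ (1 - k * s / 2) ^ (1 / R) :=
          Real.rpow_le_rpow_of_exponent_ge (h5.trans_le h2) (by linarith)
            (one_div_le_one_div_of_le (by linarith) hqR)
      _ = (1 + -(k * s / 2)) ^ (1 / R) := by rw [sub_eq_add_neg]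
      _ ≤ 1 + 1 / R * -(k * s / 2) :=
          rpow_one_add_le_one_add_mul_self (by linarith) (by positivity)
            ((div_le_one hR0).2 (by linarith))
      _ = 1 - k / (2 * R) * s := by field_simp; ring
  have hz0 : 0 < innerMap c s q 0 := h.innerMap_pos hA hs0 (by simp)
  have hkR : 0 < k / (2 * R) := by positivity
  generalize innerMap c s q 0 = z at hz1 hz0
  have hV := h.map_sub_lower hA (x := z) (y := 1) (by nlinarith)
  rw [h.map_one, ← hk] at hV
  have hV2 : k * (k / (2 * R)) * s ≤ profileMap c z := by nlinarith
  have hV1 : profileMap c z ≤ 1 := by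
    rw [← h.map_zero hA]; exact (h.map_strictAnti hA).antitone hz0.le
  have hVb : b ^ r ≤ profileMap c z := by
    have : b ^ r = b ^ (r - 1) * b := by
      rw [← Real.rpow_add_one hb0.ne', sub_add_cancel]
    rw [this]
    refine le_trans ?_ hV2
    exact mul_le_mul hbr hsb.1 hb0.le hk3.le
  have hV0 : 0 < profileMap c z := (Real.rpow_pos_of_pos hb0 _).trans_le hVb
  calc b ≤ profileMap c z ^ (1 / r) := by
        rwa [one_div, Real.le_rpow_inv_iff_of_pos hb0.le hV0.le (by linarith)]
    _ ≤ profileMap c z ^ (1 / q) :=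
        Real.rpow_le_rpow_of_exponent_ge hV0 hV1 (one_div_le_one_div_of_le (by linarith) hrq)

theorem exists_fixed_renormProfile (hr : 1 < r) (hA : 1 < A) (hl : 0 < l) (hlA : l * A < 1) :
    ∃ c s, IsProfile A c ∧ 0 < s ∧
      (∀ y ∈ Set.Icc (-1 : ℝ) 1, renormProfile c s (renormExp r A c s) y = c y) ∧
      min l (profileMap c (innerMap c s (renormExp r A c s) 0) ^ (1 / renormExp r A c s)) = s := by
  classical
  obtain ⟨b, hb0, hbl, hb⟩ := exists_scale_lower_bound hr hA hl hlA
  have hl1 : l < 1 := by nlinarith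
  let S : Set (C(Set.Icc (-1 : ℝ) 1, ℝ) × ℝ) := profileSet A ×ˢ Set.Icc b l
  let cc : S × Set.Icc (-1 : ℝ) 1 → ℝ → ℝ := fun p => extendUnit p.1.1.1
  let ss : S × Set.Icc (-1 : ℝ) 1 → ℝ := fun p => p.1.1.2
  let qq : S × Set.Icc (-1 : ℝ) 1 → ℝ := fun p => renormExp r A (cc p) (ss p)
  have hcc : ∀ p, IsProfile A (cc p) := fun p => p.1.2.1
  have hss : ∀ p, ss p ∈ Set.Icc b l := fun p => p.1.2.2
  have hss0 : ∀ p, 0 < ss p := fun p => hb0.trans_le (hss p).1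
  have hssA : ∀ p, ss p * A < 1 := fun p =>
    (mul_le_mul_of_nonneg_right (hss p).2 (by linarith)).trans_lt hlA
  have hqq : ∀ p, 1 < qq p := fun p => hr.trans_le le_renormExp
  have hccc : Continuous (Function.uncurry cc) := by
    change Continuous fun p : (S × Set.Icc (-1 : ℝ) 1) × ℝ =>
      p.1.1.1.1 (Set.projIcc (-1) 1 (neg_le_self zero_le_one) p.2)
    have h2 := continuous_projIcc (h := neg_le_self (zero_le_one (α := ℝ)))
    fun_prop
  have hssc : Continuous ss := by fun_prop
  have hqqc : Continuous qq := continuous_family_renormExp hA hcc hccc hssc hss0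
  have hxy : ∀ p, ∀ y ∈ Set.Icc (-1 : ℝ) 1, -1 < ss p * y := fun p y hy =>
    IsProfile.lt_of_scale (hss0 p) (hssA p) (by linarith [hy.1])
  have hren : Continuous fun p => renormProfile (cc p) (ss p) (qq p) (p.2 : ℝ) :=
    continuous_family_renorm hA hcc hccc hssc hqqc (by fun_prop) hss0 hqq
      fun p => hxy p _ p.2.2
  have hval : Continuous fun p =>
      min l (profileMap (cc p) (innerMap (cc p) (ss p) (qq p) 0) ^ (1 / qq p)) := by
    have hin := continuous_family_innerMap hA hcc hccc hssc hqqc (continuous_const (y := (0 : ℝ)))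
      hss0 hqq (by simp)
    refine continuous_const.min ((continuous_family_map hA hcc hccc hin).rpow
      (continuous_const.div hqqc fun p => by linarith [hqq p]) fun p => Or.inr ?_)
    exact one_div_pos.2 (by linarith [hqq p])
  let G : C(S, C(Set.Icc (-1 : ℝ) 1, ℝ)) := ContinuousMap.curry ⟨_, hren⟩
  let z : Set.Icc (-1 : ℝ) 1 := ⟨0, by norm_num⟩
  let H : S → C(Set.Icc (-1 : ℝ) 1, ℝ) × ℝ := fun p =>
    (G p, min l (profileMap (cc (p, z)) (innerMap (cc (p, z)) (ss (p, z)) (qq (p, z)) 0)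
      ^ (1 / qq (p, z))))
  have hH : Continuous H := by
    refine G.continuous.prodMk ?_
    exact hval.comp (continuous_id.prodMk continuous_const)
  let T : C(Set.Icc (-1 : ℝ) 1, ℝ) × ℝ → C(Set.Icc (-1 : ℝ) 1, ℝ) × ℝ := fun p =>
    if h : p ∈ S then H ⟨p, h⟩ else p
  have hT : ∀ p (h : p ∈ S), T p = H ⟨p, h⟩ := fun p h => dif_pos h
  have hGext : ∀ p : S, ∀ y ∈ Set.Icc (-1 : ℝ) 1, extendUnit (G p) y
      = renormProfile (cc (p, z)) (ss (p, z)) (qq (p, z)) y := by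
    intro p y hy
    rw [extendUnit, Set.IccExtend_of_mem _ _ hy]
    rfl
  have hcont : ContinuousOn T S := by
    rw [continuousOn_iff_continuous_domRestrict]
    exact hH.congr fun p => (hT p.1 p.2).symm
  have hmaps : Set.MapsTo T S S := by
    intro p hpS
    rw [hT p hpS]
    have hI := hcc (⟨p, hpS⟩, z)
    have hs := hss0 (⟨p, hpS⟩, z)
    have hsA := hssA (⟨p, hpS⟩, z)
    have hq := hqq (⟨p, hpS⟩, z)
    refine ⟨isProfile_extendUnit (map_continuous _) ?_ ?_ ?_ ?_, ?_⟩
    · exact (hI.renorm_concave hA hs hsA hq).congr fun y hy => (hGext ⟨p, hpS⟩ y hy).symm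
    · rw [hGext _ _ (by norm_num)]
      exact hI.renorm_zero hA
    · intro y hy
      rw [hGext _ _ hy, hGext _ _ (by norm_num)]
      exact hI.renorm_right hA hs hsA hq (hI.innerMap_le_of_renormExp hA hr hs) hy
    · intro y hy
      rw [hGext _ _ hy, hGext _ _ (by norm_num)]
      exact hI.renorm_left hA hs hsA hq hy
    · exact ⟨le_min hbl (hb _ _ hI (hss (⟨p, hpS⟩, z))), min_le_left _ _⟩
  obtain ⟨p, hpS, hp⟩ := exists_fixed_of_compact_convex
    ((profileSet_isCompact hA).prod isCompact_Icc)
    ((profileSet_convex A).prod (convex_Icc _ _))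
    (profileSet_nonempty.prod (Set.nonempty_Icc.2 hbl)) hcont hmaps
  rw [hT p hpS] at hp
  refine ⟨cc (⟨p, hpS⟩, z), p.2, hcc _, hss0 (⟨p, hpS⟩, z), fun y hy => ?_,
    congrArg Prod.snd hp⟩
  rw [← hGext ⟨p, hpS⟩ y hy]
  change _ = extendUnit p.1 y
  rw [← congrArg Prod.fst hp]

end Existence

section FixedProfile

namespace IsProfile

variable {A l s q r : ℝ} {c : ℝ → ℝ}

theorem map_innerMap (h : IsProfile A c) (hA : 1 < A) (hs : 0 < s) (hsA : s * A < 1) (hq : 1 < q)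
    (hfix : ∀ y ∈ Set.Icc (-1 : ℝ) 1, renormProfile c s q y = c y) {y : ℝ}
    (hy : y ∈ Set.Icc (-1 : ℝ) 1) :
    profileMap c (innerMap c s q y) = profileMap c (innerMap c s q 0) * profileMap c y := by
  obtain ⟨C, hC⟩ : ∃ C, C = innerConst c s q / c (innerMap c s q 0) ^ 2 := ⟨_, rfl⟩
  have hder : ∀ x ∈ Set.Icc (-1 : ℝ) 1, HasDerivAt
      (fun x => profileMap c (innerMap c s q x) - C * profileMap c x) 0 x := by
    intro x hx
    have hsx : -1 < s * x := lt_of_scale hs hsA (by linarith [hx.1])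
    have h1 := (h.hasDerivAt_map hA (innerMap c s q x)).comp x (h.hasDerivAt_innerMap hA hs hq hsx)
    refine (h1.sub ((h.hasDerivAt_map hA x).const_mul C)).congr_deriv ?_
    have h2 := hfix x hx
    have p1 := h.pos hA (innerMap c s q x)
    have p2 := h.innerWeight_pos hA hsx (q := q)
    have p3 := h.pos hA (innerMap c s q 0)
    have p4 := h.int_pos hA
    rw [← h2, hC, renormProfile]
    field_simp
    ring
  have hconst : ∀ x ∈ Set.Icc (-1 : ℝ) 1, profileMap c (innerMap c s q x) - C * profileMap c x
      = profileMap c (innerMap c s q (-1)) - C * profileMap c (-1) :=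
    constant_of_has_deriv_right_zero
      (fun x hx => (hder x hx).continuousAt.continuousWithinAt)
      fun x hx => (hder x ⟨hx.1, hx.2.le⟩).hasDerivWithinAt
  have h1 := hconst 1 (by norm_num)
  rw [h.innerMap_one hA hs, h.map_one] at h1
  have h0 := hconst 0 (by norm_num)
  rw [h.map_zero hA] at h0
  have hy' := hconst y hy
  have : C = profileMap c (innerMap c s q 0) := by linarith
  rw [← this]
  linarith

theorem innerMap_zero_lt_one (h : IsProfile A c) (hA : 1 < A) (hs : 0 < s) (hq : 1 < q) :
    innerMap c s q 0 < 1 := by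
  rw [← h.innerMap_one hA hs (q := q)]
  exact h.innerMap_strictMonoOn hA hs hq (by simp) (by simp; linarith) one_pos

theorem innerMap_eq_mul (h : IsProfile A c) (hA : 1 < A) (hs : 0 < s) {y : ℝ}
    (hy : -1 ≤ s * y) :
    innerMap c s q y = innerMap c s q 0 * profileMap c (-(s * y)) ^ (1 / q) := by
  have h1 := h.map_pos hA (y := -s) (by linarith)
  have h2 : 0 ≤ profileMap c (-(s * y)) := by
    rw [← h.map_one]
    exact (h.map_strictAnti hA).antitone (by linarith)
  rw [innerMap, innerMap, mul_zero, neg_zero, h.map_zero hA,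
    ← Real.mul_rpow (by positivity) h2, one_div_mul_eq_div]

theorem map_mul_le_one (h : IsProfile A c) (hA : 1 < A) (hs : 0 < s) (hsA : s * A < 1)
    (hq : 1 < q) (hfix : ∀ y ∈ Set.Icc (-1 : ℝ) 1, renormProfile c s q y = c y) {y : ℝ}
    (hy : y ∈ Set.Icc (-1 : ℝ) 1) :
    profileMap c (innerMap c s q 0) * profileMap c y ≤ 1 := by
  rw [← h.map_innerMap hA hs hsA hq hfix hy, ← h.map_zero hA]
  exact (h.map_strictAnti hA).antitone
    (h.innerMap_pos hA hs (lt_of_scale hs hsA (by linarith [hy.1]))).le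

theorem mul_map_rpow_le_one (h : IsProfile A c) (hA : 1 < A) (hs : 0 < s) (hsA : s * A < 1)
    (hq : 1 < q) (hfix : ∀ y ∈ Set.Icc (-1 : ℝ) 1, renormProfile c s q y = c y)
    (hsD : s ≤ profileMap c (innerMap c s q 0) ^ (1 / q)) {y : ℝ}
    (hy : y ∈ Set.Ico (-1 : ℝ) 1) : s * profileMap c y ^ (1 / q) ≤ 1 := by
  have hD := h.map_pos hA (h.innerMap_zero_lt_one hA hs hq)
  have hVy := h.map_pos hA hy.2
  calc s * profileMap c y ^ (1 / q)
      ≤ profileMap c (innerMap c s q 0) ^ (1 / q) * profileMap c y ^ (1 / q) := by gcongr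
    _ = (profileMap c (innerMap c s q 0) * profileMap c y) ^ (1 / q) :=
        (Real.mul_rpow hD.le hVy.le).symm
    _ ≤ 1 := Real.rpow_le_one (by positivity)
        (h.map_mul_le_one hA hs hsA hq hfix ⟨hy.1, hy.2.le⟩) (by positivity)

theorem scale_le_innerMap_zero (h : IsProfile A c) (hA : 1 < A) (hs : 0 < s) (hsA : s * A < 1)
    (hq : 1 < q) (hfix : ∀ y ∈ Set.Icc (-1 : ℝ) 1, renormProfile c s q y = c y)
    (hsD : s ≤ profileMap c (innerMap c s q 0) ^ (1 / q)) : s ≤ innerMap c s q 0 := by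
  have hs1 : s < 1 := by nlinarith
  have h1 := h.mul_map_rpow_le_one hA hs hsA hq hfix hsD (y := -s) ⟨by linarith, by linarith⟩
  have h2 := h.map_pos hA (y := -s) (by linarith)
  rw [innerMap, mul_zero, neg_zero, h.map_zero hA, Real.div_rpow zero_le_one h2.le,
    Real.one_rpow, le_div_iff₀ (by positivity)]
  exact h1

theorem innerMap_inv_scale_lt (h : IsProfile A c) (hA : 1 < A) (hs : 0 < s) (hsA : s * A < 1)
    (hq : 1 < q) (hfix : ∀ y ∈ Set.Icc (-1 : ℝ) 1, renormProfile c s q y = c y)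
    (hsD : s ≤ profileMap c (innerMap c s q 0) ^ (1 / q)) : innerMap c s q (1 / s) < 1 / s := by
  have h1 := h.mul_map_rpow_le_one hA hs hsA hq hfix hsD (y := -1) (by norm_num)
  have hss : s * (1 / s) = 1 := by field_simp
  have hz := h.innerMap_zero_lt_one hA hs hq
  rw [h.innerMap_eq_mul hA hs (by rw [hss]; norm_num), hss, lt_div_iff₀ hs]
  have h2 := h.innerMap_pos hA hs (q := q) (y := 0) (by simp)
  nlinarith

theorem innerMap_ne (h : IsProfile A c) (hA : 1 < A) (hs : 0 < s) (hsA : s * A < 1)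
    (hq : 1 < q) (hfix : ∀ y ∈ Set.Icc (-1 : ℝ) 1, renormProfile c s q y = c y)
    (hsD : s ≤ profileMap c (innerMap c s q 0) ^ (1 / q)) : innerMap c s q A ≠ A := by
  intro hAA
  have hAs : A < 1 / s := by rw [lt_div_iff₀ hs]; linarith
  have hd : ∀ y, 0 ≤ y → HasDerivAt (innerMap c s q)
      (innerConst c s q / innerWeight c s q y ^ 2) y := fun y hy =>
    h.hasDerivAt_innerMap hA hs hq (by nlinarith)
  have hmvt : ∀ a b, 0 ≤ a → a < b → ∃ x ∈ Set.Ioo a b,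
      innerConst c s q / innerWeight c s q x ^ 2 =
        (innerMap c s q b - innerMap c s q a) / (b - a) := fun a b ha hab =>
    exists_hasDerivAt_eq_slope _ _ hab
      (fun x hx => (hd x (ha.trans hx.1)).continuousAt.continuousWithinAt)
      fun x hx => hd x (ha.trans hx.1.le)
  obtain ⟨x, hx, hx1⟩ := hmvt 0 1 le_rfl one_pos
  obtain ⟨y, hy, hy1⟩ := hmvt 1 A zero_le_one hA
  obtain ⟨z, hz, hz1⟩ := hmvt A (1 / s) (by linarith) hAs
  have hk := h.innerConst_pos hA hs hq
  have hpos : ∀ y, 0 ≤ y → 0 < innerWeight c s q y := fun y hy =>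
    h.innerWeight_pos hA (by nlinarith)
  have hxp := hpos x hx.1.le
  have hyp := hpos y (by linarith [hy.1])
  have hzp := hpos z (by linarith [hz.1])
  have hx2 : innerConst c s q < innerWeight c s q x ^ 2 := by
    rw [← div_lt_one (by positivity), hx1, h.innerMap_one hA hs, sub_zero, div_one]
    linarith [h.innerMap_pos hA hs (q := q) (y := 0) (by simp)]
  have hy2 : innerConst c s q = innerWeight c s q y ^ 2 := by
    rw [← div_eq_one_iff_eq (by positivity), hy1, h.innerMap_one hA hs, hAA,
      div_self (by linarith)]
  have hz2 : innerConst c s q < innerWeight c s q z ^ 2 := by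
    rw [← div_lt_one (by positivity), hz1, hAA, div_lt_one (by linarith)]
    linarith [h.innerMap_inv_scale_lt hA hs hsA hq hfix hsD]
  rw [hy2] at hx2 hz2
  have hx3 := lt_of_pow_lt_pow_left₀ 2 hxp.le hx2
  have hz3 := lt_of_pow_lt_pow_left₀ 2 hzp.le hz2
  have hs1 : 0 < 1 / s := by positivity
  have hcon := (h.innerWeight_concave hA hs hq).three_point (x := x) (y := y) (z := z)
    ⟨by linarith [hx.1], by linarith [hx.2]⟩ ⟨by linarith [hz.1], hz.2.le⟩
    (by linarith [hx.2, hy.1]) (by linarith [hy.2, hz.1])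
  have hxy : 0 < y - x := by linarith [hx.2, hy.1]
  have hyz : 0 < z - y := by linarith [hy.2, hz.1]
  nlinarith

theorem renormExp_eq (h : IsProfile A c) (hA : 1 < A) (hr : 1 < r) (hs : 0 < s)
    (hne : innerMap c s (renormExp r A c s) A ≠ A) : renormExp r A c s = r := by
  by_contra hq
  have h1 : renormExp r A c s
      = Real.log (profileMap c (-(s * A)) / profileMap c (-s)) / Real.log A := by
    rcases max_choice r (Real.log (profileMap c (-(s * A)) / profileMap c (-s)) / Real.log A)
      with h2 | h2
    · exact absurd h2 hq
    · exact h2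
  have hq1 : 1 < renormExp r A c s := hr.trans_le le_renormExp
  refine hne ?_
  have hV := h.map_pos hA (y := -(s * A)) (by nlinarith)
  have hV1 := h.map_pos hA (y := -s) (by linarith)
  have hA0 : 0 < A := by linarith
  have h2 : profileMap c (-(s * A)) / profileMap c (-s) = A ^ renormExp r A c s := by
    rw [eq_div_iff (Real.log_pos hA).ne', ← Real.log_rpow hA0] at h1
    exact (Real.log_injOn_pos (Set.mem_Ioi.2 (by positivity))
      (Set.mem_Ioi.2 (div_pos hV hV1)) h1).symm
  rw [innerMap, h2, one_div, Real.rpow_rpow_inv hA0.le (by linarith)]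

theorem mul_le_mul_of_le (h : IsProfile A c) (hA : 1 < A) {x y : ℝ} (hx : 0 ≤ x) (hxy : x ≤ y)
    (hy : y < 1) : c x * (A - y) ≤ c y * (A - x) := by
  have hx1 : x ∈ Set.Icc (-1 : ℝ) 1 := ⟨by linarith, by linarith⟩
  have h1 := h.concave.three_point hx1 (by norm_num : (1 : ℝ) ∈ _) hxy hy.le
  have h2 := h.right x hx1
  have h3 := mul_le_mul_of_nonneg_left h2 (sub_nonneg.2 hxy)
  have h4 := mul_le_mul_of_nonneg_right h1 (by linarith : 0 ≤ A - x)
  refine le_of_mul_le_mul_left ?_ (by linarith : 0 < 1 - x)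
  linarith

theorem map_mul_le (h : IsProfile A c) (hA : 1 < A) (hl : 0 < l) (hl1 : l < 1) :
    profileMap c l * (l * (A - 1)) ≤ (1 - profileMap c l) * ((1 - l) * A) := by
  have hd : ∀ a b, 0 ≤ a → a < b → b ≤ 1 → ∃ x ∈ Set.Ioo a b,
      (1 / (A - b) - 1 / (A - a)) * -(1 / c x ^ 2 / profileInt c)
        = (profileMap c b - profileMap c a) * (1 / (A - x) ^ 2) := by
    intro a b ha hab hb
    have hg : ∀ x, x ≤ 1 → HasDerivAt (fun x => 1 / (A - x)) (1 / (A - x) ^ 2) x := by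
      intro x hx
      have h2 := ((hasDerivAt_id x).const_sub A).inv (c := fun x => A - x)
        (show A - x ≠ 0 by linarith)
      simp only [one_div]
      refine h2.congr_deriv ?_
      simp [one_div]
    exact exists_ratio_hasDerivAt_eq_ratio_slope (profileMap c) _ hab
      (fun x _ => (h.hasDerivAt_map hA x).continuousAt.continuousWithinAt)
      (fun x _ => h.hasDerivAt_map hA x) (fun x => 1 / (A - x)) _
      (fun x hx => (hg x (hx.2.trans hb)).continuousAt.continuousWithinAt)
      (fun x hx => hg x (hx.2.le.trans hb))
  obtain ⟨x, hx, hx1⟩ := hd 0 l le_rfl hl hl1.le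
  obtain ⟨y, hy, hy1⟩ := hd l 1 hl.le hl1 le_rfl
  have hm := h.mul_le_mul_of_le hA hx.1.le (hx.2.trans hy.1).le hy.2
  rw [h.map_zero hA, sub_zero] at hx1
  rw [h.map_one] at hy1
  have hI := h.int_pos hA
  have hcx := h.pos hA x
  have hcy := h.pos hA y
  have hAx : 0 < A - x := by linarith [hx.2]
  have hAy : 0 < A - y := by linarith [hy.2]
  have hAl : 0 < A - l := by linarith
  have hA1 : 0 < A - 1 := by linarith
  have hA0 : 0 < A := by linarith
  have e1 : (1 - profileMap c l) * (A * (A - l)) * (profileInt c)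
      = l * ((A - x) / c x) ^ 2 := by
    field_simp at hx1 ⊢
    linarith
  have e2 : profileMap c l * ((A - l) * (A - 1)) * (profileInt c)
      = (1 - l) * ((A - y) / c y) ^ 2 := by
    field_simp at hy1 ⊢
    linarith
  have hm2 : ((A - y) / c y) ^ 2 ≤ ((A - x) / c x) ^ 2 := by
    have : (A - y) / c y ≤ (A - x) / c x := by
      rw [div_le_div_iff₀ hcy hcx]
      linarith
    gcongr
  have hm3 : l * (1 - l) * ((A - y) / c y) ^ 2 ≤ l * (1 - l) * ((A - x) / c x) ^ 2 :=
    mul_le_mul_of_nonneg_left hm2 (mul_nonneg hl.le (by linarith))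
  refine le_of_mul_le_mul_right ?_ (mul_pos hAl hI)
  linear_combination hm3 + l * e2 - (1 - l) * e1

end IsProfile

theorem exists_fixed_profile (hr : 1 < r) : ∃ A c s, 1 < A ∧ 0 < s ∧ s * A < 1 ∧ IsProfile A c ∧
    (∀ y ∈ Set.Icc (-1 : ℝ) 1, renormProfile c s r y = c y) ∧ innerMap c s r A < A ∧
    (∀ y ∈ Set.Icc (-1 : ℝ) 1, profileMap c (innerMap c s r y) = s ^ r * profileMap c y) ∧
    s ≤ innerMap c s r 0 := by
  obtain ⟨l, hl, hl1, hlr⟩ : ∃ l : ℝ, 0 < l ∧ l < 1 ∧ (1 + l) / (1 + 2 * l) < l ^ r := by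
    have hcont : ContinuousAt (fun l : ℝ => l ^ r - (1 + l) / (1 + 2 * l)) 1 := by
      refine (Real.continuousAt_rpow_const _ _ (Or.inl one_ne_zero)).sub ?_
      refine ContinuousAt.div (by fun_prop) (by fun_prop) (by norm_num)
    have h1 := hcont.eventually_const_lt (u := 0) (by norm_num)
    have h2 := (h1.filter_mono (nhdsWithin_le_nhds (s := Set.Iio 1))).and
      (Ioo_mem_nhdsLT (zero_lt_one (α := ℝ)))
    obtain ⟨l, h3, h4⟩ := h2.exists
    exact ⟨l, h4.1, h4.2, by linarith⟩
  obtain ⟨A, hAdef⟩ : ∃ A, A = (1 + l) / (2 * l) := ⟨_, rfl⟩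
  have hA : 1 < A := by rw [hAdef, lt_div_iff₀ (by linarith)]; linarith
  have hlA : l * A < 1 := by
    have : l * A = (1 + l) / 2 := by rw [hAdef]; field_simp
    rw [this]; linarith
  obtain ⟨c, s, h, hs, hfix, hmin⟩ := exists_fixed_renormProfile hr hA hl hlA
  have hsl : s ≤ l := hmin ▸ min_le_left _ _
  have hsA : s * A < 1 := (mul_le_mul_of_nonneg_right hsl (by linarith)).trans_lt hlA
  have hq : 1 < renormExp r A c s := hr.trans_le le_renormExp
  have hsD : s ≤ profileMap c (innerMap c s (renormExp r A c s) 0) ^ (1 / renormExp r A c s) := by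
    conv_lhs => rw [← hmin]
    exact min_le_right _ _
  have hne := h.innerMap_ne hA hs hsA hq hfix hsD
  have hle := h.innerMap_le_of_renormExp hA hr hs
  have hqr := h.renormExp_eq hA hr hs hne
  rw [hqr] at hq hsD hne hle hfix hmin
  have hz := h.scale_le_innerMap_zero hA hs hsA hq hfix hsD
  have hD := h.map_pos hA (h.innerMap_zero_lt_one hA hs hq)
  have hDs : profileMap c (innerMap c s r 0) = s ^ r := by
    rcases min_choice l (profileMap c (innerMap c s r 0) ^ (1 / r)) with h1 | h1
    · exfalso
      rw [hmin] at h1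
      subst h1
      have h2 := h.map_mul_le hA hs hl1
      have h3 : profileMap c (innerMap c s r 0) ≤ profileMap c s :=
        (h.map_strictAnti hA).antitone hz
      rw [one_div, Real.le_rpow_inv_iff_of_pos hs.le hD.le (by linarith)] at hsD
      have h4 : A - 1 = (1 - s) / (2 * s) := by rw [hAdef]; field_simp; ring
      have h5 : profileMap c s * (1 + 2 * s) ≤ 1 + s := by
        rw [h4, hAdef] at h2
        have h6 : profileMap c s * (s * ((1 - s) / (2 * s)))
          = profileMap c s * s * ((1 - s) / (2 * s)) := by ring
        have h7 : (1 - profileMap c s) * ((1 - s) * ((1 + s) / (2 * s)))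
          = (1 - profileMap c s) * (1 + s) * ((1 - s) / (2 * s)) := by ring
        rw [h6, h7] at h2
        have := le_of_mul_le_mul_right h2 (div_pos (by linarith) (by linarith))
        linarith
      rw [← le_div_iff₀ (by linarith)] at h5
      linarith
    · rw [hmin] at h1
      have h2 := Real.rpow_inv_rpow hD.le (show r ≠ 0 by linarith)
      rwa [← one_div, ← h1, eq_comm] at h2
  refine ⟨A, c, s, hA, hs, hsA, h, hfix, lt_of_le_of_ne hle hne, fun y hy => ?_, hz⟩
  rw [h.map_innerMap hA hs hsA hq hfix hy, hDs]

end FixedProfile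

/-- If every finite sum of the nonnegative function `g` over `I` is bounded and `g` is dominated
by a contracting transfer operator with disjoint injective branches, then `g` vanishes on `I`. -/
theorem eq_zero_of_transfer {I : Set ℝ} {g u v : ℝ → ℝ} {κ M : ℝ} (hκ0 : 0 ≤ κ) (hκ1 : κ < 1)
    (hg : ∀ y ∈ I, 0 ≤ g y) (hM : ∀ F : Finset ℝ, ↑F ⊆ I → ∑ y ∈ F, g y ≤ M)
    (hu : Set.MapsTo u I I) (hv : Set.MapsTo v I I) (hui : Set.InjOn u I) (hvi : Set.InjOn v I)
    (hdisj : ∀ x ∈ I, ∀ y ∈ I, u x ≠ v y) (hle : ∀ y ∈ I, g y ≤ κ * (g (u y) + g (v y)))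
    {y : ℝ} (hy : y ∈ I) : g y = 0 := by
  classical
  have hn : ∀ n : ℕ, ∀ F : Finset ℝ, ↑F ⊆ I → ∑ y ∈ F, g y ≤ κ ^ n * M := by
    intro n
    induction n with
    | zero => simpa using hM
    | succ n ih =>
      intro F hF
      have hdis : Disjoint (F.image u) (F.image v) := by
        rw [Finset.disjoint_left]
        intro a ha hb
        obtain ⟨x, hx, rfl⟩ := Finset.mem_image.1 ha
        obtain ⟨y, hy, hxy⟩ := Finset.mem_image.1 hb
        exact hdisj x (hF hx) y (hF hy) hxy.symm
      have h1 := ih (F.image u ∪ F.image v) (by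
        intro a ha
        rcases Finset.mem_union.1 ha with ha | ha
        · obtain ⟨x, hx, rfl⟩ := Finset.mem_image.1 ha
          exact hu (hF hx)
        · obtain ⟨x, hx, rfl⟩ := Finset.mem_image.1 ha
          exact hv (hF hx))
      rw [Finset.sum_union hdis, Finset.sum_image (hui.mono hF), Finset.sum_image (hvi.mono hF),
        ← Finset.sum_add_distrib] at h1
      calc ∑ y ∈ F, g y ≤ ∑ y ∈ F, κ * (g (u y) + g (v y)) :=
            Finset.sum_le_sum fun y hy => hle y (hF hy)
        _ = κ * ∑ y ∈ F, (g (u y) + g (v y)) := by rw [Finset.mul_sum]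
        _ ≤ κ * (κ ^ n * M) := mul_le_mul_of_nonneg_left h1 hκ0
        _ = κ ^ (n + 1) * M := by ring
  have hlim : Filter.Tendsto (fun n : ℕ => κ ^ n * M) Filter.atTop (nhds (0 * M)) :=
    (tendsto_pow_atTop_nhds_zero_of_lt_one hκ0 hκ1).mul_const M
  rw [zero_mul] at hlim
  refine le_antisymm (ge_of_tendsto' hlim fun n => ?_) (hg y hy)
  simpa using hn n {y} (by simpa using hy)

/-- The sum of the jumps of the one-sided derivatives of a concave function is bounded. -/
theorem sum_jump_le {L R : ℝ → ℝ} {I : Set ℝ} {M : ℝ} (hLM : ∀ y ∈ I, L y ≤ M)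
    (hRM : ∀ y ∈ I, -M ≤ R y)
    (hLR : ∀ x ∈ I, ∀ y ∈ I, x < y → L y ≤ R x) (F : Finset ℝ) (hF : ↑F ⊆ I) (hM : 0 ≤ M) :
    ∑ y ∈ F, (L y - R y) ≤ 2 * M := by
  have key : ∀ F : Finset ℝ, ↑F ⊆ I → ∀ K, K ≤ M → (∀ a ∈ F, K ≤ R a) →
      ∑ y ∈ F, (L y - R y) ≤ M - K := by
    intro F
    induction F using Finset.induction_on_max with
    | empty => intro _ K hK _; simpa using hK
    | insert a F ha ih =>
      intro hF K _ hKR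
      have haI : a ∈ I := hF (by simp)
      have hFI : ↑F ⊆ I := fun x hx => hF (by simp [Finset.mem_coe.1 hx])
      rw [Finset.sum_insert fun h => lt_irrefl _ (ha a h)]
      have h1 := ih hFI (L a) (hLM a haI) fun x hx => hLR x (hFI hx) a haI (ha x hx)
      linarith [hKR a (by simp)]
  linarith [key F hF (-M) (by linarith) fun a ha => hRM a (hF ha)]

/-- The data of a fixed point of the renormalization operator on profiles. -/
structure IsFixedProfile (A : ℝ) (c : ℝ → ℝ) (s r : ℝ) : Prop where
  prof : IsProfile A c
  one_lt : 1 < A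
  one_lt_exp : 1 < r
  scale_pos : 0 < s
  scale_mul : s * A < 1
  fixed : ∀ y ∈ Set.Icc (-1 : ℝ) 1, renormProfile c s r y = c y
  inner_lt : innerMap c s r A < A
  map_inner : ∀ y ∈ Set.Icc (-1 : ℝ) 1,
    profileMap c (innerMap c s r y) = s ^ r * profileMap c y
  scale_le : s ≤ innerMap c s r 0

namespace IsFixedProfile

variable {A s r : ℝ} {c : ℝ → ℝ}

theorem scale_lt_one (h : IsFixedProfile A c s r) : s < 1 := by
  nlinarith [h.one_lt, h.scale_mul, h.scale_pos]

theorem inner_zero_rpow_mul (h : IsFixedProfile A c s r) :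
    innerMap c s r 0 ^ r * profileMap c (-s) = 1 := by
  have hs := h.scale_pos
  have hr := h.one_lt_exp
  have hV := h.prof.map_pos h.one_lt (y := -s) (by linarith)
  rw [innerMap, mul_zero, neg_zero, h.prof.map_zero h.one_lt, one_div r,
    Real.rpow_inv_rpow (by positivity) (by linarith)]
  field_simp

theorem inner_eq (h : IsFixedProfile A c s r) {y : ℝ} (hy : -1 ≤ s * y) :
    innerMap c s r y = (innerMap c s r 0 ^ r * profileMap c (-(s * y))) ^ (1 / r) := by
  have hr := h.one_lt_exp
  have hz := h.prof.innerMap_pos h.one_lt h.scale_pos (q := r) (y := 0) (by simp)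
  have h2 : 0 ≤ profileMap c (-(s * y)) := by
    rw [← h.prof.map_one]
    exact (h.prof.map_strictAnti h.one_lt).antitone (by linarith)
  rw [h.prof.innerMap_eq_mul h.one_lt h.scale_pos hy,
    Real.mul_rpow (Real.rpow_nonneg hz.le r) h2, one_div, Real.rpow_rpow_inv hz.le (by linarith)]

theorem exists_crossing (h : IsFixedProfile A c s r) : ∃ x, s ≤ x ∧ x < 1 ∧
    innerMap c s r 0 ^ r * profileMap c x = x ^ r := by
  have hs := h.scale_pos
  have hs1 := h.scale_lt_one
  have hr := h.one_lt_exp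
  have hr0 : 0 < r := by linarith
  have hz := h.prof.innerMap_pos h.one_lt hs (q := r) (y := 0) (by simp)
  have hzr : 0 < innerMap c s r 0 ^ r := Real.rpow_pos_of_pos hz r
  have hanti := h.prof.map_strictAnti h.one_lt
  have hcont : ContinuousOn (fun x => innerMap c s r 0 ^ r * profileMap c x - x ^ r)
      (Set.Icc 0 1) := by
    refine ContinuousOn.sub (continuousOn_const.mul fun x _ => ?_) ?_
    · exact (h.prof.hasDerivAt_map h.one_lt x).continuousAt.continuousWithinAt
    · exact (Real.continuous_rpow_const hr0.le).continuousOn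
  obtain ⟨x, hx, hx0⟩ := intermediate_value_Icc' (zero_le_one (α := ℝ)) hcont
    (show (0 : ℝ) ∈ _ by
      constructor
      · simp [h.prof.map_one]
      · simp [h.prof.map_zero h.one_lt, Real.zero_rpow hr0.ne', hzr.le])
  have hxr : innerMap c s r 0 ^ r * profileMap c x = x ^ r := by simpa [sub_eq_zero] using hx0
  have hx1 : x < 1 := by
    refine lt_of_le_of_ne hx.2 ?_
    rintro rfl
    simp [h.prof.map_one] at hxr
  refine ⟨x, ?_, hx1, hxr⟩
  by_contra! hxs
  have hb1 : x / s < 1 := (div_lt_one hs).2 hxs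
  have hb0 : 0 ≤ x / s := div_nonneg hx.1 hs.le
  have hsb : s * (x / s) = x := by field_simp
  have hin : innerMap c s r (-(x / s)) = x := by
    rw [h.inner_eq (by rw [mul_neg, hsb]; linarith), mul_neg, neg_neg, hsb, hxr, one_div,
      Real.rpow_rpow_inv hx.1 hr0.ne']
  have h1 := h.map_inner (-(x / s)) ⟨by linarith, by linarith⟩
  have h2 : innerMap c s r 0 ^ r * profileMap c (-(x / s)) = (x / s) ^ r := by
    rw [Real.div_rpow hx.1 hs.le, eq_div_iff (Real.rpow_pos_of_pos hs r).ne', ← hxr, ← hin, h1, hin]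
    ring
  have h3 : (x / s) ^ r < 1 := Real.rpow_lt_one hb0 hb1 hr0
  rw [← h2, ← h.inner_zero_rpow_mul] at h3
  have h4 := hanti.lt_iff_gt.1 (lt_of_mul_lt_mul_left h3 hzr.le)
  have h5 : s ^ r ≤ (x / s) ^ r := by
    rw [← h2]
    calc s ^ r ≤ innerMap c s r 0 ^ r := Real.rpow_le_rpow hs.le h.scale_le hr0.le
      _ = innerMap c s r 0 ^ r * 1 := (mul_one _).symm
      _ ≤ _ := mul_le_mul_of_nonneg_left (h.prof.one_le_map h.one_lt (by linarith)) hzr.le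
  rw [Real.rpow_le_rpow_iff hs.le hb0 hr0] at h5
  linarith

theorem scale_le_inner (h : IsFixedProfile A c s r) {y : ℝ} (hy : y ∈ Set.Icc (-1 : ℝ) 1) :
    s ≤ innerMap c s r y := by
  obtain ⟨x, hsx, hx1, hx⟩ := h.exists_crossing
  have hs := h.scale_pos
  have hr := h.one_lt_exp
  have hz := h.prof.innerMap_pos h.one_lt hs (q := r) (y := 0) (by simp)
  refine hsx.trans ?_
  have hys : -s ≤ s * y := by nlinarith [hy.1]
  rw [h.inner_eq (by linarith [h.scale_lt_one]), one_div,
    Real.le_rpow_inv_iff_of_pos (by linarith) _ (by linarith), ← hx]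
  · exact mul_le_mul_of_nonneg_left ((h.prof.map_strictAnti h.one_lt).antitone (by linarith))
      (Real.rpow_nonneg hz.le _)
  · refine mul_nonneg (Real.rpow_nonneg hz.le _) (h.prof.map_pos h.one_lt ?_).le
    linarith [h.scale_lt_one]

end IsFixedProfile

namespace IsFixedProfile

variable {A s r : ℝ} {c : ℝ → ℝ}

theorem hasDerivAt_inner (h : IsFixedProfile A c s r) {y : ℝ} (hy : -A ≤ y) :
    HasDerivAt (innerMap c s r) (innerConst c s r / innerWeight c s r y ^ 2) y :=
  h.prof.hasDerivAt_innerMap h.one_lt h.scale_pos h.one_lt_exp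
    (IsProfile.lt_of_scale h.scale_pos h.scale_mul hy)

theorem inner_strictMonoOn (h : IsFixedProfile A c s r) :
    StrictMonoOn (innerMap c s r) (Set.Ici (-A)) :=
  (h.prof.innerMap_strictMonoOn h.one_lt h.scale_pos h.one_lt_exp).mono fun _ hy =>
    IsProfile.lt_of_scale h.scale_pos h.scale_mul hy

theorem inner_mem (h : IsFixedProfile A c s r) {y : ℝ} (hy : y ∈ Set.Ioo (-1 : ℝ) 1) :
    innerMap c s r y ∈ Set.Ioo s 1 := by
  have h1 := h.one_lt
  constructor
  · refine (h.scale_le_inner (y := -1) (by norm_num)).trans_lt ?_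
    exact h.inner_strictMonoOn (Set.mem_Ici.2 (by linarith))
      (Set.mem_Ici.2 (by linarith [hy.1])) hy.1
  · rw [← h.prof.innerMap_one h.one_lt h.scale_pos (q := r)]
    exact h.inner_strictMonoOn (Set.mem_Ici.2 (by linarith [hy.1]))
      (Set.mem_Ici.2 (by linarith)) hy.2

theorem jump_eq (h : IsFixedProfile A c s r) {L R : ℝ → ℝ}
    (hL : ∀ y ∈ Set.Ioo (-1 : ℝ) 1, HasDerivWithinAt c (L y) (Set.Iio y) y)
    (hR : ∀ y ∈ Set.Ioo (-1 : ℝ) 1, HasDerivWithinAt c (R y) (Set.Ioi y) y)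
    {y : ℝ} (hy : y ∈ Set.Ioo (-1 : ℝ) 1) :
    (L y - R y) / c y = innerConst c s r / innerWeight c s r y ^ 2 *
      ((L (innerMap c s r y) - R (innerMap c s r y)) / c (innerMap c s r y))
      + s * ((L (-(s * y)) - R (-(s * y))) / c (-(s * y))) := by
  have hA := h.one_lt
  have hs := h.scale_pos
  have hs1 := h.scale_lt_one
  have hsy : -(s * y) ∈ Set.Ioo (-1 : ℝ) 1 := by
    constructor <;> nlinarith [hy.1, hy.2]
  have hin : innerMap c s r y ∈ Set.Ioo (-1 : ℝ) 1 :=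
    ⟨by linarith [(h.inner_mem hy).1], (h.inner_mem hy).2⟩
  have hφ := h.hasDerivAt_inner (y := y) (by linarith [hy.1])
  obtain ⟨a, ha⟩ : ∃ a, a = (1 - 1 / r) / 2 := ⟨_, rfl⟩
  have hV := h.prof.map_pos hA hsy.2
  obtain ⟨P, hP⟩ : ∃ P, HasDerivAt (fun y => profileMap c (-(s * y)) ^ a) P y :=
    ⟨_, (h.prof.hasDerivAt_map_scale hA y).rpow_const (Or.inl hV.ne')⟩
  have hlin : HasDerivAt (fun y => -(s * y)) (-s) y :=
    HasDerivAt.congr_deriv ((hasDerivAt_id y).const_mul s).neg (by ring)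
  have hfun : Set.EqOn c (fun y => c (innerMap c s r y) * (profileMap c (-(s * y)) ^ a *
      c (-(s * y))) / c (innerMap c s r 0)) (Set.Icc (-1) 1) := by
    intro x hx
    rw [← h.fixed x hx, renormProfile, innerWeight, ha]
  have hev : c =ᶠ[nhds y] (fun y => c (innerMap c s r y) * (profileMap c (-(s * y)) ^ a *
      c (-(s * y))) / c (innerMap c s r 0)) :=
    Filter.eventuallyEq_of_mem (Icc_mem_nhds hy.1 hy.2) hfun
  have hmono : ∀ x ∈ Set.Iio y ∩ Set.Ioi (-1), innerMap c s r x ∈ Set.Iio (innerMap c s r y) :=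
    fun x hx => h.inner_strictMonoOn (Set.mem_Ici.2 (by linarith [Set.mem_Ioi.1 hx.2]))
      (Set.mem_Ici.2 (by linarith [hy.1])) hx.1
  have hmono' : ∀ x ∈ Set.Ioi y, innerMap c s r x ∈ Set.Ioi (innerMap c s r y) :=
    fun x hx => h.inner_strictMonoOn (Set.mem_Ici.2 (by linarith [hy.1]))
      (Set.mem_Ici.2 (by linarith [hy.1, Set.mem_Ioi.1 hx])) hx
  have hl1 : HasDerivWithinAt (fun y => c (innerMap c s r y))
      (L (innerMap c s r y) * (innerConst c s r / innerWeight c s r y ^ 2)) (Set.Iio y) y := by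
    have := HasDerivWithinAt.comp y (hL _ hin)
      (hφ.hasDerivWithinAt (s := Set.Iio y ∩ Set.Ioi (-1))) hmono
    exact (hasDerivWithinAt_inter (Ioi_mem_nhds hy.1)).1 this
  have hr1 : HasDerivWithinAt (fun y => c (innerMap c s r y))
      (R (innerMap c s r y) * (innerConst c s r / innerWeight c s r y ^ 2)) (Set.Ioi y) y :=
    HasDerivWithinAt.comp y (hR _ hin) hφ.hasDerivWithinAt hmono'
  have hl2 : HasDerivWithinAt (fun y => c (-(s * y))) (R (-(s * y)) * -s) (Set.Iio y) y :=
    HasDerivWithinAt.comp (h₂ := c) y (hR _ hsy) hlin.hasDerivWithinAt fun x hx => by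
      have : x < y := hx
      simp only [Set.mem_Ioi]; nlinarith
  have hr2 : HasDerivWithinAt (fun y => c (-(s * y))) (L (-(s * y)) * -s) (Set.Ioi y) y :=
    HasDerivWithinAt.comp (h₂ := c) y (hL _ hsy) hlin.hasDerivWithinAt fun x hx => by
      have : y < x := hx
      simp only [Set.mem_Iio]; nlinarith
  have hl := (hl1.mul (hP.hasDerivWithinAt.mul hl2)).div_const (c (innerMap c s r 0))
  have hr := (hr1.mul (hP.hasDerivWithinAt.mul hr2)).div_const (c (innerMap c s r 0))
  have el := (uniqueDiffWithinAt_Iio y).eq_deriv _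
    ((hL y hy).congr_of_eventuallyEq (hev.symm.filter_mono nhdsWithin_le_nhds)
      hev.symm.self_of_nhds) hl
  have er := (uniqueDiffWithinAt_Ioi y).eq_deriv _
    ((hR y hy).congr_of_eventuallyEq (hev.symm.filter_mono nhdsWithin_le_nhds)
      hev.symm.self_of_nhds) hr
  have p0 := h.prof.pos hA (innerMap c s r 0)
  have p1 := h.prof.pos hA (innerMap c s r y)
  have p2 := h.prof.pos hA (-(s * y))
  have p3 : 0 < profileMap c (-(s * y)) ^ a := Real.rpow_pos_of_pos hV a
  simp only [Pi.mul_apply] at el er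
  rw [el, er, hev.self_of_nhds]
  field_simp
  ring

/-- The profile of a fixed point is differentiable. -/
theorem hasDerivAt_profile (h : IsFixedProfile A c s r) : ∃ L : ℝ → ℝ,
    ∀ y ∈ Set.Ioo (-1 : ℝ) 1, HasDerivAt c (L y) y ∧
      (∀ z ∈ Set.Icc (-1 : ℝ) 1, c z - c y ≤ L y * (z - y)) ∧ |L y| ≤ 2 / (A - 1) := by
  have hA := h.one_lt
  have hA1 : 0 < A - 1 := by linarith
  have hs := h.scale_pos
  have hs1 := h.scale_lt_one
  obtain ⟨L, R, hLR⟩ := h.prof.concave.exists_one_sided_derivs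
  have hsub : ∀ y ∈ Set.Ioo (-1 : ℝ) 1, y ∈ Set.Icc (-1 : ℝ) 1 := fun y hy => ⟨hy.1.le, hy.2.le⟩
  have hLle : ∀ y ∈ Set.Ioo (-1 : ℝ) 1, L y ≤ 2 / (A - 1) := by
    intro y hy
    have h1 := (hLR y hy).2.2.2.2 (-1) (by norm_num) hy.1
    have h2 := h.prof.slope_bound hA (by norm_num : (-1 : ℝ) ∈ _) (hsub y hy) hy.1
    have h3 := mul_le_mul_of_nonneg_right (le_abs_self (c y - c (-1))) hA1.le
    have hy1 : 0 < y - -1 := by linarith [hy.1]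
    rw [le_div_iff₀ hA1]
    refine le_of_mul_le_mul_right ?_ hy1
    nlinarith
  have hRle : ∀ y ∈ Set.Ioo (-1 : ℝ) 1, -(2 / (A - 1)) ≤ R y := by
    intro y hy
    have h1 := (hLR y hy).2.2.2.1 1 (by norm_num) hy.2
    have h2 := h.prof.slope_bound hA (hsub y hy) (by norm_num : (1 : ℝ) ∈ _) hy.2
    have h3 := mul_le_mul_of_nonneg_right (neg_abs_le (c 1 - c y)) hA1.le
    have hy1 : 0 < 1 - y := by linarith [hy.2]
    rw [neg_le, div_eq_mul_inv, ← div_eq_mul_inv, le_div_iff₀ hA1]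
    refine le_of_mul_le_mul_right ?_ hy1
    nlinarith
  have hanti : ∀ x ∈ Set.Ioo (-1 : ℝ) 1, ∀ y ∈ Set.Ioo (-1 : ℝ) 1, x < y → L y ≤ R x := by
    intro x hx y hy hxy
    have h1 := (hLR x hx).2.2.2.1 y (hsub y hy) hxy
    have h2 := (hLR y hy).2.2.2.2 x (hsub x hx) hxy
    exact le_of_mul_le_mul_right (h2.trans h1) (sub_pos.2 hxy)
  have hmem : ∀ y ∈ Set.Ioo (-1 : ℝ) 1, -(s * y) ∈ Set.Ioo (-s) s := by
    intro y hy
    constructor <;> nlinarith [hy.1, hy.2]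
  have hw : ∀ y ∈ Set.Ioo (-1 : ℝ) 1, 0 < A ^ 2 - y ^ 2 := by
    intro y hy
    nlinarith [hy.1, hy.2]
  have hj : ∀ y ∈ Set.Ioo (-1 : ℝ) 1, 0 ≤ (L y - R y) / c y := fun y hy =>
    div_nonneg (sub_nonneg.2 (hLR y hy).2.2.1) (h.prof.pos hA y).le
  have hinA : 0 < innerMap c s r A :=
    h.prof.innerMap_pos hA hs (IsProfile.lt_of_scale hs h.scale_mul (by linarith))
  have hzero : ∀ y ∈ Set.Ioo (-1 : ℝ) 1, (L y - R y) / c y * (A ^ 2 - y ^ 2) = 0 := by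
    intro y hy
    refine eq_zero_of_transfer (I := Set.Ioo (-1 : ℝ) 1)
      (g := fun y => (L y - R y) / c y * (A ^ 2 - y ^ 2)) (u := innerMap c s r)
      (v := fun y => -(s * y)) (κ := max (innerMap c s r A / A) s)
      (M := A ^ 3 / (A - 1) * (2 * (2 / (A - 1))))
      (hs.le.trans (le_max_right _ _)) (max_lt ((div_lt_one (by linarith)).2 h.inner_lt) hs1)
      (fun y hy => mul_nonneg (hj y hy) (hw y hy).le) ?_ ?_ ?_ ?_ ?_ ?_ ?_ hy
    · intro F hF
      calc ∑ y ∈ F, (L y - R y) / c y * (A ^ 2 - y ^ 2)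
          ≤ ∑ y ∈ F, A ^ 3 / (A - 1) * (L y - R y) := by
            refine Finset.sum_le_sum fun y hy => ?_
            have h1 := h.prof.lower hA y
            have h2 := h.prof.pos hA y
            have h3 := sub_nonneg.2 (hLR y (hF hy)).2.2.1
            rw [div_le_iff₀ (by linarith)] at h1
            rw [div_mul_eq_mul_div, div_mul_eq_mul_div, div_le_div_iff₀ h2 hA1]
            have h4 : (A ^ 2 - y ^ 2) * (A - 1) ≤ A ^ 3 * c y := by
              have h5 := mul_le_mul_of_nonneg_left h1 (sq_nonneg A)
              nlinarith [mul_nonneg (sq_nonneg y) hA1.le]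
            nlinarith [mul_le_mul_of_nonneg_left h4 h3]
        _ = A ^ 3 / (A - 1) * ∑ y ∈ F, (L y - R y) := by rw [Finset.mul_sum]
        _ ≤ _ := mul_le_mul_of_nonneg_left
            (sum_jump_le hLle hRle hanti F hF (by positivity)) (by positivity)
    · intro y hy
      exact ⟨by linarith [(h.inner_mem hy).1], (h.inner_mem hy).2⟩
    · intro y hy
      exact ⟨by linarith [(hmem y hy).1], by linarith [(hmem y hy).2]⟩
    · exact h.inner_strictMonoOn.injOn.mono fun y hy => by
        simp only [Set.mem_Ici]; linarith [hy.1]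
    · intro x _ y _ hxy
      have : s * x = s * y := neg_injective hxy
      exact mul_left_cancel₀ hs.ne' this
    · intro x hx y hy hxy
      have h1 := (h.inner_mem hx).1
      have h2 := (hmem y hy).2
      rw [hxy] at h1
      exact lt_asymm h1 h2
    · intro y hy
      have hin : innerMap c s r y ∈ Set.Ioo (-1 : ℝ) 1 :=
        ⟨by linarith [(h.inner_mem hy).1], (h.inner_mem hy).2⟩
      have hsy : -(s * y) ∈ Set.Ioo (-1 : ℝ) 1 :=
        ⟨by linarith [(hmem y hy).1], by linarith [(hmem y hy).2]⟩
      have h1 := ConcaveOn.primitive_deriv_weight_le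
        (h.prof.innerConst_pos hA hs h.one_lt_exp).le
        (h.prof.innerWeight_concave' hA hs h.scale_mul h.one_lt_exp)
        (fun t ht => h.prof.innerWeight_pos hA (IsProfile.lt_of_scale hs h.scale_mul ht.1))
        (fun t ht => h.hasDerivAt_inner ht.1)
        (h.prof.innerMap_pos hA hs (IsProfile.lt_of_scale hs h.scale_mul le_rfl)).le
        hinA h.inner_lt.le (y := y) ⟨by linarith [hy.1], by linarith [hy.2]⟩
      have h2 : innerConst c s r / innerWeight c s r y ^ 2 * (A ^ 2 - y ^ 2)
          ≤ max (innerMap c s r A / A) s * (A ^ 2 - innerMap c s r y ^ 2) :=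
        h1.trans (mul_le_mul_of_nonneg_right (le_max_left _ _) (hw _ hin).le)
      have h3 : s * (A ^ 2 - y ^ 2)
          ≤ max (innerMap c s r A / A) s * (A ^ 2 - (-(s * y)) ^ 2) := by
        refine mul_le_mul (le_max_right _ _) ?_ (hw _ hy).le (hs.le.trans (le_max_right _ _))
        nlinarith [mul_nonneg (sq_nonneg y) (show 0 ≤ 1 - s ^ 2 by nlinarith)]
      have h4 := mul_le_mul_of_nonneg_left h2 (hj _ hin)
      have h5 := mul_le_mul_of_nonneg_left h3 (hj _ hsy)
      have h6 := h.jump_eq (fun y hy => (hLR y hy).1) (fun y hy => (hLR y hy).2.1) hy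
      rw [h6]
      linarith
  have heq : ∀ y ∈ Set.Ioo (-1 : ℝ) 1, L y = R y := by
    intro y hy
    have h1 := (mul_eq_zero.1 (hzero y hy)).resolve_right (hw y hy).ne'
    exact sub_eq_zero.1 ((div_eq_zero_iff.1 h1).resolve_right (h.prof.pos hA y).ne')
  refine ⟨L, fun y hy => ⟨?_, fun z hz => ?_, abs_le.2 ⟨heq y hy ▸ hRle y hy, hLle y hy⟩⟩⟩
  · have h1 := (hLR y hy).1
    have h2 := (hLR y hy).2.1
    rw [← heq y hy] at h2
    exact hasDerivAt_iff_tendsto_slope_left_right.2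
      ⟨(hasDerivWithinAt_iff_tendsto_slope' Set.self_notMem_Iio).1 h1,
        (hasDerivWithinAt_iff_tendsto_slope' Set.self_notMem_Ioi).1 h2⟩
  · obtain ⟨-, -, -, h4, h5⟩ := hLR y hy
    rcases lt_trichotomy z y with hzy | rfl | hzy
    · linarith [h5 z hz hzy]
    · simp
    · rw [heq y hy]; exact h4 z hz hzy

end IsFixedProfile

/-- The derivative of a function with everywhere defined antitone bounded derivative on `(a, b)`
is continuous and has a limit at `b`. -/
theorem exists_continuousOn_Ioc_deriv {f L : ℝ → ℝ} {a b M : ℝ} (hf : Continuous f) (hab : a < b)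
    (hL : ∀ y ∈ Set.Ioo a b, HasDerivAt f (L y) y) (hanti : AntitoneOn L (Set.Ioo a b))
    (hM : ∀ y ∈ Set.Ioo a b, |L y| ≤ M) :
    ∃ N : ℝ → ℝ, ContinuousOn N (Set.Ioc a b) ∧ Set.EqOn N L (Set.Ioo a b) := by
  classical
  have hleft : ∀ y ∈ Set.Ioc a b, Filter.Tendsto L (nhdsWithin y (Set.Iio y))
      (nhds (sInf (L '' Set.Ioo a y))) := by
    intro y hy
    have hsub : Set.Ioo a y ⊆ Set.Ioo a b := Set.Ioo_subset_Ioo_right hy.2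
    refine (hanti.mono hsub).tendsto_nhdsWithin_Ioo_left (Set.nonempty_Ioo.2 hy.1) ⟨-M, ?_⟩
    rintro _ ⟨x, hx, rfl⟩
    exact (abs_le.1 (hM x (hsub hx))).1
  have hright : ∀ y ∈ Set.Ioo a b, Filter.Tendsto L (nhdsWithin y (Set.Ioi y))
      (nhds (sSup (L '' Set.Ioo y b))) := by
    intro y hy
    have hsub : Set.Ioo y b ⊆ Set.Ioo a b := Set.Ioo_subset_Ioo_left hy.1.le
    refine (hanti.mono hsub).tendsto_nhdsWithin_Ioo_right (Set.nonempty_Ioo.2 hy.2) ⟨M, ?_⟩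
    rintro _ ⟨x, hx, rfl⟩
    exact (abs_le.1 (hM x (hsub hx))).2
  have hderivl : ∀ y ∈ Set.Ioo a b, sInf (L '' Set.Ioo a y) = L y := by
    intro y hy
    have hsub : Set.Ioo a y ⊆ Set.Ioo a b := Set.Ioo_subset_Ioo_right hy.2.le
    have h1 := hasDerivWithinAt_Iic_of_tendsto_deriv (f := f) (s := Set.Ioo a y) (a := y)
      (fun x hx => (hL x (hsub hx)).differentiableAt.differentiableWithinAt)
      hf.continuousAt.continuousWithinAt (Ioo_mem_nhdsLT hy.1)
      ((hleft y ⟨hy.1, hy.2.le⟩).congr' (Filter.eventuallyEq_of_mem (Ioo_mem_nhdsLT hy.1)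
        fun x hx => (hL x (hsub hx)).deriv.symm))
    exact (uniqueDiffOn_Iic y y Set.self_mem_Iic).eq_deriv _ h1 (hL y hy).hasDerivWithinAt
  have hderivr : ∀ y ∈ Set.Ioo a b, sSup (L '' Set.Ioo y b) = L y := by
    intro y hy
    have hsub : Set.Ioo y b ⊆ Set.Ioo a b := Set.Ioo_subset_Ioo_left hy.1.le
    have h1 := hasDerivWithinAt_Ici_of_tendsto_deriv (f := f) (s := Set.Ioo y b) (a := y)
      (fun x hx => (hL x (hsub hx)).differentiableAt.differentiableWithinAt)
      hf.continuousAt.continuousWithinAt (Ioo_mem_nhdsGT hy.2)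
      ((hright y hy).congr' (Filter.eventuallyEq_of_mem (Ioo_mem_nhdsGT hy.2)
        fun x hx => (hL x (hsub hx)).deriv.symm))
    exact (uniqueDiffOn_Ici y y Set.self_mem_Ici).eq_deriv _ h1 (hL y hy).hasDerivWithinAt
  obtain ⟨N, hN⟩ : ∃ N, N = Function.update L b (sInf (L '' Set.Ioo a b)) := ⟨_, rfl⟩
  have hNL : Set.EqOn N L (Set.Ioo a b) := fun y hy => by
    rw [hN, Function.update_of_ne hy.2.ne]
  refine ⟨N, fun y hy => ?_, hNL⟩
  rcases hy.2.eq_or_lt with rfl | hyb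
  · have h1 : ContinuousWithinAt N (Set.Iio y) y := by
      rw [ContinuousWithinAt, show N y = sInf (L '' Set.Ioo a y) by rw [hN, Function.update_self]]
      exact (hleft y hy).congr' (Filter.eventuallyEq_of_mem (Ioo_mem_nhdsLT hy.1)
        fun x hx => (hNL hx).symm)
    exact (continuousWithinAt_Iio_iff_Iic.1 h1).mono fun x hx => hx.2
  · have hy' : y ∈ Set.Ioo a b := ⟨hy.1, hyb⟩
    have h1 : ContinuousAt L y := by
      rw [continuousAt_iff_continuous_left'_right']
      refine ⟨?_, ?_⟩
      · rw [ContinuousWithinAt, ← hderivl y hy']; exact hleft y hy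
      · have := hright y hy'
        rwa [hderivr y hy'] at this
    exact (h1.congr (Filter.eventuallyEq_of_mem (Ioo_mem_nhds hy.1 hyb)
      fun x hx => (hNL hx).symm)).continuousWithinAt

theorem IsFixedProfile.exists_contDiff_extension {A s r : ℝ} {c : ℝ → ℝ}
    (h : IsFixedProfile A c s r) {x : ℝ} (hx0 : 0 ≤ x) (hx1 : x < 1) : ∃ W W' W'' : ℝ → ℝ,
      (∀ y, HasDerivAt W (W' y) y) ∧ (∀ y, HasDerivAt W' (W'' y) y) ∧ Continuous W'' ∧
      (∀ y, W' y < 0) ∧ ∀ y ∈ Set.Icc (-x) 1, W y = profileMap c y := by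
  have hA := h.one_lt
  have hc := h.prof.pos hA
  have hI := h.prof.int_pos hA
  obtain ⟨L, hL⟩ := h.hasDerivAt_profile
  have hanti : AntitoneOn L (Set.Ioo (-1) 1) := by
    intro y hy z hz hyz
    rcases hyz.eq_or_lt with rfl | hyz
    · rfl
    have h1 := (hL y hy).2.1 z ⟨hz.1.le, hz.2.le⟩
    have h2 := (hL z hz).2.1 y ⟨hy.1.le, hy.2.le⟩
    exact le_of_mul_le_mul_right (by linarith) (sub_pos.2 hyz)
  obtain ⟨N, hNc, hNL⟩ := exists_continuousOn_Ioc_deriv h.prof.cont (by norm_num)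
    (fun y hy => (hL y hy).1) hanti (fun y hy => (hL y hy).2.2)
  obtain ⟨ρ, hρ⟩ : ∃ ρ : ℝ → ℝ, ρ = fun y => N (max (-x) (min y 1)) / c (max (-x) (min y 1)) :=
    ⟨_, rfl⟩
  have hcl : ∀ y : ℝ, max (-x) (min y 1) ∈ Set.Ioc (-1 : ℝ) 1 := fun y =>
    ⟨(by linarith : -1 < -x).trans_le (le_max_left _ _),
      max_le (by linarith) (min_le_right _ _)⟩
  have hρc : Continuous ρ := by
    rw [hρ]
    have hcc : Continuous fun y : ℝ => max (-x) (min y 1) := by fun_prop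
    exact (hNc.comp_continuous hcc hcl).div (h.prof.cont.comp hcc) fun y => (hc _).ne'
  obtain ⟨P, hP⟩ : ∃ P : ℝ → ℝ, P = fun y => ∫ t in (0 : ℝ)..y, ρ t := ⟨_, rfl⟩
  have hPd : ∀ y, HasDerivAt P (ρ y) y := fun y => by
    rw [hP]
    exact intervalIntegral.integral_hasDerivAt_right (hρc.intervalIntegrable _ _)
      (hρc.stronglyMeasurableAtFilter _ _) hρc.continuousAt
  have hP0 : P 0 = 0 := by rw [hP]; exact intervalIntegral.integral_same
  have hlog : ∀ y ∈ Set.Icc (-x) 1, Real.log (c y) - P y = Real.log (c (-x)) - P (-x) := by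
    refine constant_of_has_deriv_right_zero (fun y _ => ?_) fun y hy => ?_
    · exact ((h.prof.cont.continuousAt.log (hc y).ne').sub
        (hPd y).continuousAt).continuousWithinAt
    · have hy' : y ∈ Set.Ioo (-1 : ℝ) 1 := ⟨by linarith [hy.1], hy.2⟩
      refine (((hL y hy').1.log (hc y).ne').sub (hPd y)).hasDerivWithinAt.congr_deriv ?_
      rw [hρ]
      simp only
      rw [min_eq_left hy.2.le, max_eq_right hy.1, hNL hy', sub_self]
  have hcP : ∀ y ∈ Set.Icc (-x) 1, c y = Real.exp (P y) := by
    intro y hy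
    have h1 := hlog y hy
    have h0 := hlog 0 ⟨by linarith, by norm_num⟩
    rw [h.prof.zero, Real.log_one, hP0] at h0
    rw [← h0] at h1
    rw [← Real.exp_log (hc y)]
    congr 1
    linarith
  obtain ⟨D, hD⟩ : ∃ D : ℝ → ℝ, D = fun y => -(Real.exp (-(2 * P y)) / profileInt c) := ⟨_, rfl⟩
  have hDd : ∀ y, HasDerivAt D (2 * ρ y * Real.exp (-(2 * P y)) / profileInt c) y := fun y => by
    rw [hD]
    refine HasDerivAt.congr_deriv (((((hPd y).const_mul 2).neg).exp.div_const _).neg) ?_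
    simp only [Pi.neg_apply]
    ring
  have hPc : Continuous P := continuous_iff_continuousAt.2 fun y => (hPd y).continuousAt
  have hDc : Continuous D := continuous_iff_continuousAt.2 fun y => (hDd y).continuousAt
  have hWd : ∀ y, HasDerivAt (fun y => ∫ t in (1 : ℝ)..y, D t) (D y) y := fun y =>
    intervalIntegral.integral_hasDerivAt_right (hDc.intervalIntegrable _ _)
      (hDc.stronglyMeasurableAtFilter _ _) hDc.continuousAt
  refine ⟨fun y => ∫ t in (1 : ℝ)..y, D t, D, _, hWd, hDd, ?_, fun y => ?_, ?_⟩
  · fun_prop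
  · rw [hD]
    exact neg_neg_of_pos (div_pos (Real.exp_pos _) hI)
  · have hconst : ∀ y ∈ Set.Icc (-x) 1, (∫ t in (1 : ℝ)..y, D t) - profileMap c y
        = (∫ t in (1 : ℝ)..(-x), D t) - profileMap c (-x) := by
      refine constant_of_has_deriv_right_zero
        (f := fun y => (∫ t in (1 : ℝ)..y, D t) - profileMap c y) (fun y _ => ?_) fun y hy => ?_
      · exact ((hWd y).sub (h.prof.hasDerivAt_map hA y)).continuousAt.continuousWithinAt
      · refine ((hWd y).sub (h.prof.hasDerivAt_map hA y)).hasDerivWithinAt.congr_deriv ?_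
        rw [hD, hcP y ⟨hy.1, hy.2.le⟩]
        simp only
        rw [one_div, ← Real.exp_nat_mul, ← Real.exp_neg]
        push_cast
        ring
    intro y hy
    have h1 := hconst 1 ⟨by linarith, le_rfl⟩
    have h2 := hconst y hy
    rw [intervalIntegral.integral_same, h.prof.map_one] at h1
    linarith

theorem IsFixedProfile.exists_transition {A s r : ℝ} {c : ℝ → ℝ} (h : IsFixedProfile A c s r) :
    ∃ (b : ℝ) (Y : ℝ → ℝ) (O : Set ℝ), 1 ≤ b ∧ s * b < 1 ∧ IsOpen O ∧ Set.Icc (-b) b ⊆ O ∧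
      ContDiffOn ℝ 2 Y O ∧ (∀ y ∈ Set.Icc (-b) b, deriv Y y < 0) ∧
      Y (-b) = b ^ r ∧ Y 1 = 0 ∧ Y (s * b) = (s * b) ^ r ∧
      ∀ y ∈ Set.Icc (-b) 1, ∃ z ∈ Set.Icc (0 : ℝ) 1, Y z = s ^ r * Y y ∧ z ^ r = Y (-(s * y)) := by
  have hs := h.scale_pos
  have hs1 := h.scale_lt_one
  have hA := h.one_lt
  have hr := h.one_lt_exp
  have hr0 : r ≠ 0 := by linarith
  have hsr : 0 < s ^ r := Real.rpow_pos_of_pos hs r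
  obtain ⟨x, hsx, hx1, hx⟩ := h.exists_crossing
  have hx0 : 0 < x := hs.trans_le hsx
  obtain ⟨W, W', W'', hW, hW', hWc, hWn, hWV⟩ := h.exists_contDiff_extension hx0.le hx1
  have hz := h.prof.innerMap_pos h.one_lt hs (q := r) (y := 0) (by simp)
  obtain ⟨k, hk⟩ : ∃ k, k = innerMap c s r 0 ^ r := ⟨_, rfl⟩
  have hk0 : 0 < k := hk ▸ Real.rpow_pos_of_pos hz r
  have hW2 : ContDiff ℝ 2 W := by
    have e1 : deriv W = W' := funext fun y => (hW y).deriv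
    have e2 : deriv W' = W'' := funext fun y => (hW' y).deriv
    rw [show (2 : WithTop ℕ∞) = 1 + 1 from rfl, contDiff_succ_iff_deriv, e1]
    refine ⟨fun y => (hW y).differentiableAt, by simp, ?_⟩
    rw [contDiff_one_iff_deriv, e2]
    exact ⟨fun y => (hW' y).differentiableAt, hWc⟩
  obtain ⟨U, hU⟩ : ∃ U : ℝ → ℝ, U = fun y => k * W y := ⟨_, rfl⟩
  have hU2 : ContDiff ℝ 2 U := by rw [hU]; exact contDiff_const.mul hW2
  have hUd : ∀ y, HasDerivAt U (k * W' y) y := fun y => by rw [hU]; exact (hW y).const_mul k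
  have hUn : ∀ y, k * W' y < 0 := fun y => mul_neg_of_pos_of_neg hk0 (hWn y)
  have hUa : StrictAnti U := strictAnti_of_hasDerivAt_neg hUd hUn
  have hUV : ∀ y ∈ Set.Icc (-x) 1, U y = k * profileMap c y := fun y hy => by
    rw [hU]; simp only; rw [hWV y hy]
  have hU1 : U 1 = 0 := by rw [hUV 1 ⟨by linarith, le_rfl⟩, h.prof.map_one, mul_zero]
  have hUs : U (-s) = 1 := by
    rw [hUV (-s) ⟨by linarith, by linarith⟩, hk, h.inner_zero_rpow_mul]
  have hUx : U x = x ^ r := by rw [hUV x ⟨by linarith, hx1.le⟩, hk, hx]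
  obtain ⟨G, hG⟩ : ∃ G : ℝ → ℝ, G = fun y => U (-(s * y)) ^ (1 / r) := ⟨_, rfl⟩
  obtain ⟨Y, hY⟩ : ∃ Y : ℝ → ℝ, Y = fun y => (s ^ r)⁻¹ * U (G y) := ⟨_, rfl⟩
  have hsb : s * (x / s) = x := by field_simp
  have hYU : ∀ y ∈ Set.Icc (-x) 1, Y y = U y := by
    intro y hy
    have hy1 : y ∈ Set.Icc (-1 : ℝ) 1 := ⟨by linarith [hy.1], hy.2⟩
    have hGy : G y = innerMap c s r y := by
      rw [h.inner_eq (by nlinarith [hy1.1]), ← hk, hG]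
      simp only
      rw [hUV _ ⟨by nlinarith [hy1.2], by nlinarith [hy1.1]⟩]
    rw [hY]
    simp only
    rw [hGy, hUV _ ⟨?_, ?_⟩, h.map_inner y hy1, hUV y hy]
    · field_simp
    · linarith [h.scale_le_inner hy1]
    · exact h.prof.innerMap_le_one hA hs h.scale_mul hr hy1
  have hpos : ∀ y ∈ {y : ℝ | s * y > -1}, 0 < U (-(s * y)) := fun y hy => by
    rw [← hU1]
    exact hUa (by linarith [show s * y > -1 from hy])
  have hGr : ∀ y ∈ {y : ℝ | s * y > -1}, G y ^ r = U (-(s * y)) := fun y hy => by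
    rw [hG]
    simp only
    rw [one_div, Real.rpow_inv_rpow (hpos y hy).le hr0]
  have hsub : Set.Icc (-(x / s)) (x / s) ⊆ {y : ℝ | s * y > -1} := fun y hy => by
    have := mul_le_mul_of_nonneg_left hy.1 hs.le
    rw [mul_neg, hsb] at this
    exact (show s * y > -1 by linarith)
  have hb1 : 1 ≤ x / s := (one_le_div hs).2 hsx
  refine ⟨x / s, Y, {y | s * y > -1}, hb1, by rwa [hsb], isOpen_lt (by fun_prop) (by fun_prop),
    hsub, fun y hy => ?_, fun y hy => ?_, ?_, ?_, ?_, fun y hy => ?_⟩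
  · rw [hY, hG]
    have h1 : ContDiffAt ℝ 2 (fun y => U (-(s * y))) y :=
      hU2.contDiffAt.comp y (by fun_prop : ContDiffAt ℝ 2 (fun y : ℝ => -(s * y)) y)
    exact (contDiffAt_const.mul (hU2.contDiffAt.comp y
      (h1.rpow_const_of_ne (hpos y hy).ne'))).contDiffWithinAt
  · have hp := hpos y (hsub hy)
    have h1 : HasDerivAt (fun y => -(s * y)) (-s) y :=
      HasDerivAt.congr_deriv ((hasDerivAt_id y).const_mul s).neg (by ring)
    have h2 : HasDerivAt G
        (k * W' (-(s * y)) * -s * (1 / r) * U (-(s * y)) ^ (1 / r - 1)) y := by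
      rw [hG]
      exact ((hUd (-(s * y))).comp y h1).rpow_const (Or.inl hp.ne')
    have h3 : HasDerivAt Y ((s ^ r)⁻¹ * (k * W' (G y) *
        (k * W' (-(s * y)) * -s * (1 / r) * U (-(s * y)) ^ (1 / r - 1)))) y := by
      rw [hY]
      exact ((hUd (G y)).comp y h2).const_mul (s ^ r)⁻¹
    rw [h3.deriv]
    refine mul_neg_of_pos_of_neg (inv_pos.2 hsr) (mul_neg_of_neg_of_pos (hUn _) ?_)
    have h4 : 0 < k * W' (-(s * y)) * -s := mul_pos_of_neg_of_neg (hUn _) (by linarith)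
    have h5 : (0 : ℝ) < 1 / r := by positivity
    exact mul_pos (mul_pos h4 h5) (Real.rpow_pos_of_pos hp _)
  · rw [hY, hG]
    simp only
    rw [mul_neg, neg_neg, hsb, hUx, one_div, Real.rpow_rpow_inv hx0.le hr0, hUx,
      Real.div_rpow hx0.le hs.le]
    field_simp
  · rw [hYU 1 ⟨by linarith, le_rfl⟩, hU1]
  · rw [hsb, hYU x ⟨by linarith, hx1.le⟩, hUx]
  · have hy' : y ∈ {y : ℝ | s * y > -1} := hsub ⟨hy.1, hy.2.trans hb1⟩
    have hyx : -(s * y) ≤ x := by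
      have := mul_le_mul_of_nonneg_left hy.1 hs.le
      rw [mul_neg, hsb] at this
      linarith
    have hys : s * y ≤ s := by nlinarith [hy.2]
    have hG0 : 0 < G y := by rw [hG]; exact Real.rpow_pos_of_pos (hpos y hy') _
    have hG1 : G y ≤ 1 := by
      rw [hG]
      refine Real.rpow_le_one (hpos y hy').le ?_ (by positivity)
      rw [← hUs]
      exact hUa.antitone (by linarith)
    refine ⟨G y, ⟨hG0.le, hG1⟩, ?_, ?_⟩
    · rw [hYU (G y) ⟨by linarith, hG1⟩, hY]
      simp only
      field_simp
    · rw [hGr y hy', hYU _ ⟨by linarith, by linarith⟩]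

/-- The inverse of a `C²` map of `[-1, 1]` with positive derivative is a `C²` diffeomorphism. -/
theorem exists_isDiffeo_inverse {Ψ : ℝ → ℝ} {O : Set ℝ} (hO : IsOpen O)
    (hIcc : Set.Icc (-1 : ℝ) 1 ⊆ O) (hΨ : ContDiffOn ℝ 2 Ψ O)
    (hpos : ∀ y ∈ Set.Icc (-1 : ℝ) 1, 0 < deriv Ψ y) (hm : Ψ (-1) = -1) (hp : Ψ 1 = 1) :
    ∃ φ d1 d2, IsDiffeo φ d1 d2 ∧ ∀ y ∈ Set.Icc (-1 : ℝ) 1, φ (Ψ y) = y := by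
  have hcont : ContinuousOn Ψ (Set.Icc (-1) 1) := hΨ.continuousOn.mono hIcc
  have hmono : StrictMonoOn Ψ (Set.Icc (-1) 1) :=
    strictMonoOn_of_deriv_pos (convex_Icc _ _) hcont fun y hy => hpos y (interior_subset hy)
  have hbij : Set.BijOn Ψ (Set.Icc (-1) 1) (Set.Icc (-1) 1) := by
    refine ⟨fun y hy => ⟨?_, ?_⟩, hmono.injOn, ?_⟩
    · rw [← hm]; exact hmono.monotoneOn (by norm_num) hy hy.1
    · rw [← hp]; exact hmono.monotoneOn hy (by norm_num) hy.2
    · have := intermediate_value_Icc (by norm_num : (-1 : ℝ) ≤ 1) hcont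
      rwa [hm, hp] at this
  obtain ⟨e, he⟩ : ∃ e, e = hbij.equiv Ψ := ⟨_, rfl⟩
  have hev : ∀ y, (e y : ℝ) = Ψ y := fun y => by rw [he]; rfl
  have hec : Continuous e := by
    refine continuous_induced_rng.2 ?_
    rw [show (Subtype.val ∘ e) = (Set.Icc (-1 : ℝ) 1).domRestrict Ψ from funext hev]
    exact continuousOn_iff_continuous_domRestrict.1 hcont
  have hsc : Continuous e.symm := hec.continuous_symm_of_equiv_compact_to_t2
  obtain ⟨φ, hφ⟩ : ∃ φ : ℝ → ℝ, φ = Set.IccExtend (by norm_num : (-1 : ℝ) ≤ 1)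
    (fun x => (e.symm x : ℝ)) := ⟨_, rfl⟩
  have hφc : Continuous φ := by
    rw [hφ]; exact (continuous_subtype_val.comp hsc).Icc_extend'
  have hφm : Set.MapsTo φ (Set.Icc (-1) 1) (Set.Icc (-1) 1) := fun x hx => by
    rw [hφ, Set.IccExtend_of_mem _ _ hx]; exact (e.symm _).2
  have hr : ∀ x ∈ Set.Icc (-1 : ℝ) 1, Ψ (φ x) = x := fun x hx => by
    rw [hφ, Set.IccExtend_of_mem _ _ hx, ← hev, Equiv.apply_symm_apply]
  have hl : ∀ y ∈ Set.Icc (-1 : ℝ) 1, φ (Ψ y) = y := fun y hy =>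
    hmono.injOn (hφm (hbij.mapsTo hy)) hy (hr _ (hbij.mapsTo hy))
  have hΨ' : ContDiffOn ℝ 1 (deriv Ψ) O := hΨ.deriv_of_isOpen hO (by norm_num)
  have hΨ'' : ContinuousOn (deriv (deriv Ψ)) O := hΨ'.continuousOn_deriv_of_isOpen hO le_rfl
  have hd : ∀ x ∈ Set.Icc (-1 : ℝ) 1,
      HasDerivWithinAt φ (deriv Ψ (φ x))⁻¹ (Set.Icc (-1 : ℝ) 1) x := by
    intro x hx
    have h1 : HasDerivAt Ψ (deriv Ψ (φ x)) (φ x) :=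
      ((hΨ.contDiffAt (hO.mem_nhds (hIcc (hφm hx)))).differentiableAt (by norm_num)).hasDerivAt
    have h2 := h1.hasFDerivAt_equiv (hpos _ (hφm hx)).ne'
    have h3 := HasFDerivWithinAt.of_local_left_inverse (s := Set.Icc (-1 : ℝ) 1) (t := Set.univ)
      (tendsto_nhdsWithin_of_tendsto_nhds_of_eventually_within _
        hφc.continuousAt.continuousWithinAt (by simp)) h2.hasFDerivWithinAt hx
      (Filter.eventually_of_mem self_mem_nhdsWithin hr)
    exact h3.hasDerivWithinAt.congr_deriv (by simp)
  refine ⟨φ, fun x => (deriv Ψ (φ x))⁻¹,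
    fun x => -(deriv (deriv Ψ) (φ x) * (deriv Ψ (φ x))⁻¹) / deriv Ψ (φ x) ^ 2,
    ⟨⟨hφm, ?_, ?_⟩, ?_, ?_, hd, fun x hx => ?_, ?_, ?_⟩, hl⟩
  · intro x hx y hy hxy
    rw [← hr x hx, ← hr y hy, hxy]
  · exact fun y hy => ⟨Ψ y, hbij.mapsTo hy, hl y hy⟩
  · nth_rewrite 1 [← hm]; exact hl _ (by norm_num)
  · nth_rewrite 1 [← hp]; exact hl _ (by norm_num)
  · have h1 : HasDerivAt (deriv Ψ) (deriv (deriv Ψ) (φ x)) (φ x) :=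
      ((hΨ'.contDiffAt (hO.mem_nhds (hIcc (hφm hx)))).differentiableAt (by norm_num)).hasDerivAt
    exact (h1.comp_hasDerivWithinAt x (hd x hx)).inv (hpos _ (hφm hx)).ne'
  · have h1 : ContinuousOn (fun x => deriv Ψ (φ x)) (Set.Icc (-1) 1) :=
      hΨ'.continuousOn.comp hφc.continuousOn fun x hx => hIcc (hφm hx)
    have h2 : ContinuousOn (fun x => deriv (deriv Ψ) (φ x)) (Set.Icc (-1) 1) :=
      hΨ''.comp hφc.continuousOn fun x hx => hIcc (hφm hx)
    exact (h2.mul (h1.inv₀ fun x hx => (hpos _ (hφm hx)).ne')).neg.div (h1.pow 2)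
      fun x hx => (pow_pos (hpos _ (hφm hx)) 2).ne'
  · exact fun x hx => inv_pos.2 (hpos _ (hφm hx))

/-- For every critical exponent `α > 1` the period-doubling renormalization operator has a
fixed point: there are `t ∈ (0,1]`, a C² orientation-preserving diffeomorphism `φ` of
`[-1,1]`, and `p ∈ (0,1)` such that `f = φ ∘ q_t` satisfies `f p = p`, `f 0 ∈ [p,1]`, and
`f (f (-p x)) = -p * f x` for all `x ∈ [-1,1]`. -/
theorem renormalization_period_doubling_fixed_point (α : ℝ) (hα : 1 < α) :
    ∃ t ∈ Set.Ioc (0 : ℝ) 1, ∃ φ d1 d2 : ℝ → ℝ, IsDiffeo φ d1 d2 ∧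
      ∃ p ∈ Set.Ioo (0 : ℝ) 1, ∃ f : ℝ → ℝ,
        (∀ x, f x = φ (foldMap α t x)) ∧
        f p = p ∧
        f 0 ∈ Set.Icc p 1 ∧
        ∀ x ∈ Set.Icc (-1 : ℝ) 1, f (f (-p * x)) = -p * f x := by
  obtain ⟨A, c, s, hA, hs, hsA, hc, hfix, hlt, hmap, hle⟩ := exists_fixed_profile hα
  have h : IsFixedProfile A c s α := ⟨hc, hA, hα, hs, hsA, hfix, hlt, hmap, hle⟩
  have hs1 := h.scale_lt_one
  have hα0 : α ≠ 0 := by linarith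
  obtain ⟨b, Y, O, hb, hsb, hO, hIcc, hYc, hYn, hYm, hY1, hYs, hYz⟩ := h.exists_transition
  have hb0 : 0 < b := by linarith
  have hK : 0 < b ^ α := Real.rpow_pos_of_pos hb0 α
  have hYa : StrictAntiOn Y (Set.Icc (-b) b) :=
    strictAntiOn_of_deriv_neg (convex_Icc _ _) (hYc.continuousOn.mono hIcc) fun y hy =>
      hYn y (interior_subset hy)
  have hYb : Y b ≤ 0 := by
    rw [← hY1]
    exact hYa.antitoneOn ⟨by linarith, hb⟩ ⟨by linarith, le_rfl⟩ hb
  obtain ⟨t, ht⟩ : ∃ t, t = b ^ α / (b ^ α - Y b) := ⟨_, rfl⟩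
  have ht0 : 0 < t := ht ▸ div_pos hK (by linarith)
  have ht1 : t ≤ 1 := by rw [ht, div_le_one (by linarith)]; linarith
  obtain ⟨k, hk⟩ : ∃ k, k = 2 * t / b ^ α := ⟨_, rfl⟩
  have hk0 : 0 < k := hk ▸ div_pos (by linarith) hK
  obtain ⟨Ψ, hΨ⟩ : ∃ Ψ : ℝ → ℝ, Ψ = fun y => 2 * t - 1 - k * Y (b * y) := ⟨_, rfl⟩
  have hmem : ∀ y ∈ Set.Icc (-1 : ℝ) 1, b * y ∈ Set.Icc (-b) b := fun y hy =>
    ⟨by nlinarith [hy.1], by nlinarith [hy.2]⟩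
  obtain ⟨φ, d1, d2, hφ, hinv⟩ := exists_isDiffeo_inverse (Ψ := Ψ) (O := (fun y => b * y) ⁻¹' O)
    (hO.preimage (by fun_prop)) (fun y hy => hIcc (hmem y hy)) (by
      rw [hΨ]
      exact contDiffOn_const.sub (contDiffOn_const.mul
        (hYc.comp (by fun_prop : ContDiffOn ℝ 2 (fun y => b * y) _) fun y hy => hy)))
    (fun y hy => by
      have h1 : HasDerivAt Y (deriv Y (b * y)) (b * y) :=
        ((hYc.contDiffAt (hO.mem_nhds (hIcc (hmem y hy)))).differentiableAt
          (by norm_num)).hasDerivAt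
      have h2 : HasDerivAt (fun y => b * y) b y :=
        HasDerivAt.congr_deriv ((hasDerivAt_id y).const_mul b) (mul_one b)
      have h3 : HasDerivAt Ψ (-(k * (deriv Y (b * y) * b))) y := by
        rw [hΨ]; exact ((h1.comp y h2).const_mul k).const_sub _
      rw [h3.deriv, neg_pos]
      exact mul_neg_of_pos_of_neg hk0 (mul_neg_of_neg_of_pos (hYn _ (hmem y hy)) hb0))
    (by rw [hΨ]; simp only; rw [mul_neg, mul_one, hYm, hk]; field_simp; ring)
    (by
      have : b ^ α - Y b ≠ 0 := by linarith
      rw [hΨ]; simp only; rw [mul_one, hk, ht]; field_simp; ring)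
  have key : ∀ x y, y ∈ Set.Icc (-b) b → Y y = (b * |x|) ^ α → φ (foldMap α t x) = y / b := by
    intro x y hy hxy
    have h1 : b * (y / b) = y := by field_simp
    rw [show foldMap α t x = Ψ (y / b) by
      rw [hΨ]
      simp only
      rw [h1, hxy, Real.mul_rpow hb0.le (abs_nonneg x), hk, foldMap]
      field_simp
      ring]
    exact hinv _ ⟨by rw [le_div_iff₀ hb0]; linarith [hy.1], by rw [div_le_one hb0]; exact hy.2⟩
  refine ⟨t, ⟨ht0, ht1⟩, φ, d1, d2, hφ, s, ⟨hs, hs1⟩, fun x => φ (foldMap α t x), fun x => rfl,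
    ?_, ?_, fun x hx => ?_⟩
  · simp only
    rw [key s (s * b) ⟨by nlinarith, by nlinarith⟩ (by rw [hYs, abs_of_pos hs, mul_comm])]
    field_simp
  · simp only
    rw [key 0 1 ⟨by linarith, hb⟩ (by rw [hY1, abs_zero, mul_zero, Real.zero_rpow hα0])]
    exact ⟨by rw [le_div_iff₀ hb0]; exact hsb.le, by rwa [div_le_one hb0]⟩
  · have hv : b * |x| ≤ b := by nlinarith [abs_le.2 ⟨hx.1, hx.2⟩]
    have hv0 : 0 ≤ b * |x| := by positivity
    obtain ⟨y, hy, hyx⟩ : (b * |x|) ^ α ∈ Y '' Set.Icc (-b) 1 := by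
      refine intermediate_value_Icc' (by linarith)
        (hYc.continuousOn.mono fun y hy => hIcc ⟨hy.1, hy.2.trans hb⟩) ⟨?_, ?_⟩
      · rw [hY1]; positivity
      · rw [hYm]; exact Real.rpow_le_rpow hv0 hv (by linarith)
    obtain ⟨z, hz, hzy, hzr⟩ := hYz y hy
    simp only
    rw [key x y ⟨hy.1, hy.2.trans hb⟩ hyx, key (-s * x) z ⟨by linarith [hz.1], hz.2.trans hb⟩ ?_,
      key (z / b) (-(s * y)) ⟨?_, ?_⟩ ?_]
    · ring
    · nlinarith [hy.2]
    · nlinarith [hy.1]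
    · rw [← hzr, abs_of_nonneg (div_nonneg hz.1 hb0.le)]
      congr 1
      field_simp
    · rw [hzy, hyx, ← Real.mul_rpow hs.le hv0, abs_mul, abs_neg, abs_of_pos hs]
      congr 1
      ring
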